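/- Let B be a set of points in the plane with no three collinear, where either |B| = 3, or |B| = 4 and the four points are not in convex position. Then there exists a finite set R of points, disjoint from B and with B ∪ R in strong general position, such that B is not separable from R. -/

import Mathlib

open scoped RealInnerProductSpace ENNReal Classical

noncomputable section

/-- Points of the Euclidean plane. -/
abbrev Pt : Type := EuclideanSpace ℝ (Fin 2)

/-- The planar determinant `det (u, v)` of two vectors. -/
def det2 (u v : Pt) : ℝ := u 0 * v 1 - u 1 * v 0

/-- No three of the points of `S` are collinear. -/
def NoThreeCollinear (S : Set Pt) : Prop :=
  ∀ p ∈ S, ∀ q ∈ S, ∀ r ∈ S, p ≠ q → p ≠ r → q ≠ r → det2 (q - p) (r - p) ≠ 0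

/-- `S` is in strong general position: no three points are collinear and for any four
distinct points `p₁ p₂ p₃ p₄` the line through `p₁,p₂` is not parallel to the line
through `p₃,p₄`. -/
def StrongGenPos (S : Set Pt) : Prop :=
  NoThreeCollinear S ∧
    ∀ p₁ ∈ S, ∀ p₂ ∈ S, ∀ p₃ ∈ S, ∀ p₄ ∈ S,
      p₁ ≠ p₂ → p₁ ≠ p₃ → p₁ ≠ p₄ → p₂ ≠ p₃ → p₂ ≠ p₄ → p₃ ≠ p₄ →
        det2 (p₂ - p₁) (p₄ - p₃) ≠ 0

/-- A simple polygon, given by a cyclic sequence of `n ≥ 3` distinct vertices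
(encoded as an `n`-periodic function `ℕ → Pt`), such that no point of the plane lies on
more than two closed edges, and the only points lying on exactly two edges are vertices. -/
structure SimplePolygon where
  n : ℕ
  three_le : 3 ≤ n
  vtx : ℕ → Pt
  periodic : ∀ i, vtx (i + n) = vtx i
  inj : ∀ i < n, ∀ j < n, vtx i = vtx j → i = j
  simple : ∀ x : Pt, {i | i < n ∧ x ∈ segment ℝ (vtx i) (vtx (i + 1))}.ncard ≤ 2
  vtx_of_two : ∀ x : Pt,
    {i | i < n ∧ x ∈ segment ℝ (vtx i) (vtx (i + 1))}.ncard = 2 → ∃ i < n, x = vtx i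

namespace SimplePolygon

/-- The boundary of a simple polygon: the union of its closed edges. -/
def boundary (P : SimplePolygon) : Set Pt :=
  ⋃ i ∈ Finset.range P.n, segment ℝ (P.vtx i) (P.vtx (i + 1))

/-- The interior of a simple polygon: the union of the bounded connected components of the
complement of the boundary. -/
def interior (P : SimplePolygon) : Set Pt :=
  {x | x ∉ P.boundary ∧ Bornology.IsBounded (connectedComponentIn P.boundaryᶜ x)}

/-- A simple polygon, regarded as a point set: boundary together with interior. -/
def region (P : SimplePolygon) : Set Pt := P.boundary ∪ P.interior

/-- The set of vertices of the polygon. -/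
def vertexSet (P : SimplePolygon) : Set Pt := {x | ∃ i < P.n, x = P.vtx i}

/-- Twice the shoelace signed area. -/
def shoelace (P : SimplePolygon) : ℝ := ∑ i ∈ Finset.range P.n, det2 (P.vtx i) (P.vtx (i + 1))

/-- The vertices are listed in counterclockwise order (positive shoelace signed area). -/
def CCW (P : SimplePolygon) : Prop := 0 < P.shoelace

/-- The vertex `vtx (i+1)` is a convex vertex:
`det (v_{i+1} − v_i, v_{i+2} − v_{i+1}) > 0` (vertices listed counterclockwise). -/
def ConvexAt (P : SimplePolygon) (i : ℕ) : Prop :=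
  0 < det2 (P.vtx (i + 1) - P.vtx i) (P.vtx (i + 2) - P.vtx (i + 1))

/-- The number of convex vertices of the polygon. -/
def numConvex (P : SimplePolygon) : ℕ := {i | i < P.n ∧ P.ConvexAt i}.ncard

/-- Continuous paths from `s` to `t` staying inside the polygon. -/
def pathsIn (P : SimplePolygon) (s t : Pt) : Set (ℝ → Pt) :=
  {γ | ContinuousOn γ (Set.Icc 0 1) ∧ γ 0 = s ∧ γ 1 = t ∧ γ '' Set.Icc (0 : ℝ) 1 ⊆ P.region}

/-- The geodesic distance between `s` and `t` inside the polygon: the infimum of the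
lengths (total variations) of continuous paths in the polygon from `s` to `t`. -/
def geodDist (P : SimplePolygon) (s t : Pt) : ℝ≥0∞ :=
  ⨅ γ ∈ P.pathsIn s t, eVariationOn γ (Set.Icc 0 1)

end SimplePolygon

/-- Length of a polygonal path through a list of points. -/
def polylineLen : List Pt → ℝ
  | [] => 0
  | [_] => 0
  | a :: b :: l => dist a b + polylineLen (b :: l)

/-- The polygonal path through a list of points, as a point set. -/
def polylineSet : List Pt → Set Pt
  | [] => ∅
  | [a] => {a}
  | a :: b :: l => segment ℝ a b ∪ polylineSet (b :: l)

/-- `L` is the vertex sequence of the geodesic from `s` to `t` inside the polygon `P`: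
a polygonal path inside `P` from `s` to `t`, with consecutive vertices distinct, with no
three consecutive vertices collinear, whose length realizes the geodesic distance. -/
def SimplePolygon.IsGeodesicChain (P : SimplePolygon) (s t : Pt) (L : List Pt) : Prop :=
  L.head? = some s ∧ L.getLast? = some t ∧ List.Chain' (· ≠ ·) L ∧
  (∀ i, i + 2 < L.length →
      det2 (L.getD (i + 1) 0 - L.getD i 0) (L.getD (i + 2) 0 - L.getD i 0) ≠ 0) ∧
  polylineSet L ⊆ P.region ∧
  ENNReal.ofReal (polylineLen L) = P.geodDist s t

/-- The triple `(p,q,r)` is in geodesic counterclockwise order with respect to `P`: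
writing the geodesics `π(p,q) = ⟨p = v₀, …, v_k = q⟩` and `π(p,r) = ⟨p = u₀, …, u_{k'} = r⟩`
and taking the smallest index `i > 0` with `v_i ≠ u_i`, we have
`det (v_i − v_{i−1}, u_i − v_{i−1}) > 0`. -/
def geodesicCCW (P : SimplePolygon) (p q r : Pt) : Prop :=
  ∃ L M : List Pt, P.IsGeodesicChain p q L ∧ P.IsGeodesicChain p r M ∧
    ∃ i : ℕ, 0 < i ∧ (∀ j < i, L[j]? = M[j]?) ∧ L[i]? ≠ M[i]? ∧
      ∃ a b c : Pt, L[i - 1]? = some a ∧ L[i]? = some b ∧ M[i]? = some c ∧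
        0 < det2 (b - a) (c - a)

/-- The triple `(p,q,r)` is in geodesic clockwise order with respect to `P`. -/
def geodesicCW (P : SimplePolygon) (p q r : Pt) : Prop :=
  ∃ L M : List Pt, P.IsGeodesicChain p q L ∧ P.IsGeodesicChain p r M ∧
    ∃ i : ℕ, 0 < i ∧ (∀ j < i, L[j]? = M[j]?) ∧ L[i]? ≠ M[i]? ∧
      ∃ a b c : Pt, L[i - 1]? = some a ∧ L[i]? = some b ∧ M[i]? = some c ∧
        det2 (b - a) (c - a) < 0

/-- `C ⊆ P` is geodesically convex: for all `p, q ∈ C` the geodesic connecting them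
stays inside `C`. -/
def GeodesicallyConvex (P : SimplePolygon) (C : Set Pt) : Prop :=
  C ⊆ P.region ∧ ∀ p ∈ C, ∀ q ∈ C, ∀ L, P.IsGeodesicChain p q L → polylineSet L ⊆ C

/-- The geodesic hull `CH_P(U)`: the intersection of all geodesically convex subsets of `P`
containing `U`. -/
def geodesicHull (P : SimplePolygon) (U : Set Pt) : Set Pt :=
  ⋂₀ {C | GeodesicallyConvex P C ∧ U ⊆ C}

/-- `E_P(S)`: the set of points of `S` lying on the (topological) boundary of the geodesic
hull of `S` with respect to `P`. -/
def extremeSet (P : SimplePolygon) (S : Set Pt) : Set Pt :=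
  {x ∈ S | x ∈ frontier (geodesicHull P S)}

/-- `B` is separable from `R`: there is a simple polygon with at most `|B|` convex vertices
whose interior contains all points of `R` and which contains no point of `B`. -/
def Separable (B R : Finset Pt) : Prop :=
  ∃ P : SimplePolygon, P.CCW ∧ P.numConvex ≤ B.card ∧
    (∀ r ∈ R, r ∈ P.interior) ∧ ∀ b ∈ B, b ∉ P.region

/-! ### Planar determinants -/

lemma det2_add_right (u v w : Pt) : det2 u (v + w) = det2 u v + det2 u w := by
  simp [det2]; ring

lemma det2_sub_left (u v w : Pt) : det2 (u - v) w = det2 u w - det2 v w := by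
  simp [det2]; ring

lemma det2_sub_right (u v w : Pt) : det2 u (v - w) = det2 u v - det2 u w := by
  simp [det2]; ring

lemma det2_smul_left (a : ℝ) (u v : Pt) : det2 (a • u) v = a * det2 u v := by
  simp [det2]; ring

lemma det2_smul_right (a : ℝ) (u v : Pt) : det2 u (a • v) = a * det2 u v := by
  simp [det2]; ring

lemma det2_neg_left (u v : Pt) : det2 (-u) v = -det2 u v := by
  simp [det2]; ring

lemma det2_neg_right (u v : Pt) : det2 u (-v) = -det2 u v := by
  simp [det2]; ring

@[simp] lemma det2_self (u : Pt) : det2 u u = 0 := by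
  simp [det2]; ring

@[simp] lemma det2_zero_left (u : Pt) : det2 0 u = 0 := by
  simp [det2]

@[simp] lemma det2_zero_right (u : Pt) : det2 u 0 = 0 := by
  simp [det2]

lemma det2_swap (u v : Pt) : det2 u v = -det2 v u := by
  simp [det2]; ring

lemma inner_eq_coord (u v : Pt) : inner ℝ u v = u 0 * v 0 + u 1 * v 1 := by
  simp [PiLp.inner_apply, Fin.sum_univ_two]; ring

lemma norm_sq_eq_coord (u : Pt) : ‖u‖ ^ 2 = u 0 ^ 2 + u 1 ^ 2 := by
  simp [EuclideanSpace.norm_sq_eq, Fin.sum_univ_two]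

lemma det2_sq_add_inner_sq (u v : Pt) : det2 u v ^ 2 + inner ℝ u v ^ 2 = ‖u‖ ^ 2 * ‖v‖ ^ 2 := by
  rw [inner_eq_coord, norm_sq_eq_coord, norm_sq_eq_coord, det2]; ring

lemma abs_det2_le (u v : Pt) : |det2 u v| ≤ ‖u‖ * ‖v‖ := by
  apply abs_le_of_sq_le_sq _ (by positivity)
  nlinarith [det2_sq_add_inner_sq u v, sq_nonneg (inner ℝ u v)]

lemma det2_cramer (u v e : Pt) : det2 u v • e = det2 e v • u + det2 u e • v := by
  ext i; fin_cases i <;> simp [det2] <;> ring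

lemma exists_coords_of_det2_ne_zero {u v : Pt} (h : det2 u v ≠ 0) (e : Pt) :
    e = (det2 e v / det2 u v) • u + (det2 u e / det2 u v) • v := by
  have := det2_cramer u v e
  rw [div_eq_inv_mul, div_eq_inv_mul, mul_smul, mul_smul, ← smul_add, ← this, smul_smul,
    inv_mul_cancel₀ h, one_smul]

@[fun_prop] lemma Continuous.det2 {X : Type*} [TopologicalSpace X] {f g : X → Pt}
    (hf : Continuous f) (hg : Continuous g) : Continuous fun x => det2 (f x) (g x) := by
  unfold _root_.det2; fun_prop

/-- A vector with given coordinates. -/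
def mkPt (a b : ℝ) : Pt := !₂[a, b]

@[simp] lemma mkPt_zero (a b : ℝ) : mkPt a b 0 = a := rfl
@[simp] lemma mkPt_one (a b : ℝ) : mkPt a b 1 = b := rfl

lemma Pt.ext_coord {u v : Pt} (h0 : u 0 = v 0) (h1 : u 1 = v 1) : u = v := by
  ext i; fin_cases i <;> assumption

/-- Rotation by a right angle. -/
def rot (u : Pt) : Pt := mkPt (-u 1) (u 0)

lemma det2_rot (u : Pt) : det2 u (rot u) = ‖u‖ ^ 2 := by
  rw [norm_sq_eq_coord]; simp [det2, rot]; ring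

lemma det2_rot_right (u v : Pt) : det2 u (rot v) = inner ℝ u v := by
  rw [inner_eq_coord]; simp [det2, rot]

lemma norm_rot (u : Pt) : ‖rot u‖ = ‖u‖ := by
  have h : ‖rot u‖ ^ 2 = ‖u‖ ^ 2 := by
    rw [norm_sq_eq_coord, norm_sq_eq_coord]; simp [rot]; ring
  exact (sq_eq_sq₀ (norm_nonneg _) (norm_nonneg _)).1 h

lemma exists_det2_eq_clm (f : Pt →L[ℝ] ℝ) : ∃ u, ∀ x, f x = det2 u x := by
  refine ⟨mkPt (f (mkPt 0 1)) (-f (mkPt 1 0)), fun x => ?_⟩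
  have : x = x 0 • mkPt 1 0 + x 1 • mkPt 0 1 := Pt.ext_coord (by simp) (by simp)
  conv_lhs => rw [this]
  simp [det2]; ring

lemma exists_det2_pos {u : Pt} (hu : u ≠ 0) : ∃ w, 0 < det2 u w :=
  ⟨rot u, by rw [det2_rot]; positivity⟩

lemma eq_zero_of_det2_eq_zero {u v w : Pt} (huv : det2 u v ≠ 0) (h1 : det2 u w = 0)
    (h2 : det2 v w = 0) : w = 0 := by
  rw [exists_coords_of_det2_ne_zero huv w, h1, det2_swap w v, h2]; simp

/-! ### Notches and convexity -/

/-- The set `W` contains, near `p`, an open half-disc bounded by a line through `p`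
together with one of the two open segments of that line ending in `p`. -/
def Notched (W : Set Pt) (p : Pt) : Prop :=
  ∃ v w : Pt, det2 v w ≠ 0 ∧ ∃ r > (0 : ℝ),
    (∀ α β : ℝ, |α| < r → 0 < β → β < r → p + α • v + β • w ∈ W) ∧
    (∀ α : ℝ, 0 < α → α < r → p + α • v ∈ W)

lemma Notched.mono {W W' : Set Pt} {p : Pt} (h : Notched W p) (hW : W ⊆ W') : Notched W' p := by
  obtain ⟨v, w, hvw, r, hr, h1, h2⟩ := h
  exact ⟨v, w, hvw, r, hr, fun α β a b c => hW (h1 α β a b c), fun α a b => hW (h2 α a b)⟩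

/-- Two parameters `α`, `η` witness that an open set convex near a notch contains its apex. -/
lemma Notched.mem_of_convex_inter_ball {S : Set Pt} {p : Pt} (h : Notched S p) (hS : IsOpen S)
    {ρ : ℝ} (hρ : 0 < ρ) (hc : Convex ℝ (S ∩ Metric.ball p ρ)) : p ∈ S := by
  obtain ⟨v, w, hvw, r, hr, h1, h2⟩ := h
  have t1 : Filter.Tendsto (fun α : ℝ => p + α • v) (nhdsWithin 0 (Set.Ioi 0)) (nhds p) := by
    have : Continuous fun α : ℝ => p + α • v := by fun_prop
    simpa using (this.tendsto 0).mono_left nhdsWithin_le_nhds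
  obtain ⟨α, hα, hα0, hα1⟩ : ∃ α : ℝ, p + α • v ∈ Metric.ball p ρ ∧ 0 < α ∧ α < r :=
    ((t1.eventually (Metric.ball_mem_nhds p hρ)).and (Ioo_mem_nhdsGT hr)).exists
  have hαS : p + α • v ∈ S := h2 α hα0 hα1
  have t2 : Filter.Tendsto (fun η : ℝ => p + α • v - η • w) (nhdsWithin 0 (Set.Ioi 0))
      (nhds (p + α • v)) := by
    have : Continuous fun η : ℝ => p + α • v - η • w := by fun_prop
    simpa using (this.tendsto 0).mono_left nhdsWithin_le_nhds
  have t3 : Filter.Tendsto (fun η : ℝ => p - α • v + η • w) (nhdsWithin 0 (Set.Ioi 0))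
      (nhds (p - α • v)) := by
    have : Continuous fun η : ℝ => p - α • v + η • w := by fun_prop
    simpa using (this.tendsto 0).mono_left nhdsWithin_le_nhds
  have hα' : p - α • v ∈ Metric.ball p ρ := by
    simpa [dist_eq_norm] using hα
  obtain ⟨η, hη1, hη2, hη3, hη0, hηr⟩ := ((t2.eventually (hS.mem_nhds hαS)).and
    ((t2.eventually (Metric.isOpen_ball.mem_nhds hα)).and
    ((t3.eventually (Metric.isOpen_ball.mem_nhds hα')).and
      (Ioo_mem_nhdsGT hr)))).exists
  have h3 : p - α • v + η • w ∈ S := by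
    have := h1 (-α) η (by rw [abs_neg, abs_of_pos hα0]; exact hα1) hη0 hηr
    simpa [sub_eq_add_neg] using this
  have := hc.midpoint_mem ⟨hη1, hη2⟩ ⟨h3, hη3⟩
  have e : midpoint ℝ (p + α • v - η • w) (p - α • v + η • w) = p := by
    rw [midpoint_eq_smul_add, show p + α • v - η • w + (p - α • v + η • w) = (2 : ℝ) • p by
      rw [two_smul]; abel, smul_smul]
    simp
  rw [e] at this
  exact this.1

lemma Notched.mem_of_convex {S : Set Pt} {p : Pt} (h : Notched S p) (hS : IsOpen S)
    (hc : Convex ℝ S) : p ∈ S :=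
  h.mem_of_convex_inter_ball hS one_pos (hc.inter (convex_ball p 1))

lemma mem_segment_add_iff (b v x : Pt) :
    x ∈ segment ℝ b (b + v) ↔ ∃ t : ℝ, 0 ≤ t ∧ t ≤ 1 ∧ x = b + t • v := by
  rw [segment_eq_image']
  constructor
  · rintro ⟨t, ⟨h0, h1⟩, rfl⟩; exact ⟨t, h0, h1, by simp⟩
  · rintro ⟨t, h0, h1, rfl⟩; exact ⟨t, ⟨h0, h1⟩, by simp⟩

lemma triangle_subset_of_not_notched {W : Set Pt} (hW : IsOpen W) (hn : ∀ p, p ∉ W → ¬ Notched W p)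
    {b v w : Pt} (hdet : det2 v w ≠ 0)
    (h1 : ∀ t : ℝ, 0 ≤ t → t ≤ 1 → b + t • v ∈ W) (h2 : ∀ t : ℝ, 0 ≤ t → t ≤ 1 → b + t • w ∈ W)
    {l m : ℝ} (hl : 0 ≤ l) (hm : 0 ≤ m) (hlm : l + m ≤ 1) : b + l • v + m • w ∈ W := by
  by_contra hbad
  let Bad : Set (ℝ × ℝ) := {x | 0 ≤ x.1 ∧ 0 ≤ x.2 ∧ x.1 + x.2 ≤ 1 ∧ b + x.1 • v + x.2 • w ∈ Wᶜ}
  have hcl : IsClosed Bad := by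
    have c1 : IsClosed {x : ℝ × ℝ | 0 ≤ x.1} := isClosed_le (by fun_prop) (by fun_prop)
    have c2 : IsClosed {x : ℝ × ℝ | 0 ≤ x.2} := isClosed_le (by fun_prop) (by fun_prop)
    have c3 : IsClosed {x : ℝ × ℝ | x.1 + x.2 ≤ 1} := isClosed_le (by fun_prop) (by fun_prop)
    have c4 : IsClosed {x : ℝ × ℝ | b + x.1 • v + x.2 • w ∈ Wᶜ} :=
      hW.isClosed_compl.preimage (by fun_prop)
    exact c1.inter (c2.inter (c3.inter c4))
  have hcomp : IsCompact Bad := by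
    refine (isCompact_Icc (a := (0 : ℝ × ℝ)) (b := 1)).of_isClosed_subset hcl ?_
    rintro ⟨x, y⟩ ⟨h0, h1, h2, -⟩
    simp only at h0 h1 h2
    exact ⟨⟨h0, h1⟩, ⟨by simp; linarith, by simp; linarith⟩⟩
  obtain ⟨z, hz, hzmin⟩ := hcomp.exists_isMinOn ⟨(l, m), hl, hm, hlm, hbad⟩
    (f := fun x : ℝ × ℝ => x.1 + x.2) (by fun_prop)
  have hcomp2 : IsCompact (Bad ∩ {x | x.1 + x.2 = z.1 + z.2}) :=
    hcomp.inter_right (isClosed_eq (by fun_prop) (by fun_prop))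
  obtain ⟨y, ⟨hy, hyz⟩, hymin⟩ := hcomp2.exists_isMinOn ⟨z, hz, rfl⟩
    (f := fun x : ℝ × ℝ => x.2) (by fun_prop)
  have hmin1 : ∀ l m : ℝ, 0 ≤ l → 0 ≤ m → l + m < y.1 + y.2 → b + l • v + m • w ∈ W := by
    intro l m hl hm hlt
    by_contra hb
    have := hzmin (show ((l, m) : ℝ × ℝ) ∈ Bad from ⟨hl, hm, by
      have := hy.2.2.1; simp only; linarith, hb⟩)
    simp only [Set.mem_ofPred_eq] at this hyz
    linarith
  have hmin2 : ∀ l m : ℝ, 0 ≤ l → 0 ≤ m → l + m = y.1 + y.2 → m < y.2 →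
      b + l • v + m • w ∈ W := by
    intro l m hl hm hlt hmy
    by_contra hb
    have := hymin (show ((l, m) : ℝ × ℝ) ∈ Bad ∩ {x | x.1 + x.2 = z.1 + z.2} from ⟨⟨hl, hm, by
      have := hy.2.2.1; simp only; linarith, hb⟩, by
      simp only [Set.mem_ofPred_eq] at hyz ⊢; linarith⟩)
    simp only [Set.mem_ofPred_eq] at this
    linarith
  obtain ⟨⟨y1, y2⟩, hy', hyz'⟩ : ∃ y', y' = y ∧ True := ⟨y, rfl, trivial⟩
  subst hy'
  obtain ⟨hy1, hy2, hy12, hyW⟩ := hy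
  simp only at hy1 hy2 hy12 hyW hmin1 hmin2
  have y1pos : 0 < y1 := by
    rcases hy1.lt_or_eq with h | h
    · exact h
    · subst h; exact absurd (by simpa using h2 y2 hy2 (by linarith)) hyW
  have y2pos : 0 < y2 := by
    rcases hy2.lt_or_eq with h | h
    · exact h
    · subst h; exact absurd (by simpa using h1 y1 hy1 (by linarith)) hyW
  refine hn _ hyW ⟨v - w, -(y1 • v + y2 • w), ?_, min (min (y1/2) (y2/2)) (1/2), by positivity,
    ?_, ?_⟩
  · have : det2 (v - w) (-(y1 • v + y2 • w)) = -((y1 + y2) * det2 v w) := by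
      simp [det2]; ring
    rw [this]
    exact neg_ne_zero.2 (mul_ne_zero (by positivity) hdet)
  · intro α β hα hβ0 hβ
    simp only [lt_min_iff] at hα hβ
    have e : b + y1 • v + y2 • w + α • (v - w) + β • -(y1 • v + y2 • w)
        = b + ((1 - β) * y1 + α) • v + ((1 - β) * y2 - α) • w := by module
    rw [e]
    have ha := abs_lt.1 hα.1.1
    have hb := abs_lt.1 hα.1.2
    apply hmin1 <;> nlinarith
  · intro α hα0 hα
    simp only [lt_min_iff] at hα
    have e : b + y1 • v + y2 • w + α • (v - w) = b + (y1 + α) • v + (y2 - α) • w := by module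
    rw [e]
    apply hmin2 <;> linarith

/-- A connected open set without notches at outside points is convex. -/
theorem convex_of_not_notched {W : Set Pt} (hW : IsOpen W) (hpc : IsPreconnected W)
    (hn : ∀ p, p ∉ W → ¬ Notched W p) : Convex ℝ W := by
  rw [convex_iff_segment_subset]
  intro x hx y hy
  refine hpc.induction₂ (fun x y => segment ℝ x y ⊆ W) ?_ ?_ ?_ hx hy
  · intro x hx
    obtain ⟨r, hr, hb⟩ := Metric.isOpen_iff.1 hW x hx
    filter_upwards [mem_nhdsWithin_of_mem_nhds (Metric.ball_mem_nhds x hr)] with y hy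
    exact ((convex_ball x r).segment_subset (Metric.mem_ball_self hr) hy).trans hb
  · intro a b c ha hb hc hab hbc
    have hba : ∀ t : ℝ, 0 ≤ t → t ≤ 1 → b + t • (a - b) ∈ W := fun t h0 h1 =>
      hab (by rw [segment_symm, segment_eq_image']; exact ⟨t, ⟨h0, h1⟩, rfl⟩)
    have hbc' : ∀ t : ℝ, 0 ≤ t → t ≤ 1 → b + t • (c - b) ∈ W := fun t h0 h1 =>
      hbc (by rw [segment_eq_image']; exact ⟨t, ⟨h0, h1⟩, rfl⟩)
    by_cases hdet : det2 (a - b) (c - b) = 0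
    · by_cases hca : c = b
      · subst hca; exact hab
      obtain ⟨s, hs⟩ : ∃ s : ℝ, a - b = s • (c - b) := by
        have h := det2_cramer (c - b) (rot (c - b)) (a - b)
        rw [det2_swap (c - b) (a - b), hdet, neg_zero, zero_smul, add_zero, det2_rot] at h
        have h0 : ‖c - b‖ ^ 2 ≠ 0 := by simp [sub_eq_zero, hca]
        refine ⟨(‖c - b‖ ^ 2)⁻¹ * det2 (a - b) (rot (c - b)), ?_⟩
        rw [mul_smul, ← h, smul_smul, inv_mul_cancel₀ h0, one_smul]
      have ha' : a = b + s • (c - b) := by rw [← hs]; abel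
      rintro _ ⟨p, q, hp, hq, hpq, rfl⟩
      have e : p • a + q • c = b + (p * s + q) • (c - b) := by
        rw [ha', show p = 1 - q by linarith]; module
      rw [e]
      rcases le_or_gt 0 (p * s + q) with h | h
      · rcases le_or_gt (p * s + q) 1 with h' | h'
        · exact hbc' _ h h'
        · have hs1 : 1 < s := by by_contra hh; nlinarith
          have := hba ((p * s + q) / s) (by positivity)
            (by rw [div_le_one (by linarith)]; nlinarith)
          rwa [hs, smul_smul, div_mul_cancel₀ _ (by linarith)] at this
      · have hs1 : s < 0 := by by_contra hh; push Not at hh; nlinarith [mul_nonneg hp hh]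
        have := hba ((p * s + q) / s) (div_nonneg_of_nonpos h.le hs1.le)
            (by rw [div_le_one_of_neg hs1]; nlinarith)
        rwa [hs, smul_smul, div_mul_cancel₀ _ hs1.ne] at this
    · rintro _ ⟨p, q, hp, hq, hpq, rfl⟩
      have e : p • a + q • c = b + p • (a - b) + q • (c - b) := by
        rw [show p = 1 - q by linarith]; module
      rw [e]
      exact triangle_subset_of_not_notched hW hn hdet hba hbc' hp hq hpq.le
  · intro x y _ _ h
    rwa [segment_symm]

/-- If an open set has no notches at outside points, its components are convex. -/
theorem convex_component_of_not_notched {U : Set Pt} (hU : IsOpen U)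
    (hn : ∀ p, p ∉ U → ¬ Notched U p) (x : Pt) : Convex ℝ (connectedComponentIn U x) := by
  refine convex_of_not_notched hU.connectedComponentIn isPreconnected_connectedComponentIn ?_
  rintro p hp ⟨v, w, hvw, r, hr, h1, h2⟩
  have hN : Notched (connectedComponentIn U x) p := ⟨v, w, hvw, r, hr, h1, h2⟩
  have hpU : p ∈ U := by
    by_contra hpU
    exact hn p hpU (hN.mono (connectedComponentIn_subset U x))
  obtain ⟨ρ, hρ, hb⟩ := Metric.isOpen_iff.1 hU p hpU
  have t1 : Filter.Tendsto (fun α : ℝ => p + α • v) (nhdsWithin 0 (Set.Ioi 0)) (nhds p) := by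
    have : Continuous fun α : ℝ => p + α • v := by fun_prop
    simpa using (this.tendsto 0).mono_left nhdsWithin_le_nhds
  obtain ⟨α, hα, hα0, hα1⟩ : ∃ α : ℝ, p + α • v ∈ Metric.ball p ρ ∧ 0 < α ∧ α < r :=
    ((t1.eventually (Metric.ball_mem_nhds p hρ)).and (Ioo_mem_nhdsGT hr)).exists
  have h3 := h2 α hα0 hα1
  rw [connectedComponentIn_eq h3] at hp
  exact hp ((convex_ball p ρ).isPreconnected.subset_connectedComponentIn hα hb
    (Metric.mem_ball_self hρ))

/-! ### Edges and local structure of a simple polygon -/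

namespace SimplePolygon

variable (P : SimplePolygon)

/-- The closed edge with index `i`. -/
def edge (i : ℕ) : Set Pt := segment ℝ (P.vtx i) (P.vtx (i + 1))

/-- The direction of the edge with index `i`. -/
def dir (i : ℕ) : Pt := P.vtx (i + 1) - P.vtx i

lemma n_pos : 0 < P.n := lt_of_lt_of_le (by norm_num) P.three_le

lemma vtx_mod (i : ℕ) : P.vtx (i % P.n) = P.vtx i :=
  Function.Periodic.map_mod_nat (f := P.vtx) P.periodic i

lemma vtx_eq_iff {i j : ℕ} : P.vtx i = P.vtx j ↔ i % P.n = j % P.n := by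
  constructor
  · intro h
    rw [← P.vtx_mod i, ← P.vtx_mod j] at h
    exact P.inj _ (Nat.mod_lt _ P.n_pos) _ (Nat.mod_lt _ P.n_pos) h
  · intro h
    rw [← P.vtx_mod i, ← P.vtx_mod j, h]

lemma mod_succ_ne (i : ℕ) : i % P.n ≠ (i + 1) % P.n := by
  intro h
  have h1 : i ≡ i + 1 [MOD P.n] := h
  have h2 : P.n ∣ 1 := (Nat.modEq_iff_dvd' (by omega)).1 h1 |>.trans (by simp)
  have := P.three_le
  have := Nat.le_of_dvd one_pos h2
  omega

lemma vtx_succ_ne (i : ℕ) : P.vtx (i + 1) ≠ P.vtx i := fun h =>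
  P.mod_succ_ne i (P.vtx_eq_iff.1 h.symm)

lemma dir_ne_zero (i : ℕ) : P.dir i ≠ 0 := sub_ne_zero.2 (P.vtx_succ_ne i)

lemma vtx_add_dir (i : ℕ) : P.vtx i + P.dir i = P.vtx (i + 1) := by
  simp [dir]

lemma edge_mod (i : ℕ) : P.edge (i % P.n) = P.edge i := by
  unfold edge
  rw [P.vtx_mod i, P.vtx_eq_iff.2 (show (i % P.n + 1) % P.n = (i + 1) % P.n by simp)]

lemma edge_eq_of_mod {i j : ℕ} (h : i % P.n = j % P.n) : P.edge i = P.edge j := by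
  rw [← P.edge_mod i, h, P.edge_mod]

lemma left_mem_edge (i : ℕ) : P.vtx i ∈ P.edge i := left_mem_segment ..
lemma right_mem_edge (i : ℕ) : P.vtx (i + 1) ∈ P.edge i := right_mem_segment ..

lemma mem_edge_iff {i : ℕ} {x : Pt} :
    x ∈ P.edge i ↔ ∃ t : ℝ, 0 ≤ t ∧ t ≤ 1 ∧ x = P.vtx i + t • P.dir i := by
  rw [← mem_segment_add_iff, vtx_add_dir]; rfl

lemma mem_boundary_iff {x : Pt} : x ∈ P.boundary ↔ ∃ i, x ∈ P.edge i := by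
  simp only [boundary, Set.mem_iUnion, Finset.mem_range, exists_prop]
  constructor
  · rintro ⟨i, -, h⟩; exact ⟨i, h⟩
  · rintro ⟨i, h⟩
    exact ⟨i % P.n, Nat.mod_lt _ P.n_pos, by rw [← edge_mod] at h; exact h⟩

lemma edge_subset_boundary (i : ℕ) : P.edge i ⊆ P.boundary := fun _ h =>
  P.mem_boundary_iff.2 ⟨i, h⟩

lemma isCompact_edge (i : ℕ) : IsCompact (P.edge i) := by
  unfold edge
  rw [segment_eq_image']
  exact isCompact_Icc.image (by fun_prop)

lemma isCompact_boundary : IsCompact P.boundary :=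
  (Finset.range P.n).isCompact_biUnion fun i _ => P.isCompact_edge i

lemma boundary_nonempty : P.boundary.Nonempty := ⟨_, P.edge_subset_boundary 0 (P.left_mem_edge 0)⟩

/-- The indices below `n` of the edges through `x`. -/
lemma edges_finite (x : Pt) : {i | i < P.n ∧ x ∈ P.edge i}.Finite :=
  (Set.finite_lt_nat P.n).subset fun _ h => h.1

lemma mod_mem {i : ℕ} {x : Pt} (h : x ∈ P.edge i) :
    i % P.n ∈ {i | i < P.n ∧ x ∈ P.edge i} :=
  ⟨Nat.mod_lt _ P.n_pos, by rwa [edge_mod]⟩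

lemma edges_at_vertex {i j : ℕ} (h : P.vtx (i + 1) ∈ P.edge j) :
    j % P.n = i % P.n ∨ j % P.n = (i + 1) % P.n := by
  by_contra! hne
  have hs : ({j % P.n, i % P.n, (i + 1) % P.n} : Set ℕ) ⊆
      {j | j < P.n ∧ P.vtx (i + 1) ∈ P.edge j} := by
    rintro k (rfl | rfl | rfl)
    exacts [P.mod_mem h, P.mod_mem (P.right_mem_edge i), P.mod_mem (P.left_mem_edge (i + 1))]
  have h1 := Set.ncard_le_ncard hs (P.edges_finite _)
  have h2 := P.simple (P.vtx (i + 1))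
  have h3 : ({j % P.n, i % P.n, (i + 1) % P.n} : Set ℕ).ncard = 3 := by
    rw [Set.ncard_eq_toFinset_card']
    simp [Finset.card_insert_of_notMem, hne.1, hne.2, P.mod_succ_ne i]
  have : {j | j < P.n ∧ P.vtx (i + 1) ∈ P.edge j}.ncard ≤ 2 := h2
  omega

lemma exists_vtx_succ (m : ℕ) : ∃ i < P.n, P.vtx m = P.vtx (i + 1) := by
  refine ⟨(m + P.n - 1) % P.n, Nat.mod_lt _ P.n_pos, P.vtx_eq_iff.2 ?_⟩
  have := P.n_pos
  rw [Nat.mod_add_mod, Nat.sub_add_cancel (by omega)]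
  simp

lemma eq_vtx_of_mem_two {i j : ℕ} {x : Pt} (hi : x ∈ P.edge i) (hj : x ∈ P.edge j)
    (hij : i % P.n ≠ j % P.n) : ∃ m, x = P.vtx (m + 1) := by
  have hs : ({i % P.n, j % P.n} : Set ℕ) ⊆ {j | j < P.n ∧ x ∈ P.edge j} := by
    rintro k (rfl | rfl)
    exacts [P.mod_mem hi, P.mod_mem hj]
  have h1 := Set.ncard_le_ncard hs (P.edges_finite _)
  rw [Set.ncard_pair hij] at h1
  obtain ⟨m, -, hm⟩ := P.vtx_of_two x (le_antisymm (P.simple x) h1)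
  obtain ⟨i, -, hi⟩ := P.exists_vtx_succ m
  exact ⟨i, hm.trans hi⟩

lemma edge_unique {i j : ℕ} {t : ℝ} (h0 : 0 < t) (h1 : t < 1)
    (h : P.vtx i + t • P.dir i ∈ P.edge j) : j % P.n = i % P.n := by
  by_contra hne
  have hi : P.vtx i + t • P.dir i ∈ P.edge i := P.mem_edge_iff.2 ⟨t, h0.le, h1.le, rfl⟩
  obtain ⟨m, hm⟩ := P.eq_vtx_of_mem_two h hi hne
  rw [hm] at hi
  rcases P.edges_at_vertex hi with hh | hh
  · have : P.vtx (i + 1) = P.vtx (m + 1) := P.vtx_eq_iff.2 (Nat.ModEq.add_right 1 hh)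
    rw [← this, ← vtx_add_dir] at hm
    have h2 : (1 - t) • P.dir i = 0 := by
      rw [sub_smul, one_smul, sub_eq_zero]; exact (add_left_cancel hm).symm
    rcases smul_eq_zero.1 h2 with h | h
    · linarith
    · exact P.dir_ne_zero i h
  · have : P.vtx i = P.vtx (m + 1) := P.vtx_eq_iff.2 hh
    rw [← this] at hm
    have h2 : t • P.dir i = 0 := by simpa using hm
    rcases smul_eq_zero.1 h2 with h | h
    · linarith
    · exact P.dir_ne_zero i h

/-- Near a point there are only edges through that point. -/
lemma exists_ball_edges (p : Pt) :
    ∃ r > 0, ∀ j, ∀ x ∈ Metric.ball p r, x ∈ P.edge j → p ∈ P.edge j := by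
  have h : ∀ j ∈ Finset.range P.n, ∀ᶠ x in nhds p, x ∈ P.edge j → p ∈ P.edge j := by
    intro j _
    by_cases hp : p ∈ P.edge j
    · exact Filter.Eventually.of_forall fun _ _ => hp
    · filter_upwards [(P.isCompact_edge j).isClosed.isOpen_compl.mem_nhds hp] with x hx h
      exact absurd h hx
  obtain ⟨r, hr, hb⟩ := Metric.eventually_nhds_iff_ball.1
    ((Filter.eventually_all_finset _).2 h)
  refine ⟨r, hr, fun j x hx hj => ?_⟩
  rw [← edge_mod] at hj ⊢
  exact hb x hx _ (Finset.mem_range.2 (Nat.mod_lt _ P.n_pos)) hj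

lemma exists_pos_smul_dir {i : ℕ} (h : det2 (P.dir i) (P.dir (i + 1)) = 0) :
    ∃ c : ℝ, 0 < c ∧ P.dir (i + 1) = c • P.dir i := by
  obtain ⟨c, hc⟩ : ∃ c : ℝ, P.dir (i + 1) = c • P.dir i := by
    have h' := det2_cramer (P.dir i) (rot (P.dir i)) (P.dir (i + 1))
    rw [h, zero_smul, add_zero, det2_rot] at h'
    have h0 : ‖P.dir i‖ ^ 2 ≠ 0 := by simp [P.dir_ne_zero]
    exact ⟨(‖P.dir i‖ ^ 2)⁻¹ * det2 (P.dir (i + 1)) (rot (P.dir i)), by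
      rw [mul_smul, ← h', smul_smul, inv_mul_cancel₀ h0, one_smul]⟩
  refine ⟨c, ?_, hc⟩
  by_contra! hneg
  set t : ℝ := 1 / (2 + |c|) with ht
  have hc0 : 0 ≤ |c| := abs_nonneg c
  have ht0 : 0 < t := by positivity
  have ht1 : t < 1 := by rw [ht, div_lt_one (by positivity)]; linarith
  have hx : P.vtx (i + 1) + t • P.dir (i + 1) ∈ P.edge i := by
    rw [mem_edge_iff]
    refine ⟨1 + t * c, ?_, by nlinarith, ?_⟩
    · have : t * |c| ≤ 1 := by rw [ht, div_mul_eq_mul_div, div_le_one (by positivity)]; linarith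
      rw [abs_of_nonpos hneg] at this; linarith
    · rw [hc, ← vtx_add_dir]; module
  exact P.mod_succ_ne i (P.edge_unique ht0 ht1 hx)

/-! ### The two sides of the boundary -/

/-- The open sector on the side `ς` (`1` for left, `-1` for right) of the path arriving at `p`
in direction `e` and leaving in direction `f`. -/
def sector (ς : ℝ) (p e f : Pt) : Set Pt :=
  {x | if 0 < ς * det2 e f then 0 < ς * det2 e (x - p) ∧ 0 < ς * det2 f (x - p)
    else 0 < ς * det2 e (x - p) ∨ 0 < ς * det2 f (x - p)}

/-- The open half-plane on the side `ς` of the line through `p` with direction `e`. -/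
def side (ς : ℝ) (p e : Pt) : Set Pt := {x | 0 < ς * det2 e (x - p)}

lemma convex_side (ς : ℝ) (p e : Pt) : Convex ℝ (side ς p e) := by
  intro x hx y hy a b ha hb hab
  simp only [side, Set.mem_ofPred_eq] at *
  have e1 : a • x + b • y - p = a • (x - p) + b • (y - p) := by
    rw [show a = 1 - b by linarith]; module
  rw [e1, det2_add_right, det2_smul_right, det2_smul_right]
  rcases ha.eq_or_lt with h | h
  · subst h
    have : b = 1 := by linarith
    subst this; simpa using hy
  · nlinarith [mul_pos h hx, mul_nonneg hb hy.le]

lemma isOpen_side (ς : ℝ) (p e : Pt) : IsOpen (side ς p e) :=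
  isOpen_lt (by fun_prop) (by fun_prop)

lemma smul_mem_side {ς : ℝ} {p e d : Pt} {t : ℝ} (ht : 0 < t) :
    p + t • d ∈ side ς p e ↔ 0 < ς * det2 e d := by
  simp only [side, Set.mem_ofPred_eq, add_sub_cancel_left, det2_smul_right]
  rw [mul_left_comm]
  exact mul_pos_iff_of_pos_left ht

lemma exists_smul_mem_ball (p d : Pt) {r : ℝ} (hr : 0 < r) :
    ∃ t : ℝ, 0 < t ∧ t < 1 ∧ p + t • d ∈ Metric.ball p r := by
  have t1 : Filter.Tendsto (fun α : ℝ => p + α • d) (nhdsWithin 0 (Set.Ioi 0)) (nhds p) := by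
    have : Continuous fun α : ℝ => p + α • d := by fun_prop
    simpa using (this.tendsto 0).mono_left nhdsWithin_le_nhds
  obtain ⟨t, h1, h2⟩ := ((t1.eventually (Metric.ball_mem_nhds p hr)).and
    (Ioo_mem_nhdsGT (one_pos (α := ℝ)))).exists
  exact ⟨t, h2.1, h2.2, h1⟩

lemma isPreconnected_side_inter_ball (ς : ℝ) (p e q : Pt) (r : ℝ) :
    IsPreconnected (side ς p e ∩ Metric.ball q r) :=
  ((convex_side ς p e).inter (convex_ball q r)).isPreconnected

lemma isPreconnected_sector_inter_ball {ς : ℝ} (hς : ς ≠ 0) {p e f : Pt} (he : e ≠ 0)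
    (hef : det2 e f = 0 → ∃ c : ℝ, 0 < c ∧ f = c • e) {r : ℝ} (hr : 0 < r) :
    IsPreconnected (sector ς p e f ∩ Metric.ball p r) := by
  by_cases h : 0 < ς * det2 e f
  · have : sector ς p e f ∩ Metric.ball p r
        = (side ς p e ∩ side ς p f) ∩ Metric.ball p r := by
      simp only [sector, if_pos h]; rfl
    rw [this]
    exact (((convex_side ς p e).inter (convex_side ς p f)).inter (convex_ball p r)).isPreconnected
  · have : sector ς p e f ∩ Metric.ball p r
        = (side ς p e ∩ Metric.ball p r) ∪ (side ς p f ∩ Metric.ball p r) := by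
      simp only [sector, if_neg h]
      rw [← Set.union_inter_distrib_right]; rfl
    rw [this]
    obtain ⟨d, hd1, hd2⟩ : ∃ d, 0 < ς * det2 e d ∧ 0 < ς * det2 f d := by
      by_cases h0 : det2 e f = 0
      · obtain ⟨c, hc, rfl⟩ := hef h0
        obtain ⟨w, hw⟩ := exists_det2_pos he
        have h1 : 0 < ς * det2 e (ς • w) := by
          rw [det2_smul_right, ← mul_assoc]; exact mul_pos (mul_self_pos.2 hς) hw
        exact ⟨ς • w, h1, by rw [det2_smul_left, mul_left_comm]; positivity⟩
      · refine ⟨ς • (det2 e f • (f - e)), ?_, ?_⟩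
        · have : ς * det2 e (ς • (det2 e f • (f - e))) = ς ^ 2 * det2 e f ^ 2 := by
            simp [det2]; ring
          rw [this]; positivity
        · have : ς * det2 f (ς • (det2 e f • (f - e))) = ς ^ 2 * det2 e f ^ 2 := by
            simp [det2]; ring
          rw [this]; positivity
    obtain ⟨t, ht0, -, htb⟩ := exists_smul_mem_ball p d hr
    exact IsPreconnected.union (p + t • d) ⟨(smul_mem_side ht0).2 hd1, htb⟩
      ⟨(smul_mem_side ht0).2 hd2, htb⟩ (isPreconnected_side_inter_ball _ _ _ _ _)
      (isPreconnected_side_inter_ball _ _ _ _ _)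

lemma exists_ball_open_edge (i : ℕ) {t : ℝ} (h0 : 0 < t) (h1 : t < 1) :
    ∃ r > 0, ∀ x ∈ Metric.ball (P.vtx i + t • P.dir i) r,
      (x ∈ P.boundary ↔ det2 (P.dir i) (x - P.vtx i) = 0) := by
  obtain ⟨r, hr, hb⟩ := P.exists_ball_edges (P.vtx i + t • P.dir i)
  set p := P.vtx i + t • P.dir i with hp
  have hcont : Continuous fun x : Pt => inner ℝ (P.dir i) (x - P.vtx i) / ‖P.dir i‖ ^ 2 := by
    fun_prop
  have hn : ‖P.dir i‖ ^ 2 ≠ 0 := by simp [P.dir_ne_zero]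
  have hval : inner ℝ (P.dir i) (p - P.vtx i) / ‖P.dir i‖ ^ 2 = t := by
    rw [hp, add_sub_cancel_left, inner_smul_right, real_inner_self_eq_norm_sq,
      mul_div_cancel_right₀ _ hn]
  have hev := hcont.continuousAt.eventually_mem (x := p) (s := Set.Ioo (0:ℝ) 1)
    (by rw [hval]; exact Ioo_mem_nhds h0 h1)
  obtain ⟨r', hr', hb'⟩ := Metric.eventually_nhds_iff_ball.1 hev
  refine ⟨min r r', lt_min hr hr', fun x hx => ⟨fun hbd => ?_, fun hdet => ?_⟩⟩
  · obtain ⟨j, hj⟩ := P.mem_boundary_iff.1 hbd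
    have h2 := hb j x (Metric.ball_subset_ball (min_le_left _ _) hx) hj
    have h3 := P.edge_unique h0 h1 h2
    rw [P.edge_eq_of_mod h3, mem_edge_iff] at hj
    obtain ⟨s, -, -, rfl⟩ := hj
    simp [det2_smul_right]
  · have h2 := hb' x (Metric.ball_subset_ball (min_le_right _ _) hx)
    refine P.edge_subset_boundary i (P.mem_edge_iff.2 ⟨_, h2.1.le, h2.2.le, ?_⟩)
    have h3 := det2_cramer (P.dir i) (rot (P.dir i)) (x - P.vtx i)
    rw [hdet, zero_smul, add_zero, det2_rot, det2_rot_right] at h3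
    rw [div_eq_inv_mul, mul_smul, real_inner_comm, ← h3, smul_smul, inv_mul_cancel₀ hn]
    simp

lemma mem_edge_near (i : ℕ) :
    ∃ r > 0, ∀ x ∈ Metric.ball (P.vtx (i + 1)) r, ∀ s : ℝ, 0 ≤ s →
      (x = P.vtx (i + 1) - s • P.dir i ∨ x = P.vtx (i + 1) + s • P.dir (i + 1)) →
      x ∈ P.boundary := by
  refine ⟨min ‖P.dir i‖ ‖P.dir (i + 1)‖, lt_min (norm_pos_iff.2 (P.dir_ne_zero _))
    (norm_pos_iff.2 (P.dir_ne_zero _)), ?_⟩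
  rintro x hx s hs (rfl | rfl)
  · rw [Metric.mem_ball, dist_eq_norm, lt_min_iff] at hx
    have h1 := hx.1
    rw [sub_sub_cancel_left, norm_neg, norm_smul, Real.norm_of_nonneg hs] at h1
    have : s < 1 := by
      by_contra! h
      nlinarith [norm_nonneg (P.dir i)]
    refine P.edge_subset_boundary i (P.mem_edge_iff.2 ⟨1 - s, by linarith, by linarith, ?_⟩)
    rw [← vtx_add_dir]; module
  · rw [Metric.mem_ball, dist_eq_norm, lt_min_iff] at hx
    have h1 := hx.2
    rw [add_sub_cancel_left, norm_smul, Real.norm_of_nonneg hs] at h1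
    have : s < 1 := by
      by_contra! h
      nlinarith [norm_nonneg (P.dir (i + 1))]
    exact P.edge_subset_boundary (i + 1) (P.mem_edge_iff.2 ⟨s, hs, by linarith, rfl⟩)

lemma sector_disjoint_boundary {ς : ℝ} (i : ℕ) :
    ∃ r > 0, ∀ x ∈ sector ς (P.vtx (i + 1)) (P.dir i) (P.dir (i + 1)) ∩
      Metric.ball (P.vtx (i + 1)) r, x ∉ P.boundary := by
  obtain ⟨r, hr, hb⟩ := P.exists_ball_edges (P.vtx (i + 1))
  refine ⟨r, hr, ?_⟩
  rintro x ⟨hx, hxr⟩ hbd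
  obtain ⟨j, hj⟩ := P.mem_boundary_iff.1 hbd
  have hsw := det2_swap (P.dir (i + 1)) (P.dir i)
  rcases P.edges_at_vertex (hb j x hxr hj) with hh | hh
  · rw [P.edge_eq_of_mod hh, mem_edge_iff] at hj
    obtain ⟨s, h0, h1, rfl⟩ := hj
    have e1 : P.vtx i + s • P.dir i - P.vtx (i + 1) = (s - 1) • P.dir i := by
      rw [← vtx_add_dir]; module
    simp only [sector, Set.mem_ofPred_eq, e1, det2_smul_right, det2_self, mul_zero, lt_self_iff_false,
      false_and, false_or, hsw] at hx
    split_ifs at hx with h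
    nlinarith
  · rw [P.edge_eq_of_mod hh, mem_edge_iff] at hj
    obtain ⟨s, h0, h1, rfl⟩ := hj
    simp only [sector, Set.mem_ofPred_eq, add_sub_cancel_left, det2_smul_right, det2_self, mul_zero,
      lt_self_iff_false, and_false, or_false] at hx
    split_ifs at hx with h
    nlinarith

lemma sector_cover (i : ℕ) :
    ∃ r > 0, ∀ x ∈ Metric.ball (P.vtx (i + 1)) r, x ∉ P.boundary →
      x ∈ sector 1 (P.vtx (i + 1)) (P.dir i) (P.dir (i + 1)) ∨
      x ∈ sector (-1) (P.vtx (i + 1)) (P.dir i) (P.dir (i + 1)) := by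
  obtain ⟨r, hr, hb⟩ := P.mem_edge_near i
  refine ⟨r, hr, fun x hx hbd => ?_⟩
  by_contra! hno
  apply hbd
  have hco : ∀ μ ν : ℝ, x - P.vtx (i + 1) = μ • P.dir i + ν • P.dir (i + 1) →
      (μ ≤ 0 ∧ ν = 0) ∨ (μ = 0 ∧ 0 ≤ ν) → x ∈ P.boundary := by
    rintro μ ν h (⟨h1, h2⟩ | ⟨h1, h2⟩)
    · refine hb x hx (-μ) (by linarith) (Or.inl ?_)
      rw [h2] at h
      rw [eq_add_of_sub_eq h]; module
    · refine hb x hx ν (by linarith) (Or.inr ?_)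
      rw [h1] at h
      rw [eq_add_of_sub_eq h]; module
  set e := P.dir i
  set f := P.dir (i + 1)
  set y := x - P.vtx (i + 1)
  have hsw := det2_swap f e
  simp only [sector, Set.mem_ofPred_eq, one_mul, neg_one_mul, Left.neg_pos_iff] at hno
  rcases lt_trichotomy (det2 e f) 0 with h | h | h
  · rw [if_neg (by linarith), if_pos h] at hno
    push Not at hno
    obtain ⟨⟨h1, h2⟩, h3⟩ := hno
    have hc := exists_coords_of_det2_ne_zero h.ne y
    refine hco _ _ hc ?_
    have s1 := det2_swap y f
    rcases h1.eq_or_lt with h4 | h4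
    · left
      refine ⟨div_nonpos_of_nonneg_of_nonpos (by linarith) h.le, by rw [h4]; simp⟩
    · right
      have h5 := le_antisymm h2 (h3 h4)
      refine ⟨by rw [s1, h5]; simp, div_nonneg_of_nonpos h1 h.le⟩
  · obtain ⟨c, hc, hcf⟩ := P.exists_pos_smul_dir h
    change f = c • e at hcf
    have hd : det2 f y = c * det2 e y := by rw [hcf, det2_smul_left]
    rw [if_neg (by linarith), if_neg (by linarith)] at hno
    push Not at hno
    have h0 : det2 e y = 0 := le_antisymm hno.1.1 hno.2.1
    have h' := det2_cramer e (rot e) y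
    rw [h0, zero_smul, add_zero, det2_rot] at h'
    have hn : ‖e‖ ^ 2 ≠ 0 := by simp [e, P.dir_ne_zero]
    have hy : y = ((‖e‖ ^ 2)⁻¹ * det2 y (rot e)) • e := by
      rw [mul_smul, ← h', smul_smul, inv_mul_cancel₀ hn, one_smul]
    set μ := (‖e‖ ^ 2)⁻¹ * det2 y (rot e)
    rcases le_total μ 0 with hm | hm
    · exact hco μ 0 (by rw [hy]; simp) (Or.inl ⟨hm, rfl⟩)
    · refine hco 0 (μ / c) ?_ (Or.inr ⟨rfl, by positivity⟩)
      rw [hcf, smul_smul, div_mul_cancel₀ _ hc.ne', ← hy]; simp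
  · rw [if_pos h, if_neg (by linarith)] at hno
    push Not at hno
    obtain ⟨h3, h1, h2⟩ := hno
    have hc := exists_coords_of_det2_ne_zero h.ne' y
    refine hco _ _ hc ?_
    have s1 := det2_swap y f
    rcases h1.eq_or_lt with h4 | h4
    · left
      refine ⟨div_nonpos_of_nonpos_of_nonneg (by linarith) h.le, by rw [← h4]; simp⟩
    · right
      have h5 := le_antisymm h2 (h3 h4)
      refine ⟨by rw [s1, ← h5]; simp, div_nonneg h1 h.le⟩

end SimplePolygon

namespace SimplePolygon

variable (P : SimplePolygon)

/-- The component of the complement of the boundary containing `x`. -/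
def comp (x : Pt) : Set Pt := connectedComponentIn P.boundaryᶜ x

lemma comp_eq_of_preconnected {S : Set Pt} (hS : IsPreconnected S) (hd : ∀ x ∈ S, x ∉ P.boundary)
    {x y : Pt} (hx : x ∈ S) (hy : y ∈ S) : P.comp x = P.comp y :=
  connectedComponentIn_eq (hS.subset_connectedComponentIn hx hd hy)

/-- The component `A` is the one adjacent to the point with parameter `t` of the edge `i`
on the side `ς`. -/
def SideComp (ς : ℝ) (i : ℕ) (t : ℝ) (A : Set Pt) : Prop :=
  ∃ r > 0, ∀ x ∈ side ς (P.vtx i) (P.dir i) ∩ Metric.ball (P.vtx i + t • P.dir i) r, P.comp x = A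

lemma side_ball_nonempty {ς : ℝ} (hς : ς ≠ 0) (i : ℕ) (t : ℝ) {r : ℝ} (hr : 0 < r) :
    (side ς (P.vtx i) (P.dir i) ∩ Metric.ball (P.vtx i + t • P.dir i) r).Nonempty := by
  obtain ⟨w, hw⟩ := exists_det2_pos (P.dir_ne_zero i)
  obtain ⟨s, hs, -, hsb⟩ := exists_smul_mem_ball (P.vtx i + t • P.dir i) (ς • w) hr
  refine ⟨_, ?_, hsb⟩
  simp only [side, Set.mem_ofPred_eq]
  have : ς * det2 (P.dir i) (P.vtx i + t • P.dir i + s • ς • w - P.vtx i)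
      = (ς * ς) * (s * det2 (P.dir i) w) := by simp [det2]; ring
  rw [this]
  exact mul_pos (mul_self_pos.2 hς) (by positivity)

variable {P}

lemma SideComp.unique {ς : ℝ} (hς : ς ≠ 0) {i : ℕ} {t : ℝ} {A A' : Set Pt}
    (h : P.SideComp ς i t A) (h' : P.SideComp ς i t A') : A = A' := by
  obtain ⟨r, hr, h⟩ := h
  obtain ⟨r', hr', h'⟩ := h'
  obtain ⟨x, hx, hxb⟩ := P.side_ball_nonempty hς i t (lt_min hr hr')
  rw [← h x ⟨hx, Metric.ball_subset_ball (min_le_left _ _) hxb⟩,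
    h' x ⟨hx, Metric.ball_subset_ball (min_le_right _ _) hxb⟩]

lemma SideComp.eventually {ς : ℝ} {i : ℕ} {t : ℝ} {A : Set Pt}
    (h : P.SideComp ς i t A) : ∀ᶠ s in nhds t, P.SideComp ς i s A := by
  obtain ⟨r, hr, h⟩ := h
  have hc : Continuous fun s : ℝ => P.vtx i + s • P.dir i := by fun_prop
  filter_upwards [hc.continuousAt.eventually_mem (Metric.ball_mem_nhds _ hr)] with s hs
  obtain ⟨r', hr', hb⟩ := Metric.isOpen_iff.1 Metric.isOpen_ball _ hs
  exact ⟨r', hr', fun x hx => h x ⟨hx.1, hb hx.2⟩⟩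

variable (P)

lemma exists_sideComp {ς : ℝ} (hς : ς ≠ 0) (i : ℕ) {t : ℝ} (h0 : 0 < t) (h1 : t < 1) :
    ∃ A, P.SideComp ς i t A := by
  obtain ⟨r, hr, hb⟩ := P.exists_ball_open_edge i h0 h1
  obtain ⟨y, hy⟩ := P.side_ball_nonempty hς i t hr
  refine ⟨P.comp y, r, hr, fun x hx => P.comp_eq_of_preconnected
    (isPreconnected_side_inter_ball _ _ _ _ _) (fun z hz hzb => ?_) hx hy⟩
  have h2 := (hb z hz.2).1 hzb
  have h3 := hz.1
  simp only [side, Set.mem_ofPred_eq, h2, mul_zero, lt_self_iff_false] at h3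

lemma sideComp_const {ς : ℝ} (hς : ς ≠ 0) (i : ℕ) :
    ∃ A, ∀ t, 0 < t → t < 1 → P.SideComp ς i t A := by
  obtain ⟨A, hA⟩ := P.exists_sideComp hς i (t := 1 / 2) (by norm_num) (by norm_num)
  refine ⟨A, fun t h0 h1 => ?_⟩
  have hpc : IsPreconnected (Set.Ioo (0 : ℝ) 1) := isPreconnected_Ioo
  refine hpc.induction₂ (fun s t => ∀ A, P.SideComp ς i s A ↔ P.SideComp ς i t A) ?_ ?_ ?_
    (⟨by norm_num, by norm_num⟩ : (1 / 2 : ℝ) ∈ Set.Ioo (0 : ℝ) 1) ⟨h0, h1⟩ A |>.1 hA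
  · intro s hs
    obtain ⟨A, hA⟩ := P.exists_sideComp hς i hs.1 hs.2
    filter_upwards [mem_nhdsWithin_of_mem_nhds hA.eventually] with t ht A'
    exact ⟨fun h => by rwa [h.unique hς hA], fun h => by rwa [h.unique hς ht]⟩
  · intro x y z _ _ _ h1 h2 A
    exact (h1 A).trans (h2 A)
  · intro x y _ _ h A
    exact (h A).symm

lemma sector_inter_side_left {ς : ℝ} (hς : ς ≠ 0) {p e f q : Pt} {s : ℝ} (hs : 0 < s) (he : e ≠ 0)
    (hq : q = p - s • e) {r : ℝ} (hr : 0 < r) :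
    (sector ς p e f ∩ side ς q e ∩ Metric.ball q r).Nonempty := by
  obtain ⟨w, hw⟩ := exists_det2_pos he
  by_cases h : 0 < ς * det2 e f
  · have hop : IsOpen (side ς p f) := isOpen_side _ _ _
    have hqf : q ∈ side ς p f := by
      simp only [side, Set.mem_ofPred_eq, hq, sub_sub_cancel_left, det2_neg_right, det2_smul_right]
      have := det2_swap f e
      rw [this]; nlinarith
    obtain ⟨r', hr', hb⟩ := Metric.isOpen_iff.1 hop q hqf
    obtain ⟨t, ht, -, htb⟩ := exists_smul_mem_ball q (ς • w) (lt_min hr hr')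
    have h1 : q + t • ς • w ∈ side ς q e := by
      rw [smul_mem_side ht, det2_smul_right, ← mul_assoc]
      exact mul_pos (mul_self_pos.2 hς) hw
    refine ⟨_, ⟨?_, h1⟩, Metric.ball_subset_ball (min_le_left _ _) htb⟩
    simp only [sector, if_pos h, Set.mem_ofPred_eq]
    refine ⟨?_, hb (Metric.ball_subset_ball (min_le_right _ _) htb)⟩
    simp only [side, Set.mem_ofPred_eq] at h1
    convert h1 using 2
    rw [hq]; simp [det2]; ring
  · obtain ⟨t, ht, -, htb⟩ := exists_smul_mem_ball q (ς • w) hr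
    have h1 : q + t • ς • w ∈ side ς q e := by
      rw [smul_mem_side ht, det2_smul_right, ← mul_assoc]
      exact mul_pos (mul_self_pos.2 hς) hw
    refine ⟨_, ⟨?_, h1⟩, htb⟩
    simp only [sector, if_neg h, Set.mem_ofPred_eq]
    left
    simp only [side, Set.mem_ofPred_eq] at h1
    convert h1 using 2
    rw [hq]; simp [det2]; ring

lemma sector_inter_side_right {ς : ℝ} (hς : ς ≠ 0) {p e f q : Pt} {s : ℝ} (hs : 0 < s) (hf : f ≠ 0)
    (hq : q = p + s • f) {r : ℝ} (hr : 0 < r) :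
    (sector ς p e f ∩ side ς q f ∩ Metric.ball q r).Nonempty := by
  have hq' : q = p - s • (-f) := by rw [hq]; simp
  obtain ⟨x, ⟨h1, h2⟩, h3⟩ := sector_inter_side_left (ς := -ς) (f := -e) (neg_ne_zero.2 hς) hs
    (neg_ne_zero.2 hf) hq' hr
  refine ⟨x, ⟨?_, ?_⟩, h3⟩
  · simp only [sector, Set.mem_ofPred_eq, det2_neg_left, det2_neg_right, neg_neg, mul_neg,
      neg_mul, det2_swap f e] at h1 ⊢
    simpa only [and_comm, or_comm] using h1
  · simpa only [side, Set.mem_ofPred_eq, det2_neg_left, mul_neg, neg_mul, neg_neg] using h2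

lemma exists_sectorComp {ς : ℝ} (hς : ς ≠ 0) (i : ℕ) :
    ∃ A, (∃ r > 0, ∀ x ∈ sector ς (P.vtx (i + 1)) (P.dir i) (P.dir (i + 1)) ∩
      Metric.ball (P.vtx (i + 1)) r, P.comp x = A) ∧
      (∀ t, 0 < t → t < 1 → P.SideComp ς i t A) ∧
      (∀ t, 0 < t → t < 1 → P.SideComp ς (i + 1) t A) := by
  obtain ⟨r, hr, hb⟩ := P.sector_disjoint_boundary (ς := ς) i
  have hpc := isPreconnected_sector_inter_ball hς (p := P.vtx (i + 1)) (P.dir_ne_zero i)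
    (f := P.dir (i + 1)) (fun h => P.exists_pos_smul_dir h) hr
  obtain ⟨A1, h1⟩ := P.sideComp_const hς i
  obtain ⟨A2, h2⟩ := P.sideComp_const hς (i + 1)
  have hcomp : ∀ x ∈ sector ς (P.vtx (i + 1)) (P.dir i) (P.dir (i + 1)) ∩
      Metric.ball (P.vtx (i + 1)) r, P.comp x = A1 := by
    obtain ⟨s, hs, hs1, hsb⟩ := exists_smul_mem_ball (P.vtx (i + 1)) (-P.dir i) hr
    have hq : P.vtx i + (1 - s) • P.dir i = P.vtx (i + 1) - s • P.dir i := by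
      rw [← vtx_add_dir]; module
    rw [smul_neg, ← sub_eq_add_neg, ← hq] at hsb
    obtain ⟨r', hr', hb'⟩ := Metric.isOpen_iff.1 Metric.isOpen_ball _ hsb
    obtain ⟨r'', hr'', h1'⟩ := h1 (1 - s) (by linarith) (by linarith)
    obtain ⟨y, ⟨hy1, hy2⟩, hy3⟩ := sector_inter_side_left (f := P.dir (i + 1)) hς hs
      (P.dir_ne_zero i) hq (lt_min hr' hr'')
    intro x hx
    rw [← h1' y ⟨?_, Metric.ball_subset_ball (min_le_right _ _) hy3⟩]
    · exact P.comp_eq_of_preconnected hpc hb hx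
        ⟨hy1, hb' (Metric.ball_subset_ball (min_le_left _ _) hy3)⟩
    · simp only [side, Set.mem_ofPred_eq] at hy2 ⊢
      convert hy2 using 2
      simp [det2]; ring
  have e12 : A1 = A2 := by
    obtain ⟨s, hs, hs1, hsb⟩ := exists_smul_mem_ball (P.vtx (i + 1)) (P.dir (i + 1)) hr
    obtain ⟨r', hr', hb'⟩ := Metric.isOpen_iff.1 Metric.isOpen_ball _ hsb
    obtain ⟨r'', hr'', h2'⟩ := h2 s hs hs1
    obtain ⟨y, ⟨hy1, hy2⟩, hy3⟩ := sector_inter_side_right (e := P.dir i) hς hs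
      (P.dir_ne_zero (i + 1)) rfl (lt_min hr' hr'')
    rw [← h2' y ⟨?_, Metric.ball_subset_ball (min_le_right _ _) hy3⟩]
    · exact (hcomp y ⟨hy1, hb' (Metric.ball_subset_ball (min_le_left _ _) hy3)⟩).symm
    · simp only [side, Set.mem_ofPred_eq] at hy2 ⊢
      convert hy2 using 2
      simp [det2]; ring
  exact ⟨A1, ⟨r, hr, hcomp⟩, h1, e12 ▸ h2⟩

/-- All sectors and half-discs on one side of the boundary lie in a single component. -/
theorem exists_side_component {ς : ℝ} (hς : ς ≠ 0) : ∃ A,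
    (∀ i, ∃ r > 0, ∀ x ∈ sector ς (P.vtx (i + 1)) (P.dir i) (P.dir (i + 1)) ∩
      Metric.ball (P.vtx (i + 1)) r, P.comp x = A) ∧
    (∀ i t, 0 < t → t < 1 → P.SideComp ς i t A) := by
  choose A hA hB hC using P.exists_sectorComp hς
  have hstep : ∀ i, A (i + 1) = A i := fun i =>
    (hB (i + 1) (1 / 2) (by norm_num) (by norm_num)).unique hς
      (hC i (1 / 2) (by norm_num) (by norm_num))
  have hall : ∀ i, A i = A 0 := fun i => by
    induction i with
    | zero => rfl
    | succ i ih => rw [hstep, ih]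
  exact ⟨A 0, fun i => by rw [← hall i]; exact hA i, fun i => by rw [← hall i]; exact hB i⟩

/-- The component on the side `ς` of the boundary. -/
def sideC (ς : ℝ) (hς : ς ≠ 0) : Set Pt := (P.exists_side_component hς).choose

/-- The component to the left of the boundary. -/
def leftC : Set Pt := P.sideC 1 one_ne_zero

/-- The component to the right of the boundary. -/
def rightC : Set Pt := P.sideC (-1) (by norm_num)

lemma cases_of_mem_boundary {p : Pt} (hp : p ∈ P.boundary) :
    (∃ i < P.n, p = P.vtx (i + 1)) ∨ ∃ (i : ℕ) (t : ℝ), 0 < t ∧ t < 1 ∧ p = P.vtx i + t • P.dir i := by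
  obtain ⟨i, hi⟩ := P.mem_boundary_iff.1 hp
  obtain ⟨t, h0, h1, rfl⟩ := P.mem_edge_iff.1 hi
  rcases h0.eq_or_lt with h | h
  · left
    obtain ⟨j, hj, hj'⟩ := P.exists_vtx_succ i
    exact ⟨j, hj, by rw [← h, zero_smul, add_zero, hj']⟩
  · rcases h1.eq_or_lt with h' | h'
    · left
      obtain ⟨j, hj, hj'⟩ := P.exists_vtx_succ (i + 1)
      exact ⟨j, hj, by rw [h', one_smul, vtx_add_dir, hj']⟩
    · exact Or.inr ⟨i, t, h, h', rfl⟩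

lemma local_open_edge (i : ℕ) {t : ℝ} (h0 : 0 < t) (h1 : t < 1) :
    ∃ r > 0, ∀ x ∈ Metric.ball (P.vtx i + t • P.dir i) r,
      (x ∈ P.boundary ↔ det2 (P.dir i) (x - P.vtx i) = 0) ∧
      (0 < det2 (P.dir i) (x - P.vtx i) → P.comp x = P.leftC) ∧
      (det2 (P.dir i) (x - P.vtx i) < 0 → P.comp x = P.rightC) := by
  obtain ⟨r, hr, hb⟩ := P.exists_ball_open_edge i h0 h1
  obtain ⟨r1, hr1, hb1⟩ := (P.exists_side_component one_ne_zero).choose_spec.2 i t h0 h1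
  obtain ⟨r2, hr2, hb2⟩ := (P.exists_side_component (ς := -1) (by norm_num)).choose_spec.2 i t h0 h1
  refine ⟨min r (min r1 r2), by positivity, fun x hx => ?_⟩
  simp only [Metric.mem_ball, lt_min_iff] at hx
  refine ⟨hb x hx.1, fun h => hb1 x ⟨?_, hx.2.1⟩, fun h => hb2 x ⟨?_, hx.2.2⟩⟩
  · simpa [side] using h
  · simpa [side] using h

lemma local_vertex (i : ℕ) :
    ∃ r > 0, ∀ x ∈ Metric.ball (P.vtx (i + 1)) r,
      (x ∉ P.boundary → x ∈ sector 1 (P.vtx (i + 1)) (P.dir i) (P.dir (i + 1)) ∨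
        x ∈ sector (-1) (P.vtx (i + 1)) (P.dir i) (P.dir (i + 1))) ∧
      (x ∈ sector 1 (P.vtx (i + 1)) (P.dir i) (P.dir (i + 1)) →
        x ∉ P.boundary ∧ P.comp x = P.leftC) ∧
      (x ∈ sector (-1) (P.vtx (i + 1)) (P.dir i) (P.dir (i + 1)) →
        x ∉ P.boundary ∧ P.comp x = P.rightC) := by
  obtain ⟨r, hr, hb⟩ := P.sector_cover i
  obtain ⟨r1, hr1, hb1⟩ := (P.exists_side_component one_ne_zero).choose_spec.1 i
  obtain ⟨r2, hr2, hb2⟩ := (P.exists_side_component (ς := -1) (by norm_num)).choose_spec.1 i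
  obtain ⟨r3, hr3, hb3⟩ := P.sector_disjoint_boundary (ς := 1) i
  obtain ⟨r4, hr4, hb4⟩ := P.sector_disjoint_boundary (ς := -1) i
  refine ⟨min r (min (min r1 r2) (min r3 r4)), by positivity, fun x hx => ?_⟩
  simp only [Metric.mem_ball, lt_min_iff] at hx
  exact ⟨hb x hx.1, fun h => ⟨hb3 x ⟨h, hx.2.2.1⟩, hb1 x ⟨h, hx.2.1.1⟩⟩,
    fun h => ⟨hb4 x ⟨h, hx.2.2.2⟩, hb2 x ⟨h, hx.2.1.2⟩⟩⟩

/-- The complement of the boundary has at most two components. -/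
theorem comp_eq_left_or_right {z : Pt} (hz : z ∉ P.boundary) :
    P.comp z = P.leftC ∨ P.comp z = P.rightC := by
  obtain ⟨q, hq, hmin⟩ := P.isCompact_boundary.exists_isMinOn P.boundary_nonempty
    (f := fun q => dist q z) (by fun_prop)
  have hloc : ∃ r > 0, ∀ x ∈ Metric.ball q r, x ∉ P.boundary →
      P.comp x = P.leftC ∨ P.comp x = P.rightC := by
    rcases P.cases_of_mem_boundary hq with ⟨i, -, rfl⟩ | ⟨i, t, h0, h1, rfl⟩
    · obtain ⟨r, hr, hb⟩ := P.local_vertex i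
      exact ⟨r, hr, fun x hx hxb => ((hb x hx).1 hxb).imp (fun h => ((hb x hx).2.1 h).2)
        fun h => ((hb x hx).2.2 h).2⟩
    · obtain ⟨r, hr, hb⟩ := P.local_open_edge i h0 h1
      refine ⟨r, hr, fun x hx hxb => ?_⟩
      obtain ⟨h2, h3, h4⟩ := hb x hx
      rcases lt_trichotomy (det2 (P.dir i) (x - P.vtx i)) 0 with h | h | h
      · exact Or.inr (h4 h)
      · exact absurd (h2.2 h) hxb
      · exact Or.inl (h3 h)
  obtain ⟨r, hr, hb⟩ := hloc
  have hqz : 0 < dist q z := dist_pos.2 fun h => hz (h ▸ hq)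
  obtain ⟨s, hs0, hs1, hsb⟩ := exists_smul_mem_ball q (z - q) hr
  have hball : ∀ x ∈ Metric.ball z (dist q z), x ∉ P.boundary := fun x hx hxb => by
    have : dist q z ≤ dist x z := hmin hxb
    exact absurd hx (by simpa using this)
  have hx : q + s • (z - q) ∈ Metric.ball z (dist q z) := by
    rw [Metric.mem_ball, dist_eq_norm, show q + s • (z - q) - z = (1 - s) • (q - z) by module,
      norm_smul, Real.norm_of_nonneg (by linarith), ← dist_eq_norm]
    nlinarith
  rw [P.comp_eq_of_preconnected (convex_ball z _).isPreconnected hball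
    (Metric.mem_ball_self hqz) hx]
  exact hb _ hsb (hball _ hx)

end SimplePolygon

/-! ### A crossing number and the exterior of a polygon -/

/-- The indicator function of the positive reals. -/
def heav (u : ℝ) : ℝ := if 0 < u then 1 else 0

lemma heav_integral {f : ℝ → ℝ} (hf : Continuous f) {a M : ℝ} (h1 : -M ≤ a) (h2 : a ≤ M) :
    IntervalIntegrable (fun x => heav (x - a) * f x) MeasureTheory.volume (-M) M ∧
      ∫ x in (-M)..M, heav (x - a) * f x = ∫ x in a..M, f x := by
  have e1 : Set.EqOn (fun _ => (0 : ℝ)) (fun x => heav (x - a) * f x) (Set.uIoc (-M) a) := by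
    intro x hx
    rw [Set.uIoc_of_le h1] at hx
    simp [heav, not_lt.2 hx.2]
  have e2 : Set.EqOn f (fun x => heav (x - a) * f x) (Set.uIoc a M) := by
    intro x hx
    rw [Set.uIoc_of_le h2] at hx
    simp [heav, hx.1]
  have i1 : IntervalIntegrable (fun x => heav (x - a) * f x) MeasureTheory.volume (-M) a :=
    (intervalIntegrable_congr e1).1 (by simp)
  have i2 : IntervalIntegrable (fun x => heav (x - a) * f x) MeasureTheory.volume a M :=
    (intervalIntegrable_congr e2).1 (hf.intervalIntegrable _ _)
  refine ⟨i1.trans i2, ?_⟩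
  rw [← intervalIntegral.integral_add_adjacent_intervals i1 i2,
    ← intervalIntegral.integral_congr_ae (Filter.Eventually.of_forall e1),
    ← intervalIntegral.integral_congr_ae (Filter.Eventually.of_forall e2)]
  simp

lemma integral_affine (a b c d k : ℝ) :
    ∫ x in a..b, (c + (x - d) * k) = (b - a) * c + ((b - d) ^ 2 - (a - d) ^ 2) * k / 2 := by
  rw [intervalIntegral.integral_eq_sub_of_hasDerivAt (f := fun x => c * x + (x - d) ^ 2 * k / 2)]
  · ring
  · intro x _
    have h := ((hasDerivAt_id' x).const_mul c).add
      ((((((hasDerivAt_id' x).sub_const d).fun_pow 2)).mul_const k).div_const 2)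
    refine h.congr_deriv ?_
    norm_num
    ring
  · exact Continuous.intervalIntegrable (by fun_prop) _ _

lemma exists_pos_of_integral_pos {f : ℝ → ℝ} {a b : ℝ} (hab : a ≤ b)
    (hf : IntervalIntegrable f MeasureTheory.volume a b) (h : 0 < ∫ x in a..b, f x)
    {N : Set ℝ} (hN : N.Finite) : ∃ x, x ∉ N ∧ 0 < f x := by
  by_contra! hno
  have : ∫ x in a..b, f x ≤ ∫ x in a..b, (0 : ℝ) := by
    refine intervalIntegral.integral_mono_ae hab hf (by simp) ?_
    filter_upwards [hN.countable.ae_notMem MeasureTheory.volume] with x hx using hno x hx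
  simp at this
  linarith

/-- `f` is constant near `z`. -/
def LocConst (f : Pt → ℝ) (z : Pt) : Prop := ∀ᶠ z' in nhds z, f z' = f z

lemma LocConst.const (c : ℝ) (z : Pt) : LocConst (fun _ => c) z := Filter.Eventually.of_forall fun _ => rfl

lemma LocConst.exists_const {f : Pt → ℝ} {z : Pt} (hf : LocConst f z) :
    ∃ c, ∀ᶠ z' in nhds z, f z' = c := ⟨_, hf⟩

lemma LocConst.mul {f g : Pt → ℝ} {z : Pt} (hf : LocConst f z) (hg : LocConst g z) :
    LocConst (fun z => f z * g z) z := by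
  filter_upwards [hf, hg] with x h1 h2
  simp only [h1, h2]

lemma LocConst.sub {f g : Pt → ℝ} {z : Pt} (hf : LocConst f z) (hg : LocConst g z) :
    LocConst (fun z => f z - g z) z := by
  filter_upwards [hf, hg] with x h1 h2
  simp only [h1, h2]

lemma LocConst.sum {ι : Type*} {s : Finset ι} {f : ι → Pt → ℝ} {z : Pt}
    (hf : ∀ i ∈ s, LocConst (f i) z) : LocConst (fun z => ∑ i ∈ s, f i z) z := by
  filter_upwards [(Filter.eventually_all_finset s).2 hf] with x h
  exact Finset.sum_congr rfl h

lemma locConst_heav {a : ℝ} {z : Pt} (h : z 0 ≠ a) : LocConst (fun z => heav (z 0 - a)) z := by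
  have hc : Continuous fun z : Pt => z 0 := by fun_prop
  rcases h.lt_or_gt with h | h
  · filter_upwards [hc.continuousAt.eventually_mem (Iio_mem_nhds h)] with x hx
    have hx : x 0 < a := hx
    simp [heav, not_lt.2 hx.le, not_lt.2 h.le]
  · filter_upwards [hc.continuousAt.eventually_mem (Ioi_mem_nhds h)] with x hx
    have hx : a < x 0 := hx
    simp [heav, hx, h]

lemma locConst_le {f : Pt → ℝ} (hf : Continuous f) {z : Pt} (h : f z ≠ 0) :
    LocConst (fun z => if 0 ≤ f z then 1 else 0) z := by
  rcases h.lt_or_gt with h | h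
  · filter_upwards [hf.continuousAt.eventually_mem (Iio_mem_nhds h)] with x hx
    have hx : f x < 0 := hx
    simp only [if_neg (not_le.2 hx), if_neg (not_le.2 h)]
  · filter_upwards [hf.continuousAt.eventually_mem (Ioi_mem_nhds h)] with x hx
    have hx : 0 < f x := hx
    simp only [if_pos hx.le, if_pos h.le]

namespace SimplePolygon

variable (P : SimplePolygon)

/-- The height over `x` of the line supporting the edge `i`. -/
def height (i : ℕ) (x : ℝ) : ℝ :=
  P.vtx i 1 + (x - P.vtx i 0) * ((P.vtx (i + 1) 1 - P.vtx i 1) / (P.vtx (i + 1) 0 - P.vtx i 0))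

/-- The signed indicator function of the projection of the edge `i` to the first axis. -/
def cross (i : ℕ) (x : ℝ) : ℝ := heav (x - P.vtx (i + 1) 0) - heav (x - P.vtx i 0)

/-- The signed number of edges above a point. -/
def wind (z : Pt) : ℝ :=
  ∑ i ∈ Finset.range P.n, P.cross i (z 0) * (if 0 ≤ P.height i (z 0) - z 1 then 1 else 0)

lemma continuous_height (i : ℕ) : Continuous (P.height i) := by
  unfold height; fun_prop

lemma height_left (i : ℕ) : P.height i (P.vtx i 0) = P.vtx i 1 := by simp [height]

lemma height_right {i : ℕ} (h : P.vtx i 0 ≠ P.vtx (i + 1) 0) :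
    P.height i (P.vtx (i + 1) 0) = P.vtx (i + 1) 1 := by
  rw [height, mul_div_cancel₀ _ (sub_ne_zero.2 h.symm)]; ring

lemma mem_edge_of_coord {i : ℕ} {z : Pt} {t : ℝ} (h0 : 0 ≤ t) (h1 : t ≤ 1)
    (hx : z 0 = P.vtx i 0 + t * (P.vtx (i + 1) 0 - P.vtx i 0))
    (hy : z 1 = P.vtx i 1 + t * (P.vtx (i + 1) 1 - P.vtx i 1)) : z ∈ P.edge i :=
  P.mem_edge_iff.2 ⟨t, h0, h1, Pt.ext_coord (by simpa [dir] using hx) (by simpa [dir] using hy)⟩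

lemma mem_edge_of_height {i : ℕ} {z : Pt} (h : P.vtx i 0 ≠ P.vtx (i + 1) 0)
    (hz : z 1 = P.height i (z 0)) {t : ℝ} (h0 : 0 ≤ t) (h1 : t ≤ 1)
    (hx : z 0 = P.vtx i 0 + t * (P.vtx (i + 1) 0 - P.vtx i 0)) : z ∈ P.edge i := by
  refine P.mem_edge_of_coord h0 h1 hx ?_
  have h' : P.vtx (i + 1) 0 - P.vtx i 0 ≠ 0 := sub_ne_zero.2 h.symm
  rw [hz, height, hx]
  field_simp
  ring

/-- The corrected contribution of the edge `i` to the crossing number is constant near a point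
outside the edge. -/
lemma locConst_term {i : ℕ} {z : Pt} (hz : z ∉ P.edge i) :
    LocConst (fun z' => P.cross i (z' 0) * (if 0 ≤ P.height i (z' 0) - z' 1 then 1 else 0)
      - (heav (z' 0 - P.vtx (i + 1) 0) * (if 0 ≤ P.vtx (i + 1) 1 - z 1 then 1 else 0)
        - heav (z' 0 - P.vtx i 0) * (if 0 ≤ P.vtx i 1 - z 1 then 1 else 0))) z := by
  have hcont : Continuous fun z : Pt => P.height i (z 0) - z 1 := by
    have := P.continuous_height i; fun_prop
  by_cases hX : P.vtx i 0 = P.vtx (i + 1) 0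
  · have e : ∀ z' : Pt, P.cross i (z' 0) * (if 0 ≤ P.height i (z' 0) - z' 1 then 1 else 0)
      - (heav (z' 0 - P.vtx (i + 1) 0) * (if 0 ≤ P.vtx (i + 1) 1 - z 1 then 1 else 0)
        - heav (z' 0 - P.vtx i 0) * (if 0 ≤ P.vtx i 1 - z 1 then 1 else 0)) =
        heav (z' 0 - P.vtx i 0) * ((if 0 ≤ P.vtx i 1 - z 1 then 1 else 0) -
          (if 0 ≤ P.vtx (i + 1) 1 - z 1 then 1 else 0)) := by
      intro z'; rw [cross, ← hX]; ring
    simp only [e]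
    by_cases h0 : z 0 = P.vtx i 0
    · have hβ : ((if 0 ≤ P.vtx i 1 - z 1 then 1 else 0) -
          (if 0 ≤ P.vtx (i + 1) 1 - z 1 then 1 else 0) : ℝ) = 0 := by
        by_contra hne
        apply hz
        have hY : P.vtx (i + 1) 1 - P.vtx i 1 ≠ 0 := by
          intro h; apply hne; rw [sub_eq_zero] at h; rw [h]; simp
        refine P.mem_edge_of_coord (t := (z 1 - P.vtx i 1) / (P.vtx (i + 1) 1 - P.vtx i 1))
          ?_ ?_ (by rw [h0, hX]; ring) (by rw [div_mul_cancel₀ _ hY]; ring)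
        all_goals
          split_ifs at hne with h1 h2 h2
          · simp at hne
          · first
              | exact div_nonneg_of_nonpos (by linarith) (by linarith)
              | exact (div_le_one_of_neg (by linarith)).2 (by linarith)
          · first
              | exact div_nonneg (by linarith) (by linarith)
              | exact (div_le_one (by linarith)).2 (by linarith)
          · simp at hne
      simp only [hβ, mul_zero]
      exact LocConst.const 0 z
    · exact (locConst_heav h0).mul (LocConst.const _ z)
  · by_cases h1 : z 0 = P.vtx (i + 1) 0
    · have h0 : z 0 ≠ P.vtx i 0 := fun h => hX (h.symm.trans h1)
      have hy : P.height i (z 0) - z 1 ≠ 0 := by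
        rw [h1, P.height_right hX, sub_ne_zero]
        intro h
        exact hz (by rw [Pt.ext_coord h1 h.symm]; exact P.right_mem_edge i)
      have hl := locConst_le hcont hy
      have hv : (if 0 ≤ P.height i (z 0) - z 1 then 1 else 0 : ℝ) =
          if 0 ≤ P.vtx (i + 1) 1 - z 1 then 1 else 0 := by rw [h1, P.height_right hX]
      have := (locConst_heav h0).mul (LocConst.const
        ((if 0 ≤ P.vtx i 1 - z 1 then 1 else 0) - (if 0 ≤ P.vtx (i + 1) 1 - z 1 then 1 else 0)) z)
      filter_upwards [hl, this] with z' h2 h3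
      rw [h2, hv, cross, cross]
      linear_combination h3
    · by_cases h0 : z 0 = P.vtx i 0
      · have hy : P.height i (z 0) - z 1 ≠ 0 := by
          rw [h0, P.height_left, sub_ne_zero]
          intro h
          exact hz (by rw [Pt.ext_coord h0 h.symm]; exact P.left_mem_edge i)
        have hl := locConst_le hcont hy
        have hv : (if 0 ≤ P.height i (z 0) - z 1 then 1 else 0 : ℝ) =
            if 0 ≤ P.vtx i 1 - z 1 then 1 else 0 := by rw [h0, P.height_left]
        have := (locConst_heav h1).mul (LocConst.const
          ((if 0 ≤ P.vtx i 1 - z 1 then 1 else 0) -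
            (if 0 ≤ P.vtx (i + 1) 1 - z 1 then 1 else 0)) z)
        filter_upwards [hl, this] with z' h2 h3
        rw [h2, hv, cross, cross]
        linear_combination h3
      · have hs : LocConst (fun z => P.cross i (z 0)) z := (locConst_heav h1).sub (locConst_heav h0)
        have hβ := ((locConst_heav h1).mul
          (LocConst.const (if 0 ≤ P.vtx (i + 1) 1 - z 1 then 1 else 0) z)).sub
          ((locConst_heav h0).mul (LocConst.const (if 0 ≤ P.vtx i 1 - z 1 then 1 else 0) z))
        refine LocConst.sub ?_ hβ
        by_cases hy : P.height i (z 0) - z 1 = 0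
        · have hz0 : P.cross i (z 0) = 0 := by
            by_contra hne
            apply hz
            have hX' : P.vtx (i + 1) 0 - P.vtx i 0 ≠ 0 := sub_ne_zero.2 (Ne.symm hX)
            refine P.mem_edge_of_height hX (by linarith)
              (t := (z 0 - P.vtx i 0) / (P.vtx (i + 1) 0 - P.vtx i 0)) ?_ ?_
              (by rw [div_mul_cancel₀ _ hX']; ring)
            all_goals
              unfold cross heav at hne
              split_ifs at hne with h1 h2 h2
              · simp at hne
              · first
                  | exact div_nonneg_of_nonpos (by linarith) (by linarith)
                  | exact (div_le_one_of_neg (by linarith)).2 (by linarith)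
              · first
                  | exact div_nonneg (by linarith) (by linarith)
                  | exact (div_le_one (by linarith)).2 (by linarith)
              · simp at hne
          filter_upwards [hs] with z' h
          rw [h, hz0]; simp
        · exact hs.mul (locConst_le hcont hy)

lemma vtx_n : P.vtx P.n = P.vtx 0 := by
  have := P.periodic 0; rwa [zero_add] at this

lemma wind_eq (β : ℕ → ℝ) (hβ : β P.n = β 0) (z : Pt) :
    P.wind z = ∑ i ∈ Finset.range P.n,
      (P.cross i (z 0) * (if 0 ≤ P.height i (z 0) - z 1 then 1 else 0)
      - (heav (z 0 - P.vtx (i + 1) 0) * β (i + 1) - heav (z 0 - P.vtx i 0) * β i)) := by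
  rw [Finset.sum_sub_distrib, Finset.sum_range_sub (fun i => heav (z 0 - P.vtx i 0) * β i),
    P.vtx_n, hβ]
  simp [wind]

lemma locConst_wind {z : Pt} (hz : z ∉ P.boundary) : LocConst P.wind z := by
  have := fun z' => P.wind_eq (fun i => if 0 ≤ P.vtx i 1 - z 1 then 1 else 0)
    (by simp [P.vtx_n]) z'
  rw [show P.wind = _ from funext this]
  exact LocConst.sum fun i _ => P.locConst_term fun h => hz (P.edge_subset_boundary i h)

lemma wind_eq_of_comp_eq {x y : Pt} (hx : x ∉ P.boundary) (hy : y ∉ P.boundary)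
    (h : P.comp x = P.comp y) : P.wind x = P.wind y := by
  have hx' : x ∈ P.comp x := mem_connectedComponentIn hx
  have hy' : y ∈ P.comp x := h ▸ mem_connectedComponentIn hy
  refine isPreconnected_connectedComponentIn.induction₂ (fun x y => P.wind x = P.wind y) ?_ ?_ ?_
    hx' hy'
  · intro z hz
    have hz' : z ∉ P.boundary := connectedComponentIn_subset _ _ hz
    filter_upwards [mem_nhdsWithin_of_mem_nhds (P.locConst_wind hz')] with z' h
    exact Eq.symm h
  · intro _ _ _ _ _ _ h1 h2; exact h1.trans h2
  · intro _ _ _ _ h; exact h.symm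

/-- The crossing number jumps by one across the boundary. -/
lemma wind_jump {i : ℕ} (hi : i < P.n) (hX : P.vtx i 0 ≠ P.vtx (i + 1) 0) :
    ∃ c : ℝ, ∀ᶠ z in nhds (P.vtx i + (1 / 2 : ℝ) • P.dir i),
      (0 < det2 (P.dir i) (z - P.vtx i) → P.wind z = c + 1) ∧
      (det2 (P.dir i) (z - P.vtx i) < 0 → P.wind z = c) := by
  set m := P.vtx i + (1 / 2 : ℝ) • P.dir i with hm
  have hm0 : m 0 = (P.vtx i 0 + P.vtx (i + 1) 0) / 2 := by
    simp [hm, dir]; ring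
  have h0 : m 0 ≠ P.vtx i 0 := fun h => hX (by linarith)
  have h1 : m 0 ≠ P.vtx (i + 1) 0 := fun h => hX (by linarith)
  have hw := fun z' => P.wind_eq (fun j => if 0 ≤ P.vtx j 1 - m 1 then 1 else 0)
    (by simp [P.vtx_n]) z'
  have hs : LocConst (fun z => P.cross i (z 0)) m := (locConst_heav h1).sub (locConst_heav h0)
  have hβ := ((locConst_heav h1).mul
    (LocConst.const (if 0 ≤ P.vtx (i + 1) 1 - m 1 then 1 else 0) m)).sub
    ((locConst_heav h0).mul (LocConst.const (if 0 ≤ P.vtx i 1 - m 1 then 1 else 0) m))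
  have hrest : LocConst (fun z' => ∑ j ∈ (Finset.range P.n).erase i,
      (P.cross j (z' 0) * (if 0 ≤ P.height j (z' 0) - z' 1 then 1 else 0)
      - (heav (z' 0 - P.vtx (j + 1) 0) * (if 0 ≤ P.vtx (j + 1) 1 - m 1 then 1 else 0) -
        heav (z' 0 - P.vtx j 0) * (if 0 ≤ P.vtx j 1 - m 1 then 1 else 0)))) m := by
    refine LocConst.sum fun j hj => P.locConst_term fun h => ?_
    have := P.edge_unique (by norm_num) (by norm_num) h
    rw [Finset.mem_erase, Finset.mem_range] at hj
    rw [Nat.mod_eq_of_lt hi, Nat.mod_eq_of_lt hj.2] at this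
    exact hj.1 this
  have hdet : ∀ z : Pt, det2 (P.dir i) (z - P.vtx i) =
      (P.vtx (i + 1) 0 - P.vtx i 0) * (z 1 - P.height i (z 0)) := by
    intro z
    have h' : P.vtx (i + 1) 0 - P.vtx i 0 ≠ 0 := sub_ne_zero.2 hX.symm
    simp only [det2, dir, height, PiLp.sub_apply]
    field_simp
    ring
  obtain ⟨c, hc⟩ : ∃ c : ℝ, ∀ᶠ z in nhds m,
      P.wind z = P.cross i (m 0) * (if 0 ≤ P.height i (z 0) - z 1 then 1 else 0) + c := by
    obtain ⟨c, hc⟩ := (hrest.sub hβ).exists_const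
    refine ⟨c, ?_⟩
    filter_upwards [hs, hc] with z e1 e2
    rw [hw, ← Finset.add_sum_erase _ _ (Finset.mem_range.2 hi), ← e1]
    linear_combination e2
  rcases hX.lt_or_gt with hlt | hlt
  · refine ⟨c - 1, ?_⟩
    have hcr : P.cross i (m 0) = -1 := by
      simp only [cross, heav]
      rw [if_neg (by linarith), if_pos (by linarith)]; norm_num
    filter_upwards [hc] with z hz
    rw [hz, hcr, hdet]
    constructor
    · intro h
      have := pos_of_mul_pos_right h (by linarith)
      rw [if_neg (by linarith)]; ring
    · intro h
      have : z 1 - P.height i (z 0) < 0 := by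
        by_contra! hh
        nlinarith
      rw [if_pos (by linarith)]; ring
  · refine ⟨c, ?_⟩
    have hcr : P.cross i (m 0) = 1 := by
      simp only [cross, heav]
      rw [if_pos (by linarith), if_neg (by linarith)]; norm_num
    filter_upwards [hc] with z hz
    rw [hz, hcr, hdet]
    constructor
    · intro h
      have : z 1 - P.height i (z 0) < 0 := by
        by_contra! hh
        nlinarith
      rw [if_pos (by linarith)]; ring
    · intro h
      have : 0 < z 1 - P.height i (z 0) := by
        by_contra! hh
        nlinarith
      rw [if_neg (by linarith)]; ring

lemma abs_coord_le (z : Pt) (j : Fin 2) : |z j| ≤ ‖z‖ := PiLp.norm_apply_le z j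

lemma exists_bound : ∃ M > 0, P.boundary ⊆ Metric.ball 0 M := by
  obtain ⟨M, hM⟩ := P.isCompact_boundary.isBounded.subset_ball_lt 0 0
  exact ⟨M, hM.1, hM.2⟩

lemma wind_eq_zero {M : ℝ} (hM : P.boundary ⊆ Metric.ball 0 M) {z : Pt} (hz : M ≤ z 1) :
    P.wind z = 0 := by
  refine Finset.sum_eq_zero fun i _ => ?_
  have hY : ∀ j, P.vtx j 1 < M := fun j => by
    have := hM (P.edge_subset_boundary j (P.left_mem_edge j))
    rw [mem_ball_zero_iff] at this
    exact (le_abs_self _).trans_lt ((abs_coord_le _ 1).trans_lt this)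
  by_contra hne
  obtain ⟨hc, hh⟩ := mul_ne_zero_iff.1 hne
  have hh' : 0 ≤ P.height i (z 0) - z 1 := by by_contra h; simp [h] at hh
  have hX : P.vtx (i + 1) 0 - P.vtx i 0 ≠ 0 := by
    intro h; rw [sub_eq_zero] at h; simp [cross, h] at hc
  set t := (z 0 - P.vtx i 0) / (P.vtx (i + 1) 0 - P.vtx i 0) with ht
  have e : P.height i (z 0) = P.vtx i 1 + t * (P.vtx (i + 1) 1 - P.vtx i 1) := by
    rw [height, ht]; ring
  have h0 : 0 ≤ t ∧ t ≤ 1 := by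
    unfold cross heav at hc
    split_ifs at hc with h1 h2 h2
    · simp at hc
    · exact ⟨div_nonneg_of_nonpos (by linarith) (by linarith),
        (div_le_one_of_neg (by linarith)).2 (by linarith)⟩
    · exact ⟨div_nonneg (by linarith) (by linarith), (div_le_one (by linarith)).2 (by linarith)⟩
    · simp at hc
  have h1 := hY i
  have h2 := hY (i + 1)
  rw [e] at hh'
  nlinarith [mul_nonneg h0.1 (sub_nonneg.2 h2.le), mul_nonneg (sub_nonneg.2 h0.2) (sub_nonneg.2 h1.le)]

/-- A counterclockwise polygon has a point with positive crossing number. -/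
lemma exists_wind_pos (hP : P.CCW) : ∃ z, z ∉ P.boundary ∧ 0 < P.wind z := by
  obtain ⟨M, hM0, hM⟩ := P.exists_bound
  have hv : ∀ j k, |P.vtx j k| ≤ M := fun j k => by
    have := hM (P.edge_subset_boundary j (P.left_mem_edge j))
    rw [mem_ball_zero_iff] at this
    exact (abs_coord_le _ k).trans this.le
  have hInt : ∀ i ∈ Finset.range P.n,
      IntervalIntegrable (fun x => P.cross i x * P.height i x) MeasureTheory.volume (-M) M := by
    intro i _
    have h1 := (heav_integral (P.continuous_height i) (abs_le.1 (hv (i + 1) 0)).1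
      (abs_le.1 (hv (i + 1) 0)).2).1
    have h2 := (heav_integral (P.continuous_height i) (abs_le.1 (hv i 0)).1
      (abs_le.1 (hv i 0)).2).1
    simpa only [cross, sub_mul] using h1.sub h2
  have hval : ∀ i, ∫ x in (-M)..M, P.cross i x * P.height i x =
      (P.vtx i 0 - P.vtx (i + 1) 0) * (P.vtx i 1 + P.vtx (i + 1) 1) / 2 := by
    intro i
    have h1 := (heav_integral (P.continuous_height i) (abs_le.1 (hv (i + 1) 0)).1
      (abs_le.1 (hv (i + 1) 0)).2)
    have h2 := (heav_integral (P.continuous_height i) (abs_le.1 (hv i 0)).1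
      (abs_le.1 (hv i 0)).2)
    simp only [cross, sub_mul]
    rw [intervalIntegral.integral_sub h1.1 h2.1, h1.2, h2.2,
      ← intervalIntegral.integral_add_adjacent_intervals (b := P.vtx i 0)
        ((P.continuous_height i).intervalIntegrable (P.vtx (i + 1) 0) _)
        ((P.continuous_height i).intervalIntegrable _ M), add_sub_cancel_right]
    simp only [height]
    rw [integral_affine]
    by_cases hX : P.vtx (i + 1) 0 - P.vtx i 0 = 0
    · rw [sub_eq_zero] at hX; rw [hX]; ring
    · field_simp; ring
  have htot : 0 < ∫ x in (-M)..M, ∑ i ∈ Finset.range P.n, P.cross i x * P.height i x := by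
    rw [intervalIntegral.integral_finsetSum hInt]
    have : ∑ i ∈ Finset.range P.n, ∫ x in (-M)..M, P.cross i x * P.height i x
        = P.shoelace / 2 := by
      have htel := Finset.sum_range_sub (fun i => P.vtx i 0 * P.vtx i 1) P.n
      rw [P.vtx_n, sub_self] at htel
      rw [SimplePolygon.shoelace, Finset.sum_div, ← sub_zero (∑ i ∈ _, _ / 2),
        ← zero_div 2, ← htel, Finset.sum_div, ← Finset.sum_sub_distrib]
      refine Finset.sum_congr rfl fun i _ => ?_
      rw [hval, det2]; ring
    rw [this]
    exact half_pos hP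
  obtain ⟨x, hx, hpos⟩ := exists_pos_of_integral_pos (by linarith)
    (IntervalIntegrable.sum _ hInt |>.congr (by
      intro x _; simp)) htot
    (N := (fun i => P.vtx i 0) '' (Finset.range P.n : Set ℕ)) ((Finset.finite_toSet _).image _)
  have hxv : ∀ i, x ≠ P.vtx i 0 := fun i h => hx ⟨i % P.n, by
    simpa using Nat.mod_lt _ P.n_pos, by simp only [P.vtx_mod]; exact h.symm⟩
  obtain ⟨M', hM'0, hM'⟩ : ∃ M' > 0, ∀ i ∈ Finset.range P.n, |P.height i x| ≤ M' := by
    refine ⟨1 + ∑ i ∈ Finset.range P.n, |P.height i x|, by positivity, fun i hi => ?_⟩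
    have := Finset.single_le_sum (f := fun i => |P.height i x|) (fun i _ => abs_nonneg _) hi
    linarith
  have e : ∀ y l : ℝ, (if 0 ≤ l - y then 1 else 0 : ℝ) = 1 - heav (y - l) * 1 := by
    intro y l
    unfold heav
    split_ifs with h1 h2 h2
    · linarith
    · norm_num
    · norm_num
    · linarith
  have hInt2 : ∀ i ∈ Finset.range P.n, IntervalIntegrable
      (fun y => P.cross i x * (if 0 ≤ P.height i x - y then 1 else 0))
      MeasureTheory.volume (-M') M' := by
    intro i hi
    have h1 := (heav_integral (continuous_const (y := (1 : ℝ))) (abs_le.1 (hM' i hi)).1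
      (abs_le.1 (hM' i hi)).2).1
    simp only [e]
    exact (((continuous_const).intervalIntegrable _ _).sub h1).const_mul _
  have hval2 : ∀ i ∈ Finset.range P.n, ∫ y in (-M')..M',
      P.cross i x * (if 0 ≤ P.height i x - y then 1 else 0) =
      P.cross i x * P.height i x + P.cross i x * M' := by
    intro i hi
    have h1 := (heav_integral (continuous_const (y := (1 : ℝ))) (abs_le.1 (hM' i hi)).1
      (abs_le.1 (hM' i hi)).2)
    simp only [e]
    rw [intervalIntegral.integral_const_mul, intervalIntegral.integral_sub
      ((continuous_const).intervalIntegrable _ _) h1.1, h1.2]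
    simp; ring
  have htot2 : 0 < ∫ y in (-M')..M', ∑ i ∈ Finset.range P.n,
      P.cross i x * (if 0 ≤ P.height i x - y then 1 else 0) := by
    rw [intervalIntegral.integral_finsetSum hInt2, Finset.sum_congr rfl hval2,
      Finset.sum_add_distrib, ← Finset.sum_mul]
    have : ∑ i ∈ Finset.range P.n, P.cross i x = 0 := by
      simp only [cross]
      rw [Finset.sum_range_sub (fun i => heav (x - P.vtx i 0)), P.vtx_n, sub_self]
    rw [this]; simpa using hpos
  obtain ⟨y, hy, hpos'⟩ := exists_pos_of_integral_pos (by linarith)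
    (IntervalIntegrable.sum _ hInt2 |>.congr (by
      intro x _; simp)) htot2
    (N := (fun i => P.height i x) '' (Finset.range P.n : Set ℕ)) ((Finset.finite_toSet _).image _)
  refine ⟨mkPt x y, fun hb => ?_, by simpa [wind] using hpos'⟩
  simp only [boundary, Set.mem_iUnion, Finset.mem_range, exists_prop] at hb
  obtain ⟨i, hi, hb⟩ := hb
  obtain ⟨t, h0, h1, ht⟩ := P.mem_edge_iff.1 hb
  have ex : x = P.vtx i 0 + t * (P.vtx (i + 1) 0 - P.vtx i 0) := by
    have := congrArg (fun z : Pt => z 0) ht; simpa [dir] using this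
  have ey : y = P.vtx i 1 + t * (P.vtx (i + 1) 1 - P.vtx i 1) := by
    have := congrArg (fun z : Pt => z 1) ht; simpa [dir] using this
  refine hy ⟨i, by simpa using hi, ?_⟩
  have hX : P.vtx (i + 1) 0 - P.vtx i 0 ≠ 0 := by
    intro h; exact hxv i (by rw [ex, h]; ring)
  simp only [height]
  rw [ey, ex]
  field_simp
  ring

end SimplePolygon

/-! ### The exterior region of a polygon -/

/-- An open connected region with bounded complement whose only boundary points where it is
locally nonconvex belong to the finite set `C`, and which at the points of `C` can be entered by
rays whose opposite rays start outside the region. -/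
structure OuterRegion (E C : Set Pt) : Prop where
  isOpen : IsOpen E
  isPreconnected : IsPreconnected E
  bounded : Bornology.IsBounded Eᶜ
  finite : C.Finite
  disjoint : ∀ c ∈ C, c ∉ E
  locally_convex : ∀ p, p ∉ E → p ∉ C → ∃ r > 0, Convex ℝ (E ∩ Metric.ball p r)
  cut : ∀ c ∈ C, ∃ O : Set Pt, IsOpen O ∧ O.Nonempty ∧
    ∀ d ∈ O, ∃ r > (0 : ℝ), ∀ t : ℝ, 0 < t → t < r → c + t • d ∈ E ∧ c - t • d ∉ E

lemma isPreconnected_compl_ball (M : ℝ) :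
    IsPreconnected (Metric.ball (0 : Pt) M)ᶜ := by
  have hr : 1 < Module.rank ℝ Pt := by
    rw [rank_eq_card_basis (EuclideanSpace.basisFun (Fin 2) ℝ).toBasis]; simp
  have h := (isPreconnected_Ici (a := M)).prod (isPreconnected_sphere hr (0 : Pt) 1)
  have h2 := h.image (fun x : ℝ × Pt => x.1 • x.2) (by fun_prop)
  convert h2 using 1
  ext x
  simp only [Set.mem_compl_iff, mem_ball_zero_iff, not_lt, Set.mem_image, Prod.exists,
    Set.mem_prod, Set.mem_Ici, mem_sphere_zero_iff_norm]
  constructor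
  · intro hx
    rcases eq_or_ne x 0 with rfl | h0
    · obtain ⟨y, hy⟩ : ∃ y : Pt, ‖y‖ = 1 := exists_norm_eq Pt zero_le_one
      exact ⟨0, y, ⟨by simpa using hx, hy⟩, by simp⟩
    · refine ⟨‖x‖, ‖x‖⁻¹ • x, ⟨hx, ?_⟩, ?_⟩
      · rw [norm_smul, norm_inv, norm_norm, inv_mul_cancel₀ (norm_ne_zero_iff.2 h0)]
      · rw [smul_smul, mul_inv_cancel₀ (norm_ne_zero_iff.2 h0), one_smul]
  · rintro ⟨r, y, ⟨hr, hy⟩, rfl⟩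
    rw [norm_smul, hy, mul_one]
    exact hr.trans (le_abs_self r)

namespace SimplePolygon

variable (P : SimplePolygon)

lemma mem_comp {x : Pt} (hx : x ∉ P.boundary) : x ∈ P.comp x := mem_connectedComponentIn hx

lemma comp_eq_of_mem {x y : Pt} (h : x ∈ P.comp y) : P.comp x = P.comp y :=
  (connectedComponentIn_eq h).symm

lemma notMem_boundary_of_mem_comp {x y : Pt} (h : x ∈ P.comp y) : x ∉ P.boundary :=
  connectedComponentIn_subset _ _ h

lemma exists_nonvertical (hP : P.CCW) : ∃ i < P.n, P.vtx i 0 ≠ P.vtx (i + 1) 0 := by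
  by_contra! h
  have hc : ∀ i ≤ P.n, P.vtx i 0 = P.vtx 0 0 := by
    intro i
    induction i with
    | zero => simp
    | succ k ih => intro hk; rw [← h k (by omega)]; exact ih (by omega)
  have : P.shoelace = 0 := by
    have htel := Finset.sum_range_sub (fun i => P.vtx 0 0 * P.vtx i 1) P.n
    rw [P.vtx_n, sub_self] at htel
    rw [shoelace, ← htel]
    refine Finset.sum_congr rfl fun i hi => ?_
    rw [Finset.mem_range] at hi
    rw [det2, hc i hi.le, hc (i + 1) hi]; ring
  exact absurd hP (by rw [CCW, this]; exact lt_irrefl 0)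

lemma exists_outer (hP : P.CCW) : P.regionᶜ = P.rightC ∧ P.rightC ≠ P.leftC ∧
    (∃ z, z ∉ P.boundary ∧ P.comp z = P.rightC) ∧ Bornology.IsBounded P.region := by
  obtain ⟨M, hM0, hM⟩ := P.exists_bound
  have hsub : ∀ x : Pt, x ∈ (Metric.ball (0 : Pt) M)ᶜ → x ∉ P.boundary := fun x hx hb => hx (hM hb)
  set z : Pt := mkPt 0 M with hz
  have hzM : z ∈ (Metric.ball (0 : Pt) M)ᶜ := by
    rw [Set.mem_compl_iff, mem_ball_zero_iff, not_lt]
    have := abs_coord_le z 1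
    have e : z 1 = M := by simp [hz, mkPt]
    rw [e] at this
    exact (le_abs_self M).trans this
  have hfar : ∀ x : Pt, x ∈ (Metric.ball (0 : Pt) M)ᶜ → P.comp x = P.comp z := fun x hx =>
    P.comp_eq_of_preconnected (isPreconnected_compl_ball M) hsub hx hzM
  have hunb : ¬ Bornology.IsBounded (P.comp z) := by
    intro hb
    obtain ⟨M', hM'⟩ := hb.subset_ball 0
    obtain ⟨y, hy⟩ : ∃ y : Pt, ‖y‖ = max M M' := exists_norm_eq Pt (le_max_of_le_left hM0.le)
    have hy1 : y ∈ (Metric.ball (0 : Pt) M)ᶜ := by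
      rw [Set.mem_compl_iff, mem_ball_zero_iff, not_lt, hy]; exact le_max_left _ _
    have := hM' (hfar y hy1 ▸ P.mem_comp (hsub y hy1))
    rw [mem_ball_zero_iff, hy] at this
    exact absurd (le_max_right M M') (not_le.2 this)
  have hreg : P.regionᶜ = P.comp z := by
    ext x
    simp only [region, interior, Set.mem_compl_iff, Set.mem_union, Set.mem_ofPred_eq, not_or, not_and]
    constructor
    · rintro ⟨h1, h2⟩
      have h3 : ¬ P.comp x ⊆ Metric.ball 0 M := fun h => h2 h1 (Metric.isBounded_ball.subset h)
      obtain ⟨y, hy, hyM⟩ := Set.not_subset.1 h3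
      rw [← hfar y hyM, P.comp_eq_of_mem hy]
      exact P.mem_comp h1
    · intro h
      refine ⟨P.notMem_boundary_of_mem_comp h, fun _ hb => hunb ?_⟩
      rw [← P.comp_eq_of_mem h]; exact hb
  have hzb := hsub z hzM
  have hwz : P.wind z = 0 := P.wind_eq_zero hM (by simp [hz, mkPt])
  obtain ⟨i, hi, hX⟩ := P.exists_nonvertical hP
  obtain ⟨c, hc⟩ := P.wind_jump hi hX
  obtain ⟨r, hr, hloc⟩ := P.local_open_edge i (t := 1 / 2) (by norm_num) (by norm_num)
  obtain ⟨r', hr', hc⟩ := Metric.eventually_nhds_iff_ball.1 hc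
  obtain ⟨xl, hxl, hxlb⟩ := P.side_ball_nonempty one_ne_zero i (1 / 2) (lt_min hr hr')
  obtain ⟨xr, hxr, hxrb⟩ := P.side_ball_nonempty (ς := -1) (by norm_num) i (1 / 2) (lt_min hr hr')
  simp only [side, Set.mem_ofPred_eq, one_mul, neg_mul, neg_pos] at hxl hxr
  have hl := hloc xl (Metric.ball_subset_ball (min_le_left _ _) hxlb)
  have hr := hloc xr (Metric.ball_subset_ball (min_le_left _ _) hxrb)
  have hlw := (hc xl (Metric.ball_subset_ball (min_le_right _ _) hxlb)).1 hxl
  have hrw := (hc xr (Metric.ball_subset_ball (min_le_right _ _) hxrb)).2 hxr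
  have hlb : xl ∉ P.boundary := fun h => hxl.ne' (hl.1.1 h)
  have hrb : xr ∉ P.boundary := fun h => hxr.ne (hr.1.1 h)
  have hlc := hl.2.1 hxl
  have hrc := hr.2.2 hxr
  have hne : P.rightC ≠ P.leftC := by
    intro h
    have := P.wind_eq_of_comp_eq hlb hrb (by rw [hlc, hrc, h])
    linarith
  have hright : P.comp z = P.rightC := by
    rcases P.comp_eq_left_or_right hzb with h | h
    · exfalso
      have h0 := P.wind_eq_of_comp_eq hlb hzb (by rw [hlc, h])
      obtain ⟨y, hy, hpos⟩ := P.exists_wind_pos hP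
      rcases P.comp_eq_left_or_right hy with h' | h'
      · have := P.wind_eq_of_comp_eq hy hlb (by rw [hlc, h'])
        linarith
      · have := P.wind_eq_of_comp_eq hy hrb (by rw [hrc, h'])
        linarith
    · exact h
  refine ⟨hreg.trans hright, hne, ⟨z, hzb, hright⟩, ?_⟩
  refine (Metric.isBounded_ball (x := (0 : Pt)) (r := M)).subset fun x hx => ?_
  by_contra hxM
  have : x ∈ P.regionᶜ := by rw [hreg, ← hfar x hxM]; exact P.mem_comp (hsub x hxM)
  exact this hx

theorem outerRegion (hP : P.CCW) :
    OuterRegion P.regionᶜ ((fun i => P.vtx (i + 1)) '' {i | i < P.n ∧ P.ConvexAt i}) := by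
  obtain ⟨hE, hne, ⟨z, hz, hzr⟩, hb⟩ := P.exists_outer hP
  have hEz : P.regionᶜ = P.comp z := hE.trans hzr.symm
  have hopen : IsOpen P.regionᶜ := by
    rw [hEz]; exact P.isCompact_boundary.isClosed.isOpen_compl.connectedComponentIn
  have hmem : ∀ x, x ∈ P.regionᶜ ↔ x ∉ P.boundary ∧ P.comp x = P.rightC := by
    intro x
    rw [hEz]
    constructor
    · intro h; exact ⟨P.notMem_boundary_of_mem_comp h, (P.comp_eq_of_mem h).trans hzr⟩
    · rintro ⟨h1, h2⟩; rw [hzr, ← h2]; exact P.mem_comp h1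
  have hfin : {i | i < P.n ∧ P.ConvexAt i}.Finite := (Set.finite_lt_nat P.n).subset fun _ h => h.1
  refine ⟨hopen, ?_, by rwa [compl_compl], hfin.image _, ?_, ?_, ?_⟩
  · rw [hEz]; exact isPreconnected_connectedComponentIn
  · rintro _ ⟨i, -, rfl⟩ h
    exact ((hmem _).1 h).1 (P.edge_subset_boundary i (P.right_mem_edge i))
  · intro p hp hpC
    by_cases hpb : p ∈ P.boundary
    · rcases P.cases_of_mem_boundary hpb with ⟨i, hi, rfl⟩ | ⟨i, t, h0, h1, rfl⟩
      · have hnc : ¬ 0 < det2 (P.dir i) (P.dir (i + 1)) := fun h => hpC ⟨i, ⟨hi, h⟩, rfl⟩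
        obtain ⟨r, hr, hloc⟩ := P.local_vertex i
        refine ⟨r, hr, ?_⟩
        have e : P.regionᶜ ∩ Metric.ball (P.vtx (i + 1)) r =
            sector (-1) (P.vtx (i + 1)) (P.dir i) (P.dir (i + 1)) ∩
              Metric.ball (P.vtx (i + 1)) r := by
          ext x
          simp only [Set.mem_inter_iff, and_congr_left_iff]
          intro hx
          obtain ⟨h1, h2, h3⟩ := hloc x hx
          rw [hmem]
          refine ⟨fun h => (h1 h.1).resolve_left fun h' => hne (h.2.symm.trans (h2 h').2), h3⟩
        rw [e]
        refine Convex.inter ?_ (convex_ball _ _)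
        unfold sector
        rcases (not_lt.1 hnc).lt_or_eq with h | h
        · simp only [neg_mul, one_mul, neg_pos, if_pos h]
          have := (convex_side (-1) (P.vtx (i + 1)) (P.dir i)).inter
            (convex_side (-1) (P.vtx (i + 1)) (P.dir (i + 1)))
          simp only [side, neg_mul, one_mul, neg_pos] at this
          exact this
        · obtain ⟨c, hc, hcd⟩ := P.exists_pos_smul_dir h
          have := convex_side (-1) (P.vtx (i + 1)) (P.dir i)
          simp only [h, mul_zero, lt_irrefl, if_false]
          convert this using 1
          ext x
          simp only [side, Set.mem_ofPred_eq, hcd, det2_smul_left]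
          constructor
          · rintro (h | h)
            · exact h
            · by_contra hh; nlinarith
          · exact Or.inl
      · obtain ⟨r, hr, hloc⟩ := P.local_open_edge i h0 h1
        refine ⟨r, hr, ?_⟩
        have e : P.regionᶜ ∩ Metric.ball (P.vtx i + t • P.dir i) r =
            side (-1) (P.vtx i) (P.dir i) ∩ Metric.ball (P.vtx i + t • P.dir i) r := by
          ext x
          simp only [Set.mem_inter_iff, and_congr_left_iff]
          intro hx
          obtain ⟨h1, h2, h3⟩ := hloc x hx
          rw [hmem, h1]
          simp only [side, Set.mem_ofPred_eq, neg_mul, one_mul, neg_pos]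
          constructor
          · rintro ⟨h4, h5⟩
            rcases lt_or_gt_of_ne h4 with h6 | h6
            · exact h6
            · exact absurd (h5.symm.trans (h2 h6)) hne
          · exact fun h => ⟨h.ne, h3 h⟩
        rw [e]
        exact (convex_side _ _ _).inter (convex_ball _ _)
    · have hop : IsOpen (P.comp p) :=
        P.isCompact_boundary.isClosed.isOpen_compl.connectedComponentIn
      obtain ⟨r, hr, hball⟩ := Metric.isOpen_iff.1 hop p (P.mem_comp hpb)
      refine ⟨r, hr, ?_⟩
      have : P.regionᶜ ∩ Metric.ball p r = ∅ := by
        rw [Set.eq_empty_iff_forall_notMem]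
        rintro x ⟨hx, hxb⟩
        exact hp ((hmem p).2 ⟨hpb, (P.comp_eq_of_mem (hball hxb)).symm.trans ((hmem x).1 hx).2⟩)
      rw [this]; exact convex_empty
  · rintro _ ⟨i, ⟨hi, hconv⟩, rfl⟩
    have hconv : 0 < det2 (P.dir i) (P.dir (i + 1)) := hconv
    obtain ⟨r, hr, hloc⟩ := P.local_vertex i
    refine ⟨{d | det2 (P.dir i) d < 0} ∩ {d | det2 (P.dir (i + 1)) d < 0},
      (isOpen_lt (by fun_prop) (by fun_prop)).inter (isOpen_lt (by fun_prop) (by fun_prop)),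
      ⟨P.dir i - P.dir (i + 1), ?_, ?_⟩, ?_⟩
    · simp only [Set.mem_ofPred_eq, det2_sub_right, det2_self]; linarith
    · simp only [Set.mem_ofPred_eq, det2_sub_right, det2_self]
      rw [det2_swap]; linarith
    rintro d ⟨hd1, hd2⟩
    simp only [Set.mem_ofPred_eq] at hd1 hd2
    have hd0 : d ≠ 0 := by rintro rfl; simp at hd1
    refine ⟨r / ‖d‖, div_pos hr (norm_pos_iff.2 hd0), fun t h0 h1 => ?_⟩
    rw [lt_div_iff₀ (norm_pos_iff.2 hd0)] at h1
    have hb1 : P.vtx (i + 1) + t • d ∈ Metric.ball (P.vtx (i + 1)) r := by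
      simpa [dist_eq_norm, norm_smul, abs_of_pos h0] using h1
    have hb2 : P.vtx (i + 1) - t • d ∈ Metric.ball (P.vtx (i + 1)) r := by
      simpa [dist_eq_norm, norm_smul, abs_of_pos h0] using h1
    constructor
    · refine (hmem _).2 ((hloc _ hb1).2.2 ?_)
      have : ¬ 0 < -1 * det2 (P.dir i) (P.dir (i + 1)) := by linarith
      simp only [sector, if_neg this, Set.mem_ofPred_eq, add_sub_cancel_left, det2_smul_right]
      left; nlinarith
    · intro h
      have := (hloc _ hb2).2.1 (by
        simp only [sector, one_mul, if_pos hconv, Set.mem_ofPred_eq, sub_sub_cancel_left,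
          det2_neg_right, det2_smul_right]
        constructor <;> nlinarith)
      exact hne (((hmem _).1 h).2.symm.trans this.2)

end SimplePolygon

theorem Separable.exists_outerRegion {B R : Finset Pt} (h : Separable B R) :
    ∃ E C : Set Pt, OuterRegion E C ∧ C.ncard ≤ B.card ∧ (∀ r ∈ R, r ∉ E) ∧ ∀ b ∈ B, b ∈ E := by
  obtain ⟨P, hP, hn, hR, hB⟩ := h
  refine ⟨_, _, P.outerRegion hP, (Set.ncard_image_le
    ((Set.finite_lt_nat P.n).subset fun _ h => h.1)).trans hn, fun r hr h => h (Or.inr (hR r hr)), hB⟩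

/-! ### Convex hulls of compact planar sets -/

lemma IsCompact.convexJoin_plane {s t : Set Pt} (hs : IsCompact s) (ht : IsCompact t) :
    IsCompact (convexJoin ℝ s t) := by
  have h : convexJoin ℝ s t = (fun x : (Pt × Pt) × ℝ => x.1.1 + x.2 • (x.1.2 - x.1.1)) ''
      ((s ×ˢ t) ×ˢ Set.Icc (0 : ℝ) 1) := by
    ext x
    simp only [mem_convexJoin, segment_eq_image', Set.mem_image, Prod.exists, Set.mem_prod]
    constructor
    · rintro ⟨a, ha, b, hb, θ, hθ, rfl⟩
      exact ⟨a, b, θ, ⟨⟨ha, hb⟩, hθ⟩, rfl⟩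
    · rintro ⟨a, b, θ, ⟨⟨ha, hb⟩, hθ⟩, rfl⟩
      exact ⟨a, ha, b, hb, θ, hθ, rfl⟩
  rw [h]
  exact ((hs.prod ht).prod isCompact_Icc).image (by fun_prop)

/-- The set of convex combinations of at most `n + 1` points of `K`. -/
def joinIter (K : Set Pt) : ℕ → Set Pt
  | 0 => K
  | n + 1 => convexJoin ℝ K (joinIter K n)

lemma isCompact_joinIter {K : Set Pt} (hK : IsCompact K) : ∀ n, IsCompact (joinIter K n)
  | 0 => hK
  | n + 1 => hK.convexJoin_plane (isCompact_joinIter hK n)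

lemma joinIter_subset_convexHull (K : Set Pt) : ∀ n, joinIter K n ⊆ convexHull ℝ K
  | 0 => subset_convexHull ℝ K
  | n + 1 => convexJoin_subset (subset_convexHull ℝ K)
      (joinIter_subset_convexHull K n) (convex_convexHull ℝ K)

lemma joinIter_subset_succ (K : Set Pt) (n : ℕ) : joinIter K n ⊆ joinIter K (n + 1) := by
  intro x hx
  have hne : K.Nonempty := convexHull_nonempty_iff.1 ⟨x, joinIter_subset_convexHull K n hx⟩
  exact subset_convexJoin_right hne hx

lemma convexHull_finset_subset_joinIter {K : Set Pt} :
    ∀ (n : ℕ) (t : Finset Pt), (t : Set Pt) ⊆ K → t.card ≤ n + 1 →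
      convexHull ℝ (t : Set Pt) ⊆ joinIter K n := by
  intro n
  induction n with
  | zero =>
    intro t ht hc
    rcases t.eq_empty_or_nonempty with rfl | hne
    · simp
    · obtain ⟨a, rfl⟩ := Finset.card_eq_one.1 (le_antisymm hc hne.card_pos)
      simpa [joinIter] using ht
  | succ n ih =>
    intro t ht hc
    rcases t.eq_empty_or_nonempty with rfl | ⟨a, ha⟩
    · simp
    obtain ⟨s, hs, rfl⟩ : ∃ s, a ∉ s ∧ insert a s = t :=
      ⟨t.erase a, Finset.notMem_erase a t, Finset.insert_erase ha⟩
    rw [Finset.coe_insert, Set.insert_subset_iff] at ht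
    rw [Finset.card_insert_of_notMem hs] at hc
    rcases s.eq_empty_or_nonempty with rfl | hne
    · refine (ih _ ?_ (by simp)).trans (joinIter_subset_succ K n)
      simpa using ht.1
    · rw [Finset.coe_insert, convexHull_insert hne]
      exact convexJoin_mono (Set.singleton_subset_iff.2 ht.1) (ih s ht.2 (by omega))

lemma IsCompact.convexHull_plane {K : Set Pt} (hK : IsCompact K) : IsCompact (convexHull ℝ K) := by
  have : convexHull ℝ K = joinIter K 2 := by
    refine Set.Subset.antisymm ?_ (joinIter_subset_convexHull K 2)
    rw [convexHull_eq_union]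
    refine Set.iUnion_subset fun t => Set.iUnion_subset fun ht => Set.iUnion_subset fun hi => ?_
    refine convexHull_finset_subset_joinIter 2 t ht ?_
    have := hi.card_le_finrank_succ
    rw [Fintype.card_coe] at this
    refine this.trans ?_
    have := (vectorSpan ℝ (Set.range ((↑) : t → Pt))).finrank_le
    simp only [finrank_euclideanSpace, Fintype.card_fin] at this
    omega
  rw [this]
  exact isCompact_joinIter hK 2

lemma mkPt_one_zero_ne : mkPt 1 0 ≠ 0 := fun h => by
  simpa using congrFun (congrArg WithLp.ofLp h) 0

/-! ### Propagation along preconnected sets and supporting lines -/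

lemma IsPreconnected.subset_of_eventually {S A : Set Pt} (hS : IsPreconnected S)
    (hA : IsClosed A) (h : ∀ s ∈ S, s ∈ A → ∀ᶠ s' in nhdsWithin s S, s' ∈ A) {q : Pt}
    (hq : q ∈ S) (hqA : q ∈ A) : S ⊆ A := by
  intro x hx
  refine (hS.induction₂ (fun x y => x ∈ A ↔ y ∈ A) (fun s hs => ?_)
    (fun _ _ _ _ _ _ => Iff.trans) (fun _ _ _ _ => Iff.symm) hq hx).1 hqA
  by_cases hsA : s ∈ A
  · exact (h s hs hsA).mono fun y hy => ⟨fun _ => hy, fun _ => hsA⟩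
  · have h' : ∀ᶠ y in nhdsWithin s S, y ∈ Aᶜ :=
      mem_nhdsWithin_of_mem_nhds (hA.isOpen_compl.mem_nhds hsA)
    exact h'.mono fun y hy => ⟨fun h => absurd h hsA, fun h => absurd h hy⟩

lemma exists_det2_lt_of_notMem {Q : Set Pt} (hQ : Convex ℝ Q) (hc : IsClosed Q) {x : Pt}
    (hx : x ∉ Q) : ∃ u, ∀ y ∈ Q, det2 u y < det2 u x := by
  obtain ⟨f, a, h1, h2⟩ := geometric_hahn_banach_closed_point hQ hc hx
  obtain ⟨u, hu⟩ := exists_det2_eq_clm f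
  exact ⟨u, fun y hy => by rw [← hu, ← hu]; exact (h1 y hy).trans h2⟩

lemma exists_det2_lt_of_notMem_of_isOpen {G : Set Pt} (hG : Convex ℝ G) (ho : IsOpen G) {x : Pt}
    (hx : x ∉ G) : ∃ u, ∀ y ∈ G, det2 u y < det2 u x := by
  obtain ⟨f, h⟩ := geometric_hahn_banach_open_point hG ho hx
  obtain ⟨u, hu⟩ := exists_det2_eq_clm f
  exact ⟨u, fun y hy => by rw [← hu, ← hu]; exact h y hy⟩

/-- A nonzero linear functional attaining its maximum over `Q` has no interior maximizer. -/
lemma det2_lt_of_mem_interior {Q : Set Pt} {u z x : Pt} (hu : u ≠ 0)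
    (h : ∀ y ∈ Q, det2 u y ≤ det2 u z) (hx : x ∈ interior Q) : det2 u x < det2 u z := by
  have hcont : Continuous fun t : ℝ => x + t • rot u := by fun_prop
  have h0 : ∀ᶠ t : ℝ in nhdsWithin 0 (Set.Ioi 0), x + t • rot u ∈ interior Q :=
    ((hcont.tendsto 0).mono_left nhdsWithin_le_nhds).eventually
      (isOpen_interior.mem_nhds (by simpa using hx))
  obtain ⟨t, ht, ht0⟩ := (h0.and self_mem_nhdsWithin).exists
  have := h _ (interior_subset ht)
  rw [det2_add_right, det2_smul_right, det2_rot] at this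
  have : 0 < t * ‖u‖ ^ 2 := mul_pos ht0 (by positivity)
  linarith

namespace OuterRegion

variable {E C : Set Pt}

lemma isCompact_compl (h : OuterRegion E C) : IsCompact Eᶜ :=
  Metric.isCompact_of_isClosed_isBounded h.isOpen.isClosed_compl h.bounded

lemma isCompact_hull (h : OuterRegion E C) : IsCompact (convexHull ℝ Eᶜ) :=
  h.isCompact_compl.convexHull_plane

lemma ball_subset_hull (h : OuterRegion E C) {L δ : ℝ} (hδ : 0 < δ)
    (hth : ∀ x : Pt, ‖x‖ ≤ L → ∃ r ∉ E, dist x r < δ) :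
    Metric.ball 0 (L - δ) ⊆ interior (convexHull ℝ Eᶜ) := by
  refine interior_maximal (fun x hx => ?_) Metric.isOpen_ball
  rw [mem_ball_zero_iff] at hx
  by_contra hxQ
  obtain ⟨u, hu⟩ := exists_det2_lt_of_notMem (convex_convexHull ℝ _) h.isCompact_hull.isClosed hxQ
  obtain ⟨r₀, hr₀, -⟩ := hth x (by linarith)
  have hu0 : u ≠ 0 := by
    rintro rfl
    simpa using hu r₀ (subset_convexHull ℝ _ hr₀)
  have hun : 0 < ‖u‖ := norm_pos_iff.2 hu0
  have hn : ‖(δ / ‖u‖) • rot u‖ = δ := by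
    rw [norm_smul, norm_rot, Real.norm_of_nonneg (by positivity), div_mul_cancel₀ _ hun.ne']
  obtain ⟨r, hr, hd⟩ := hth (x + (δ / ‖u‖) • rot u) ((norm_add_le _ _).trans (by linarith))
  have h1 := hu r (subset_convexHull ℝ _ hr)
  have h2 := abs_det2_le u (x + (δ / ‖u‖) • rot u - r)
  rw [← dist_eq_norm] at h2
  have h3 : ‖u‖ * dist (x + (δ / ‖u‖) • rot u) r ≤ ‖u‖ * δ := by gcongr
  have h4 := (le_abs_self _).trans (h2.trans h3)
  rw [det2_sub_right, det2_add_right, det2_smul_right, det2_rot] at h4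
  have : δ / ‖u‖ * ‖u‖ ^ 2 = ‖u‖ * δ := by field_simp
  linarith

lemma extremePoints_subset (h : OuterRegion E C) :
    (convexHull ℝ Eᶜ).extremePoints ℝ ⊆ C := by
  intro p hp
  have hpK : p ∉ E := extremePoints_convexHull_subset hp
  by_contra hpC
  obtain ⟨r, hr, hconv⟩ := h.locally_convex p hpK hpC
  obtain ⟨u, hu⟩ := exists_det2_lt_of_notMem_of_isOpen hconv
    (h.isOpen.inter Metric.isOpen_ball) (fun h' => hpK h'.1)
  obtain ⟨w, hw0, hw⟩ : ∃ w : Pt, w ≠ 0 ∧ det2 u w = 0 := by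
    by_cases hu0 : u = 0
    · exact ⟨mkPt 1 0, mkPt_one_zero_ne, by simp [hu0]⟩
    · exact ⟨u, hu0, det2_self u⟩
  have hmem : ∀ t : ℝ, |t| < r / ‖w‖ → p + t • w ∈ convexHull ℝ Eᶜ := by
    intro t ht
    rw [lt_div_iff₀ (norm_pos_iff.2 hw0)] at ht
    refine subset_convexHull ℝ _ fun hE => ?_
    have := hu _ ⟨hE, by simpa [dist_eq_norm, norm_smul] using ht⟩
    rw [det2_add_right, det2_smul_right, hw] at this
    linarith
  have hpos : 0 < r / ‖w‖ / 2 := by have := norm_pos_iff.2 hw0; positivity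
  have h1 := hmem (r / ‖w‖ / 2) (by rw [abs_of_pos hpos]; linarith)
  have h2 := hmem (-(r / ‖w‖ / 2)) (by rw [abs_neg, abs_of_pos hpos]; linarith)
  have := hp.2 h1 h2 (mem_openSegment_of_ne_left_right ?_ ?_ ?_)
  · simp [hpos.ne', hw0] at this
  · simp [hpos.ne', hw0]
  · simp [hpos.ne', hw0]
  · rw [segment_eq_image']
    exact ⟨1 / 2, by norm_num, by module⟩

lemma hull_subset (h : OuterRegion E C) :
    convexHull ℝ Eᶜ ⊆ convexHull ℝ (C \ interior (convexHull ℝ Eᶜ)) := by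
  have h1 : (convexHull ℝ Eᶜ).extremePoints ℝ ⊆ C \ interior (convexHull ℝ Eᶜ) := by
    refine fun p hp => ⟨h.extremePoints_subset hp, fun hpi => ?_⟩
    obtain ⟨w, hw0⟩ : ∃ w : Pt, w ≠ 0 := ⟨_, mkPt_one_zero_ne⟩
    obtain ⟨r, hr, hball⟩ := Metric.isOpen_iff.1 isOpen_interior p hpi
    have hpos : 0 < r / ‖w‖ / 2 := by have := norm_pos_iff.2 hw0; positivity
    have hlt : ‖(r / ‖w‖ / 2) • w‖ < r := by
      rw [norm_smul, Real.norm_of_nonneg hpos.le]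
      have := norm_pos_iff.2 hw0
      field_simp; norm_num
    have a1 := interior_subset (hball (show p + (r / ‖w‖ / 2) • w ∈ _ by
      simpa [dist_eq_norm] using hlt))
    have a2 := interior_subset (hball (show p - (r / ‖w‖ / 2) • w ∈ _ by
      simpa [dist_eq_norm] using hlt))
    have := hp.2 a1 a2 (mem_openSegment_of_ne_left_right ?_ ?_ ?_)
    · simp [hpos.ne', hw0] at this
    · simp [hpos.ne', hw0]
    · simp [hpos.ne', hw0]
    · rw [segment_eq_image']
      exact ⟨1 / 2, by norm_num, by module⟩
  conv_lhs => rw [← closure_convexHull_extremePoints h.isCompact_hull (convex_convexHull ℝ _)]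
  refine closure_minimal (convexHull_mono h1) ?_
  exact ((h.finite.subset Set.sdiff_subset).isCompact_convexHull ℝ).isClosed

end OuterRegion

/-! ### Components -/

/-- `W` is a connected component of `U`. -/
def IsComp (U W : Set Pt) : Prop := ∃ x ∈ U, W = connectedComponentIn U x

namespace IsComp

variable {U W W' : Set Pt}

lemma subset (h : IsComp U W) : W ⊆ U := by
  obtain ⟨x, -, rfl⟩ := h; exact connectedComponentIn_subset U x

lemma isOpen (h : IsComp U W) (hU : IsOpen U) : IsOpen W := by
  obtain ⟨x, -, rfl⟩ := h; exact hU.connectedComponentIn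

lemma nonempty (h : IsComp U W) : W.Nonempty := by
  obtain ⟨x, hx, rfl⟩ := h; exact ⟨x, mem_connectedComponentIn hx⟩

lemma isPreconnected (h : IsComp U W) : IsPreconnected W := by
  obtain ⟨x, -, rfl⟩ := h; exact isPreconnected_connectedComponentIn

lemma subset_of_inter {S : Set Pt} (h : IsComp U W) (hS : IsPreconnected S) (hSU : S ⊆ U)
    (hne : (S ∩ W).Nonempty) : S ⊆ W := by
  obtain ⟨x, hx, rfl⟩ := h
  obtain ⟨y, hyS, hyW⟩ := hne
  rw [connectedComponentIn_eq hyW]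
  exact hS.subset_connectedComponentIn hyS hSU

lemma eq_of_inter (h : IsComp U W) (h' : IsComp U W') (hne : (W ∩ W').Nonempty) : W = W' :=
  (h'.subset_of_inter h.isPreconnected h.subset hne).antisymm
    (h.subset_of_inter h'.isPreconnected h'.subset (by rwa [Set.inter_comm]))

lemma of_mem {x : Pt} (hx : x ∈ U) : IsComp U (connectedComponentIn U x) := ⟨x, hx, rfl⟩

end IsComp

/-! ### Edges of a convex hull of finitely many points -/

lemma convex_lex (u w : Pt) (a b : ℝ) :
    Convex ℝ {y : Pt | det2 u y < a ∨ det2 u y = a ∧ det2 w y < b} := by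
  intro x hx y hy s t hs ht hst
  simp only [Set.mem_ofPred_eq, det2_add_right, det2_smul_right] at hx hy ⊢
  rcases hs.eq_or_lt with rfl | hs
  · obtain rfl : t = 1 := by linarith
    simpa using hy
  rcases ht.eq_or_lt with rfl | ht
  · obtain rfl : s = 1 := by linarith
    simpa using hx
  obtain rfl : t = 1 - s := by linarith
  rcases hx with hx | ⟨hx1, hx2⟩ <;> rcases hy with hy | ⟨hy1, hy2⟩
  · left; nlinarith
  · left; nlinarith
  · left; nlinarith
  · right; constructor
    · rw [hx1, hy1]; ring
    · nlinarith

lemma exists_closest_right {Z : Set Pt} (hZ : Z.Finite) {u w q : Pt} (hq : q ∈ convexHull ℝ Z)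
    (hqZ : q ∉ Z) (hle : ∀ z ∈ Z, det2 u z ≤ det2 u q) (huw : det2 u w ≠ 0) :
    ∃ z ∈ Z, det2 u z = det2 u q ∧ det2 w q < det2 w z ∧
      ∀ z₁ ∈ Z, det2 u z₁ = det2 u q → det2 w q < det2 w z₁ → det2 w z ≤ det2 w z₁ := by
  have hne : {z ∈ Z | det2 u z = det2 u q ∧ det2 w q < det2 w z}.Nonempty := by
    by_contra hemp
    rw [Set.not_nonempty_iff_eq_empty, Set.eq_empty_iff_forall_notMem] at hemp
    have : convexHull ℝ Z ⊆ {y | det2 u y < det2 u q ∨ det2 u y = det2 u q ∧ det2 w y < det2 w q} := by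
      refine convexHull_min (fun z hz => ?_) (convex_lex _ _ _ _)
      rcases (hle z hz).lt_or_eq with h | h
      · exact Or.inl h
      refine Or.inr ⟨h, lt_of_not_ge fun h2 => ?_⟩
      rcases h2.lt_or_eq with h2 | h2
      · exact hemp z ⟨hz, h, h2⟩
      · have := eq_zero_of_det2_eq_zero (w := z - q) huw (by rw [det2_sub_right]; linarith)
          (by rw [det2_sub_right]; linarith)
        rw [sub_eq_zero] at this
        exact hqZ (this ▸ hz)
    rcases this hq with h | h
    · exact lt_irrefl _ h
    · exact lt_irrefl _ h.2
  obtain ⟨z, hz, hmin⟩ := Set.exists_min_image _ (fun z => det2 w z) (hZ.subset (Set.sep_subset _ _)) hne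
  exact ⟨z, hz.1, hz.2.1, hz.2.2, fun z₁ h1 h2 h3 => hmin z₁ ⟨h1, h2, h3⟩⟩

/-- Two points of `Z`, consecutive on a supporting line of `Q`. -/
structure IsEdge (Q Z : Set Pt) (z z' : Pt) : Prop where
  left : z ∈ Z
  right : z' ∈ Z
  ne : z ≠ z'
  support : ∃ u, u ≠ 0 ∧ det2 u z' = det2 u z ∧ ∀ y ∈ Q, det2 u y ≤ det2 u z
  inside : ∀ x ∈ openSegment ℝ z z', x ∉ Z

lemma IsEdge.symm {Q Z : Set Pt} {z z' : Pt} (h : IsEdge Q Z z z') : IsEdge Q Z z' z := by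
  obtain ⟨u, hu, h1, h2⟩ := h.support
  exact ⟨h.right, h.left, h.ne.symm, ⟨u, hu, h1.symm, fun y hy => (h2 y hy).trans_eq h1.symm⟩,
    fun x hx => h.inside x (by rwa [openSegment_symm])⟩

lemma det2_eq_of_mem_openSegment {u z z' x : Pt} (h : det2 u z' = det2 u z)
    (hx : x ∈ openSegment ℝ z z') : det2 u x = det2 u z := by
  obtain ⟨a, b, -, -, hab, rfl⟩ := hx
  rw [det2_add_right, det2_smul_right, det2_smul_right, h, ← add_mul, hab, one_mul]

lemma IsEdge.notMem_interior {Q Z : Set Pt} {z z' x : Pt} (h : IsEdge Q Z z z')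
    (hx : x ∈ openSegment ℝ z z') : x ∉ interior Q := by
  obtain ⟨u, hu, h1, h2⟩ := h.support
  intro hxi
  exact (det2_lt_of_mem_interior hu h2 hxi).ne (det2_eq_of_mem_openSegment h1 hx)

lemma exists_edge {Q Z : Set Pt} (hQ : Convex ℝ Q) (hne : (interior Q).Nonempty) (hZ : Z.Finite)
    (hZQ : Z ⊆ Q) (hQZ : Q ⊆ convexHull ℝ Z) {q : Pt} (hq : q ∈ Q) (hqi : q ∉ interior Q)
    (hqZ : q ∉ Z) : ∃ z z', IsEdge Q Z z z' ∧ q ∈ openSegment ℝ z z' := by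
  obtain ⟨u, hu⟩ := exists_det2_lt_of_notMem_of_isOpen hQ.interior isOpen_interior hqi
  have hu0 : u ≠ 0 := by
    rintro rfl
    obtain ⟨x, hx⟩ := hne
    simpa using hu x hx
  have hle : ∀ y ∈ Q, det2 u y ≤ det2 u q := by
    have hcl : Q ⊆ closure (interior Q) := by
      rw [hQ.closure_interior_eq_closure_of_nonempty_interior hne]; exact subset_closure
    refine fun y hy => closure_minimal (t := {y | det2 u y ≤ det2 u q})
      (fun x hx => (hu x hx).le) (isClosed_le (by fun_prop) (by fun_prop)) (hcl hy)
  obtain ⟨w, hw⟩ := exists_det2_pos hu0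
  obtain ⟨z', hz', hz'1, hz'2, hz'3⟩ := exists_closest_right hZ (hQZ hq) hqZ
    (fun z hz => hle z (hZQ hz)) hw.ne'
  obtain ⟨z, hz, hz1, hz2, hz3⟩ := exists_closest_right (w := -w) hZ (hQZ hq) hqZ
    (fun z hz => hle z (hZQ hz)) (by rw [det2_neg_right]; exact neg_ne_zero.2 hw.ne')
  simp only [det2_neg_left, neg_lt_neg_iff, neg_le_neg_iff] at hz2 hz3
  have hqs : q ∈ openSegment ℝ z z' := by
    rw [openSegment_eq_image']
    have hpos : 0 < det2 w z' - det2 w z := by linarith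
    refine ⟨(det2 w q - det2 w z) / (det2 w z' - det2 w z), ⟨by apply div_pos <;> linarith, ?_⟩, ?_⟩
    · rw [div_lt_one hpos]; linarith
    · rw [← sub_eq_zero]
      apply eq_zero_of_det2_eq_zero hw.ne'
      · simp only [det2_sub_right, det2_add_right, det2_smul_right, hz1, hz'1]; ring
      · simp only [det2_sub_right, det2_add_right, det2_smul_right]
        field_simp; ring
  refine ⟨z, z', ⟨hz, hz', ?_, ⟨u, hu0, by rw [hz1, hz'1], fun y hy => hz1 ▸ hle y hy⟩, ?_⟩, hqs⟩
  · rintro rfl; linarith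
  · intro x hx hxZ
    have hxu : det2 u x = det2 u q := by
      rw [det2_eq_of_mem_openSegment (by rw [hz1, hz'1]) hx, hz1]
    obtain ⟨a, b, ha, hb, hab, rfl⟩ := hx
    set x := a • z + b • z' with hxdef
    have hwx : det2 w x = a * det2 w z + b * det2 w z' := by
      rw [hxdef, det2_add_right, det2_smul_right, det2_smul_right]
    obtain rfl : b = 1 - a := by linarith
    rcases lt_trichotomy (det2 w q) (det2 w x) with h | h | h
    · have := hz'3 x hxZ hxu h
      nlinarith
    · have := eq_zero_of_det2_eq_zero (w := x - q) hw.ne' (by rw [det2_sub_right]; linarith)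
        (by rw [det2_sub_right]; linarith)
      rw [sub_eq_zero] at this
      exact hqZ (this ▸ hxZ)
    · have := hz3 x hxZ hxu h
      nlinarith

/-! ### Decompositions into convex pieces -/

/-- An open subset `U` of the interior of the hull of `Eᶜ` whose components are convex, and
a finite set `Z` of boundary points of the hull. -/
structure Pieces (E C U Z : Set Pt) : Prop where
  outer : OuterRegion E C
  nonempty : (interior (convexHull ℝ Eᶜ)).Nonempty
  isOpen : IsOpen U
  subset : U ⊆ E
  subset_interior : U ⊆ interior (convexHull ℝ Eᶜ)
  convex : ∀ W, IsComp U W → Convex ℝ W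
  finite : Z.Finite
  subset_hull : Z ⊆ convexHull ℝ Eᶜ
  notMem_interior : ∀ z ∈ Z, z ∉ interior (convexHull ℝ Eᶜ)
  hull_subset : convexHull ℝ Eᶜ ⊆ convexHull ℝ Z
  corners : ∀ c ∈ C, c ∉ interior (convexHull ℝ Eᶜ) → c ∈ Z
  near : ∀ p ∈ E, p ∈ convexHull ℝ Eᶜ → p ∉ interior (convexHull ℝ Eᶜ) → p ∉ Z →
    ∃ r > 0, interior (convexHull ℝ Eᶜ) ∩ Metric.ball p r ⊆ U

namespace Pieces

variable {E C U Z : Set Pt}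

/-- A piece is a gap along the edge between two given points of `Z`. -/
structure Gap (E Z W : Set Pt) (z z' : Pt) : Prop where
  edge : IsEdge (convexHull ℝ Eᶜ) Z z z'
  subset : openSegment ℝ z z' ⊆ E
  subset_closure : openSegment ℝ z z' ⊆ closure W

lemma Gap.symm {W : Set Pt} {z z' : Pt} (h : Gap E Z W z z') : Gap E Z W z' z :=
  ⟨h.edge.symm, by rw [openSegment_symm]; exact h.subset,
    by rw [openSegment_symm]; exact h.subset_closure⟩

lemma Gap.left_mem {W : Set Pt} {z z' : Pt} (h : Gap E Z W z z') : z ∈ closure W := by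
  have := closure_mono h.subset_closure
  rw [closure_openSegment, closure_closure] at this
  exact this (left_mem_segment ℝ z z')

lemma Gap.right_mem {W : Set Pt} {z z' : Pt} (h : Gap E Z W z z') : z' ∈ closure W :=
  h.symm.left_mem

lemma isClosed_hull (h : Pieces E C U Z) : IsClosed (convexHull ℝ Eᶜ) :=
  h.outer.isCompact_hull.isClosed

lemma hull_subset_closure (h : Pieces E C U Z) :
    convexHull ℝ Eᶜ ⊆ closure (interior (convexHull ℝ Eᶜ)) := by
  rw [(convex_convexHull ℝ _).closure_interior_eq_closure_of_nonempty_interior h.nonempty]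
  exact subset_closure

lemma openSegment_subset_hull (h : Pieces E C U Z) {z z' : Pt} (hz : z ∈ Z) (hz' : z' ∈ Z) :
    openSegment ℝ z z' ⊆ convexHull ℝ Eᶜ :=
  (openSegment_subset_segment ℝ z z').trans
    ((convex_convexHull ℝ _).segment_subset (h.subset_hull hz) (h.subset_hull hz'))

lemma openSegment_subset (h : Pieces E C U Z) {z z' q : Pt}
    (he : IsEdge (convexHull ℝ Eᶜ) Z z z') (hq : q ∈ openSegment ℝ z z') (hqE : q ∈ E) :
    openSegment ℝ z z' ⊆ E := by
  intro s hs
  by_contra hsE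
  obtain ⟨u, hu, h1, h2⟩ := he.support
  refine (IsPreconnected.subset_of_eventually (convex_openSegment z z').isPreconnected
    h.outer.isOpen.isClosed_compl (fun p hp hpE => ?_) hs hsE) hq hqE
  have hpC : p ∉ C := fun hpC => he.inside p hp (h.corners p hpC (he.notMem_interior hp))
  obtain ⟨r, hr, hconv⟩ := h.outer.locally_convex p hpE hpC
  have hpu := det2_eq_of_mem_openSegment h1 hp
  filter_upwards [mem_nhdsWithin_of_mem_nhds (Metric.ball_mem_nhds p hr), self_mem_nhdsWithin]
    with x hxr hx hxE
  obtain ⟨w, hw⟩ := exists_det2_pos hu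
  have hxu := det2_eq_of_mem_openSegment h1 hx
  have t1 : Filter.Tendsto (fun η : ℝ => x - η • w) (nhdsWithin 0 (Set.Ioi 0)) (nhds x) := by
    have : Continuous fun η : ℝ => x - η • w := by fun_prop
    simpa using (this.tendsto 0).mono_left nhdsWithin_le_nhds
  have hxb : (2 : ℝ) • p - x ∈ Metric.ball p r := by
    rw [Metric.mem_ball, dist_eq_norm, show (2 : ℝ) • p - x - p = -(x - p) by module, norm_neg,
      ← dist_eq_norm]
    exact hxr
  have t2 : Filter.Tendsto (fun η : ℝ => (2 : ℝ) • p - x + η • w) (nhdsWithin 0 (Set.Ioi 0))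
      (nhds ((2 : ℝ) • p - x)) := by
    have : Continuous fun η : ℝ => (2 : ℝ) • p - x + η • w := by fun_prop
    simpa using (this.tendsto 0).mono_left nhdsWithin_le_nhds
  obtain ⟨η, hη1, hη2, hη3⟩ := ((t1.eventually ((h.outer.isOpen.inter Metric.isOpen_ball).mem_nhds
    ⟨hxE, hxr⟩)).and ((t2.eventually (Metric.isOpen_ball.mem_nhds hxb)).and
      self_mem_nhdsWithin)).exists
  have hη3 : 0 < η := hη3
  have h3 : (2 : ℝ) • p - x + η • w ∈ E := by
    by_contra hE
    have := h2 _ (subset_convexHull ℝ _ hE)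
    simp only [det2_add_right, det2_sub_right, det2_smul_right] at this
    nlinarith
  have := (hconv.midpoint_mem hη1 ⟨h3, hη2⟩).1
  rw [midpoint_eq_smul_add, show x - η • w + ((2 : ℝ) • p - x + η • w) = (2 : ℝ) • p by abel,
    smul_smul] at this
  exact hpE (by simpa using this)

lemma subset_of_mem_closure (h : Pieces E C U Z) {W : Set Pt} (hW : IsComp U W) {p : Pt} {r : ℝ}
    (hr : 0 < r) (hU : interior (convexHull ℝ Eᶜ) ∩ Metric.ball p r ⊆ U) (hp : p ∈ closure W) :
    interior (convexHull ℝ Eᶜ) ∩ Metric.ball p r ⊆ W := by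
  refine hW.subset_of_inter ?_ hU ?_
  · exact ((convex_convexHull ℝ _).interior.inter (convex_ball p r)).isPreconnected
  · obtain ⟨x, hx1, hx2⟩ := mem_closure_iff_nhds.1 hp _ (Metric.ball_mem_nhds p hr)
    exact ⟨x, ⟨h.subset_interior (hW.subset hx2), hx1⟩, hx2⟩

lemma closure_subset_hull (h : Pieces E C U Z) {W : Set Pt} (hW : IsComp U W) :
    closure W ⊆ convexHull ℝ Eᶜ :=
  closure_minimal ((hW.subset.trans h.subset_interior).trans interior_subset) h.isClosed_hull

lemma eq_of_mem_closure (h : Pieces E C U Z) {W W' : Set Pt} (hW : IsComp U W) (hW' : IsComp U W')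
    {q : Pt} (hqE : q ∈ E) (hqi : q ∉ interior (convexHull ℝ Eᶜ)) (hqZ : q ∉ Z)
    (hqW : q ∈ closure W) (hqW' : q ∈ closure W') : W = W' := by
  have hqQ := h.closure_subset_hull hW hqW
  obtain ⟨r, hr, hU⟩ := h.near q hqE hqQ hqi hqZ
  obtain ⟨x, hx1, hx2⟩ := mem_closure_iff_nhds.1 (h.hull_subset_closure hqQ) _
    (Metric.ball_mem_nhds q hr)
  exact hW.eq_of_inter hW' ⟨x, h.subset_of_mem_closure hW hr hU hqW ⟨hx2, hx1⟩,
    h.subset_of_mem_closure hW' hr hU hqW' ⟨hx2, hx1⟩⟩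

lemma exists_gap (h : Pieces E C U Z) {W : Set Pt} (hW : IsComp U W) {q : Pt} (hqE : q ∈ E)
    (hqi : q ∉ interior (convexHull ℝ Eᶜ)) (hqZ : q ∉ Z) (hqW : q ∈ closure W) :
    ∃ z z', Gap E Z W z z' := by
  obtain ⟨z, z', he, hq⟩ := exists_edge (convex_convexHull ℝ _) h.nonempty h.finite h.subset_hull
    h.hull_subset (h.closure_subset_hull hW hqW) hqi hqZ
  have hE := h.openSegment_subset he hq hqE
  refine ⟨z, z', he, hE, IsPreconnected.subset_of_eventually
    (convex_openSegment z z').isPreconnected isClosed_closure (fun p hp hpW => ?_) hq hqW⟩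
  have hpQ := h.openSegment_subset_hull he.left he.right hp
  obtain ⟨r, hr, hU⟩ := h.near p (hE hp) hpQ (he.notMem_interior hp) (he.inside p hp)
  have hsub := h.subset_of_mem_closure hW hr hU hpW
  filter_upwards [mem_nhdsWithin_of_mem_nhds (Metric.ball_mem_nhds p hr), self_mem_nhdsWithin]
    with x hxr hx
  refine closure_mono hsub ?_
  rw [Set.inter_comm]
  exact Metric.isOpen_ball.inter_closure
    ⟨hxr, h.hull_subset_closure (h.openSegment_subset_hull he.left he.right hx)⟩

lemma Gap.eq_of_eq (h : Pieces E C U Z) {W W' : Set Pt} (hW : IsComp U W) (hW' : IsComp U W')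
    {z z' : Pt} (hg : Gap E Z W z z') (hg' : Gap E Z W' z z') : W = W' := by
  have hm : midpoint ℝ z z' ∈ openSegment ℝ z z' := by
    rw [openSegment_eq_image']
    exact ⟨1 / 2, by norm_num, by rw [midpoint_eq_smul_add, invOf_eq_inv]; module⟩
  exact h.eq_of_mem_closure hW hW' (hg.subset hm) (hg.edge.notMem_interior hm)
    (hg.edge.inside _ hm) (hg.subset_closure hm) (hg'.subset_closure hm)

end Pieces

/-! ### Generic choices and exit points -/

lemma exists_mem_det2_ne_zero {O : Set Pt} (hO : IsOpen O) (hne : O.Nonempty)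
    (F : Finset (Pt × Pt)) (hF : ∀ f ∈ F, f.1 ≠ 0) :
    ∃ x ∈ O, ∀ f ∈ F, det2 f.1 (x - f.2) ≠ 0 := by
  induction F using Finset.induction_on generalizing O with
  | empty => obtain ⟨x, hx⟩ := hne; exact ⟨x, hx, by simp⟩
  | insert f F _ ih =>
    have hcont : Continuous fun x => det2 f.1 (x - f.2) := by fun_prop
    have hne' : (O ∩ {x | det2 f.1 (x - f.2) ≠ 0}).Nonempty := by
      obtain ⟨x, hx⟩ := hne
      by_cases h0 : det2 f.1 (x - f.2) = 0
      · have ht : Filter.Tendsto (fun t : ℝ => x + t • rot f.1) (nhdsWithin 0 (Set.Ioi 0))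
            (nhds x) := by
          have : Continuous fun t : ℝ => x + t • rot f.1 := by fun_prop
          simpa using (this.tendsto 0).mono_left nhdsWithin_le_nhds
        obtain ⟨t, ht1, ht0⟩ := ((ht.eventually (hO.mem_nhds hx)).and self_mem_nhdsWithin).exists
        have ht0 : 0 < t := ht0
        refine ⟨_, ht1, ?_⟩
        have h1 : det2 f.1 (x + t • rot f.1 - f.2) = t * ‖f.1‖ ^ 2 := by
          rw [show x + t • rot f.1 - f.2 = (x - f.2) + t • rot f.1 by abel, det2_add_right, h0,
            det2_smul_right, det2_rot, zero_add]
        have h2 : 0 < ‖f.1‖ := norm_pos_iff.2 (hF f (Finset.mem_insert_self _ _))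
        simp only [Set.mem_ofPred_eq, h1]
        positivity
      · exact ⟨x, hx, h0⟩
    obtain ⟨x, ⟨hx, hx'⟩, h⟩ := ih (hO.inter (isOpen_ne_fun hcont continuous_const)) hne'
      fun g hg => hF g (Finset.mem_insert_of_mem hg)
    refine ⟨x, hx, fun g hg => ?_⟩
    rcases Finset.mem_insert.1 hg with rfl | hg
    · exact hx'
    · exact h g hg

lemma exists_exit {G : Set Pt} (hG : IsOpen G) {x e : Pt} {s : ℝ} (hx : x ∈ G)
    (hs : 0 ≤ s) (hxs : x + s • e ∉ G) :
    ∃ s₁, 0 < s₁ ∧ s₁ ≤ s ∧ x + s₁ • e ∉ G ∧ ∀ t, 0 ≤ t → t < s₁ → x + t • e ∈ G := by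
  have hcont : Continuous fun t : ℝ => x + t • e := by fun_prop
  have hcpt : IsCompact (Set.Icc 0 s ∩ (fun t : ℝ => x + t • e) ⁻¹' Gᶜ) :=
    isCompact_Icc.inter_right (hG.isClosed_compl.preimage hcont)
  obtain ⟨s₁, ⟨⟨h0, h1⟩, h2⟩, hmin⟩ := hcpt.exists_isMinOn ⟨s, ⟨⟨hs, le_rfl⟩, hxs⟩⟩
    continuous_id.continuousOn
  refine ⟨s₁, h0.lt_of_ne ?_, h1, h2, fun t ht ht1 => ?_⟩
  · rintro rfl
    exact h2 (by simpa using hx)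
  · by_contra h
    have : s₁ ≤ t := hmin (show t ∈ _ from ⟨⟨ht, ht1.le.trans h1⟩, h⟩)
    linarith

lemma Notched.ray {W : Set Pt} {p d : Pt} (h : Notched W p) (hd : d ≠ 0) :
    ∃ r > (0 : ℝ), (∀ s, 0 < s → s < r → p + s • d ∈ W) ∨ ∀ s, 0 < s → s < r → p - s • d ∈ W := by
  obtain ⟨v, w, hvw, r, hr, h1, h2⟩ := h
  obtain ⟨a, b, rfl⟩ : ∃ a b : ℝ, d = a • v + b • w := ⟨_, _, exists_coords_of_det2_ne_zero hvw d⟩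
  set M := |a| + |b| + 1
  have hM : 0 < M := by positivity
  have ha : |a| < M := by simp only [M]; linarith [abs_nonneg b]
  have hb : |b| < M := by simp only [M]; linarith [abs_nonneg a]
  have key : ∀ s : ℝ, 0 < s → s < r / M → |s * a| < r ∧ |s * b| < r := by
    intro s hs hs'
    rw [lt_div_iff₀ hM] at hs'
    rw [abs_mul, abs_mul, abs_of_pos hs]
    constructor <;> nlinarith
  refine ⟨r / M, by positivity, ?_⟩
  rcases lt_trichotomy b 0 with hb0 | rfl | hb0
  · right
    intro s hs hs'
    obtain ⟨k1, k2⟩ := key s hs hs'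
    rw [abs_lt] at k2
    have := h1 (-(s * a)) (-(s * b)) (by rwa [abs_neg]) (by nlinarith) (by linarith)
    rw [show p - s • (a • v + b • w) = p + (-(s * a)) • v + (-(s * b)) • w by module]
    exact this
  · have ha0 : a ≠ 0 := by rintro rfl; simp at hd
    rcases lt_or_gt_of_ne ha0 with ha0 | ha0
    · right
      intro s hs hs'
      obtain ⟨k1, k2⟩ := key s hs hs'
      rw [abs_lt] at k1
      rw [show p - s • (a • v + (0 : ℝ) • w) = p + (-(s * a)) • v by module]
      exact h2 _ (by nlinarith) (by linarith)
    · left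
      intro s hs hs'
      obtain ⟨k1, k2⟩ := key s hs hs'
      rw [abs_lt] at k1
      rw [show p + s • (a • v + (0 : ℝ) • w) = p + (s * a) • v by module]
      exact h2 _ (by nlinarith) (by linarith)
  · left
    intro s hs hs'
    obtain ⟨k1, k2⟩ := key s hs hs'
    rw [abs_lt] at k2
    have := h1 (s * a) (s * b) k1 (by positivity) (by linarith)
    rw [show p + s • (a • v + b • w) = p + (s * a) • v + (s * b) • w by module]
    exact this

lemma IsComp.mem_of_mem_closure {U W : Set Pt} (hU : IsOpen U) (hW : IsComp U W) {p : Pt}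
    (hpU : p ∈ U) (hpW : p ∈ closure W) : p ∈ W := by
  obtain ⟨x, hx1, hx2⟩ := mem_closure_iff.1 hpW _ (hU.connectedComponentIn (x := p))
    (mem_connectedComponentIn hpU)
  rw [hW.eq_of_inter (IsComp.of_mem hpU) ⟨x, hx2, hx1⟩]
  exact mem_connectedComponentIn hpU

/-! ### Cutting the outer region at an interior corner -/

/-- A segment `c y` cutting the interior `G` of the hull of `Eᶜ` inside `E` at the corner `c`. -/
structure Cut (E : Set Pt) (c y : Pt) : Prop where
  ne : c ≠ y
  mem_interior : c ∈ interior (convexHull ℝ Eᶜ)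
  notMem : c ∉ E
  subset : openSegment ℝ c y ⊆ interior (convexHull ℝ Eᶜ) ∩ E
  exit : y ∉ interior (convexHull ℝ Eᶜ) ∩ E
  opposite : ∃ r > (0 : ℝ), ∀ t, 0 < t → t < r → c - t • (y - c) ∉ E

namespace OuterRegion

variable {E C : Set Pt}

lemma exists_cut (h : OuterRegion E C) {c : Pt} (hc : c ∈ C)
    (hci : c ∈ interior (convexHull ℝ Eᶜ)) (F : Finset Pt) (hF : c ∉ F) :
    ∃ y, Cut E c y ∧ ∀ p ∈ F, det2 (y - c) (p - c) ≠ 0 := by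
  obtain ⟨O, hO, hne, hcut⟩ := h.cut c hc
  obtain ⟨d, hdO, hdF⟩ := exists_mem_det2_ne_zero hO hne
    (insert (mkPt 1 0, 0) (F.image fun p => (p - c, 0))) (by
      intro f hf
      rcases Finset.mem_insert.1 hf with rfl | hf
      · exact mkPt_one_zero_ne
      · obtain ⟨p, hp, rfl⟩ := Finset.mem_image.1 hf
        exact sub_ne_zero.2 (by rintro rfl; exact hF hp))
  have hd0 : d ≠ 0 := by
    rintro rfl
    simpa using hdF _ (Finset.mem_insert_self _ _)
  obtain ⟨r, hr, hray⟩ := hcut d hdO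
  have hcont : Continuous fun t : ℝ => c + t • d := by fun_prop
  have t1 : Filter.Tendsto (fun t : ℝ => c + t • d) (nhdsWithin 0 (Set.Ioi 0)) (nhds c) := by
    simpa using (hcont.tendsto 0).mono_left nhdsWithin_le_nhds
  obtain ⟨ρ, hρ, hball⟩ := Metric.isOpen_iff.1 isOpen_interior c hci
  have hdn : 0 < ‖d‖ := norm_pos_iff.2 hd0
  set t₀ := min r (ρ / ‖d‖) / 2
  have ht₀ : 0 < t₀ := by simp only [t₀]; positivity
  have ht₀r : t₀ < r := by
    have := min_le_left r (ρ / ‖d‖); simp only [t₀]; linarith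
  have hsmall : ∀ t : ℝ, 0 < t → t ≤ t₀ → c + t • d ∈ interior (convexHull ℝ Eᶜ) ∩ E := by
    intro t h0 h1
    refine ⟨hball ?_, (hray t h0 (by linarith)).1⟩
    have : t < ρ / ‖d‖ := by
      have := min_le_right r (ρ / ‖d‖)
      have : 0 < ρ / ‖d‖ := by positivity
      simp only [t₀] at h1; linarith
    rw [lt_div_iff₀ hdn] at this
    simpa [dist_eq_norm, norm_smul, abs_of_pos h0] using this
  obtain ⟨M, hM⟩ := h.isCompact_hull.isBounded.subset_ball (c + t₀ • d)
  obtain ⟨s, hs0, -, hsn, hsG⟩ := exists_exit (e := d) (s := |M| / ‖d‖)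
    (isOpen_interior.inter h.isOpen) (hsmall t₀ ht₀ le_rfl) (by positivity) (fun h' => by
      have := hM (interior_subset h'.1)
      rw [Metric.mem_ball, dist_eq_norm, add_sub_cancel_left, norm_smul, Real.norm_of_nonneg
        (by positivity), div_mul_cancel₀ _ hdn.ne'] at this
      exact absurd this (not_lt.2 (le_abs_self M)))
  have hT : 0 < t₀ + s := by linarith
  have hye : c + (t₀ + s) • d - c = (t₀ + s) • d := by abel
  refine ⟨c + (t₀ + s) • d, ⟨?_, hci, h.disjoint c hc, ?_, ?_, r / (t₀ + s), by positivity, ?_⟩, ?_⟩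
  · intro h
    have : (t₀ + s) • d = 0 := by simpa using h.symm
    rcases smul_eq_zero.1 this with h | h
    · exact hT.ne' h
    · exact hd0 h
  · rw [openSegment_eq_image']
    rintro _ ⟨θ, ⟨hθ0, hθ1⟩, rfl⟩
    beta_reduce
    rw [hye, smul_smul]
    by_cases hle : θ * (t₀ + s) ≤ t₀
    · exact hsmall _ (by positivity) hle
    · have := hsG (θ * (t₀ + s) - t₀) (by linarith) (by nlinarith)
      rwa [add_assoc, ← add_smul, add_sub_cancel] at this
  · rwa [add_smul, ← add_assoc]
  · intro t h0 h1
    rw [lt_div_iff₀ hT] at h1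
    rw [hye, smul_smul]
    exact (hray _ (by positivity) h1).2
  · intro p hp
    have := hdF (p - c, 0) (Finset.mem_insert_of_mem (Finset.mem_image_of_mem _ hp))
    rw [sub_zero, det2_swap] at this
    rw [hye, det2_smul_left]
    exact mul_ne_zero hT.ne' (fun h => this (by rw [h, neg_zero]))

lemma convex_of_isComp (h : OuterRegion E C) {S : Set Pt} (hS : IsClosed S)
    (hc : ∀ p ∈ interior (convexHull ℝ Eᶜ), p ∈ C ∨ p ∈ E ∧ p ∈ S →
      ¬ Notched ((interior (convexHull ℝ Eᶜ) ∩ E) \ S) p) {W : Set Pt}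
    (hW : IsComp ((interior (convexHull ℝ Eᶜ) ∩ E) \ S) W) : Convex ℝ W := by
  obtain ⟨x, -, rfl⟩ := hW
  refine convex_component_of_not_notched ((isOpen_interior.inter h.isOpen).sdiff hS)
    (fun p hp hn => ?_) x
  by_cases hpi : p ∈ interior (convexHull ℝ Eᶜ)
  · by_cases hpE : p ∈ E
    · exact hc p hpi (Or.inr ⟨hpE, by_contra fun hpS => hp ⟨⟨hpi, hpE⟩, hpS⟩⟩) hn
    · obtain ⟨r, hr, hconv⟩ := h.locally_convex p hpE fun hpC => hc p hpi (Or.inl hpC) hn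
      exact hpE ((hn.mono fun x hx => hx.1.2).mem_of_convex_inter_ball h.isOpen hr hconv)
  · exact hpi ((hn.mono fun x hx => hx.1.1).mem_of_convex isOpen_interior
      (convex_convexHull ℝ _).interior)

lemma not_subset_of_subset_interior (h : OuterRegion E C) {W : Set Pt}
    (hW : W ⊆ interior (convexHull ℝ Eᶜ)) : ¬ E ⊆ W := by
  intro hE
  have hb : Bornology.IsBounded (Set.univ : Set Pt) := by
    rw [← Set.union_compl_self E]
    exact (h.isCompact_hull.isBounded.subset (hE.trans (hW.trans interior_subset))).union h.bounded
  obtain ⟨M, hM⟩ := hb.subset_ball 0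
  have := hM (Set.mem_univ (M • mkPt 1 0))
  have hn : ‖mkPt 1 0‖ = 1 := by
    have := norm_sq_eq_coord (mkPt 1 0)
    exact (sq_eq_sq₀ (norm_nonneg _) zero_le_one).1 (by simpa using this)
  rw [mem_ball_zero_iff, norm_smul, hn, mul_one] at this
  exact absurd this (not_lt.2 (le_abs_self M))

lemma exists_frontier (h : OuterRegion E C) {U W : Set Pt} (hU : IsOpen U)
    (hUi : U ⊆ interior (convexHull ℝ Eᶜ)) (hUE : U ⊆ E) (hW : IsComp U W) :
    ∃ p ∈ E, p ∈ closure W ∧ p ∉ U := by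
  by_contra! hcon
  refine h.not_subset_of_subset_interior (hW.subset.trans hUi)
    (h.isPreconnected.subset_of_closure_inter_subset (hW.isOpen hU) ?_ ?_)
  · obtain ⟨x, hx⟩ := hW.nonempty
    exact ⟨x, hUE (hW.subset hx), hx⟩
  · rintro p ⟨hpW, hpE⟩
    exact hW.mem_of_mem_closure hU (hcon p hpE hpW) hpW

end OuterRegion

lemma three_le_ncard_of_subset_convexHull {Q Z : Set Pt} (hne : (interior Q).Nonempty)
    (hZ : Z.Finite) (h : Q ⊆ convexHull ℝ Z) : 3 ≤ Z.ncard := by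
  by_contra! hlt
  obtain ⟨x, hx⟩ := hne
  have hZne : Z.Nonempty := convexHull_nonempty_iff.1 ⟨x, h (interior_subset hx)⟩
  obtain ⟨u, hu, z, hz⟩ : ∃ u : Pt, u ≠ 0 ∧ ∃ z : Pt, ∀ y ∈ Z, det2 u y = det2 u z := by
    have := (Set.ncard_pos hZ).2 hZne
    obtain h1 | h2 : Z.ncard = 1 ∨ Z.ncard = 2 := by omega
    · obtain ⟨a, rfl⟩ := Set.ncard_eq_one.1 h1
      exact ⟨_, mkPt_one_zero_ne, a, by simp⟩
    · obtain ⟨a, b, hab, rfl⟩ := Set.ncard_eq_two.1 h2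
      refine ⟨b - a, sub_ne_zero.2 hab.symm, a, ?_⟩
      rintro y (rfl | rfl)
      · rfl
      · have := det2_self (y - a)
        rw [det2_sub_right] at this
        linarith
  have hconst : ∀ y ∈ Q, det2 u y = det2 u z := by
    have hsub : convexHull ℝ Z ⊆ {y | det2 u y = det2 u z} := by
      refine convexHull_min hz fun y hy y' hy' s t _ _ hst => ?_
      simp only [Set.mem_ofPred_eq, det2_add_right, det2_smul_right] at hy hy' ⊢
      rw [hy, hy', ← add_mul, hst, one_mul]
    exact fun y hy => hsub (h hy)
  exact (det2_lt_of_mem_interior hu (fun y hy => (hconst y hy).le) hx).ne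
    (hconst x (interior_subset hx))

namespace Cut

variable {E C Z W : Set Pt} {c y : Pt}

/-- The interior of the hull of `Eᶜ` inside `E`, minus the cut. -/
def region (E : Set Pt) (c y : Pt) : Set Pt :=
  (_root_.interior (convexHull ℝ Eᶜ) ∩ E) \ segment ℝ c y

lemma mem_openSegment_of_mem (hcut : Cut E c y) {p : Pt} (hp : p ∈ segment ℝ c y) (hpE : p ∈ E)
    (hpi : p ∈ _root_.interior (convexHull ℝ Eᶜ)) : p ∈ openSegment ℝ c y := by
  rw [← insert_endpoints_openSegment] at hp
  rcases hp with rfl | rfl | hp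
  · exact absurd hpE hcut.notMem
  · exact absurd ⟨hpi, hpE⟩ hcut.exit
  · exact hp

lemma det2_eq_zero {p : Pt} (hp : p ∈ segment ℝ c y) : det2 (y - c) (p - c) = 0 := by
  rw [segment_eq_image'] at hp
  obtain ⟨θ, -, rfl⟩ := hp
  simp [det2_smul_right]

lemma isClosed_segment : IsClosed (segment ℝ c y) := by
  rw [← convexHull_pair]
  exact ((Set.toFinite {c, y}).isCompact_convexHull ℝ).isClosed

lemma isOpen_region (h : OuterRegion E C) : IsOpen (region E c y) :=
  (isOpen_interior.inter h.isOpen).sdiff isClosed_segment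

lemma convex (hcut : Cut E c y) (h : OuterRegion E C)
    (huniq : ∀ c' ∈ C, c' ∈ _root_.interior (convexHull ℝ Eᶜ) → c' = c)
    (hW : IsComp (region E c y) W) : Convex ℝ W := by
  refine h.convex_of_isComp isClosed_segment (fun p hpi hp hn => ?_) hW
  have he : y - c ≠ 0 := sub_ne_zero.2 hcut.ne.symm
  obtain ⟨r, hr, hray⟩ := hn.ray he
  rcases hp with hp | ⟨hpE, hp⟩
  · obtain rfl := huniq p hp hpi
    obtain ⟨r', hr', hopp⟩ := hcut.opposite
    rcases hray with hray | hray
    · have hs : 0 < min r 1 / 2 := by positivity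
      refine (hray (min r 1 / 2) hs ?_).2 ?_
      · have := min_le_left r 1; linarith
      · rw [segment_eq_image']
        exact ⟨_, ⟨hs.le, by have := min_le_right r 1; linarith⟩, rfl⟩
    · have hs : 0 < min r r' / 2 := by positivity
      refine hopp (min r r' / 2) hs ?_ (hray (min r r' / 2) hs ?_).1.2
      · have := min_le_right r r'; linarith
      · have := min_le_left r r'; linarith
  · have hp' := hcut.mem_openSegment_of_mem hp hpE hpi
    rw [openSegment_eq_image'] at hp'
    obtain ⟨θ, ⟨h0, h1⟩, rfl⟩ := hp'
    have hm : 0 < min θ (1 - θ) := lt_min h0 (by linarith)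
    have hs : 0 < min r (min θ (1 - θ)) / 2 := by positivity
    have l1 := min_le_left r (min θ (1 - θ))
    have l2 := min_le_right r (min θ (1 - θ))
    have l3 := min_le_left θ (1 - θ)
    have l4 := min_le_right θ (1 - θ)
    rcases hray with hray | hray
    · refine (hray _ hs (by linarith)).2 ?_
      rw [segment_eq_image']
      exact ⟨θ + min r (min θ (1 - θ)) / 2, ⟨by linarith, by linarith⟩, by module⟩
    · refine (hray _ hs (by linarith)).2 ?_
      rw [segment_eq_image']
      exact ⟨θ - min r (min θ (1 - θ)) / 2, ⟨by linarith, by linarith⟩, by module⟩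

lemma end_mem_closure {S : Set Pt} (hS : openSegment ℝ c y ⊆ closure S) :
    y ∈ closure S := by
  have := closure_mono hS
  rw [closure_openSegment, closure_closure] at this
  exact this (right_mem_segment ℝ c y)

lemma end_mem_hull (hcut : Cut E c y) (h : OuterRegion E C) : y ∈ convexHull ℝ Eᶜ := by
  have := end_mem_closure (S := convexHull ℝ Eᶜ)
    ((hcut.subset.trans Set.inter_subset_left).trans (interior_subset.trans subset_closure))
  rwa [h.isCompact_hull.isClosed.closure_eq] at this

lemma pieces (hcut : Cut E c y) (h : OuterRegion E C)
    (huniq : ∀ c' ∈ C, c' ∈ _root_.interior (convexHull ℝ Eᶜ) → c' = c)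
    (hZ₁ : C \ _root_.interior (convexHull ℝ Eᶜ) ⊆ Z)
    (hZ₂ : Z ⊆ insert y (C \ _root_.interior (convexHull ℝ Eᶜ)))
    (hy : y ∈ E → y ∈ Z) (hy' : y ∈ Z → y ∉ _root_.interior (convexHull ℝ Eᶜ)) :
    Pieces E C (region E c y) Z where
  outer := h
  nonempty := ⟨c, hcut.mem_interior⟩
  isOpen := isOpen_region h
  subset := fun _ hx => hx.1.2
  subset_interior := fun _ hx => hx.1.1
  convex := fun _ hW => hcut.convex h huniq hW
  finite := ((h.finite.subset Set.sdiff_subset).insert y).subset hZ₂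
  subset_hull := by
    intro z hz
    rcases hZ₂ hz with rfl | hz
    · exact hcut.end_mem_hull h
    · exact subset_convexHull ℝ _ (h.disjoint z hz.1)
  notMem_interior := by
    intro z hz
    rcases hZ₂ hz with rfl | hz'
    · exact hy' hz
    · exact hz'.2
  hull_subset := h.hull_subset.trans (convexHull_mono hZ₁)
  corners := fun c' hc' hi => hZ₁ ⟨hc', hi⟩
  near := by
    intro p hpE _ hpi hpZ
    have hps : p ∉ segment ℝ c y := by
      intro hp
      rw [← insert_endpoints_openSegment] at hp
      rcases hp with rfl | rfl | hp
      · exact hcut.notMem hpE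
      · exact hpZ (hy hpE)
      · exact hpi (hcut.subset hp).1
    obtain ⟨r, hr, hball⟩ := Metric.isOpen_iff.1 (h.isOpen.sdiff isClosed_segment) p ⟨hpE, hps⟩
    exact ⟨r, hr, fun x hx => ⟨⟨hx.1, (hball hx.2).1⟩, (hball hx.2).2⟩⟩

/-- The open half-disc of radius `r` about `p` on the side `σ` of the cut. -/
def half (c y p : Pt) (r σ : ℝ) : Set Pt := Metric.ball p r ∩ {x | 0 < σ * det2 (y - c) (x - c)}

lemma convex_half (p : Pt) (r σ : ℝ) : Convex ℝ (half c y p r σ) := by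
  refine (convex_ball p r).inter fun x hx x' hx' s t hs ht hst => ?_
  simp only [Set.mem_ofPred_eq] at hx hx' ⊢
  have : det2 (y - c) (s • x + t • x' - c) = s * det2 (y - c) (x - c) + t * det2 (y - c) (x' - c) := by
    obtain rfl : t = 1 - s := by linarith
    simp only [det2_sub_right, det2_add_right, det2_smul_right]; ring
  rw [this, mul_add]
  rcases hs.eq_or_lt with rfl | hs
  · obtain rfl : t = 1 := by linarith
    linarith
  · nlinarith [mul_pos hs hx, mul_nonneg ht hx'.le]

lemma half_subset (hcut : Cut E c y) (h : OuterRegion E C) {p : Pt} (hp : p ∈ openSegment ℝ c y) :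
    ∃ r > 0, ∀ σ, half c y p r σ ⊆ region E c y := by
  obtain ⟨r, hr, hball⟩ := Metric.isOpen_iff.1 (isOpen_interior.inter h.isOpen) p (hcut.subset hp)
  refine ⟨r, hr, fun σ x hx => ⟨hball hx.1, fun hxs => ?_⟩⟩
  have := hx.2
  rw [Set.mem_ofPred_eq, det2_eq_zero hxs, mul_zero] at this
  exact lt_irrefl _ this

lemma exists_half_subset (hcut : Cut E c y) (h : OuterRegion E C)
    (hW : IsComp (region E c y) W) {p : Pt} (hp : p ∈ openSegment ℝ c y) (hpW : p ∈ closure W) :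
    ∃ r > 0, half c y p r 1 ⊆ W ∨ half c y p r (-1) ⊆ W := by
  obtain ⟨r, hr, hsub⟩ := hcut.half_subset h hp
  refine ⟨r, hr, ?_⟩
  obtain ⟨x, ⟨hx1, hx2⟩, hx⟩ := exists_mem_det2_ne_zero
    (Metric.isOpen_ball.inter (hW.isOpen (isOpen_region h)))
    (mem_closure_iff_nhds.1 hpW _ (Metric.ball_mem_nhds p hr)) {(y - c, c)}
    (by simpa using sub_ne_zero.2 hcut.ne.symm)
  have hx := hx _ (Finset.mem_singleton_self _)
  rcases lt_or_gt_of_ne hx with hx | hx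
  · exact Or.inr (hW.subset_of_inter (convex_half _ _ _).isPreconnected (hsub _)
      ⟨x, ⟨hx1, by simp only [Set.mem_ofPred_eq]; linarith⟩, hx2⟩)
  · exact Or.inl (hW.subset_of_inter (convex_half _ _ _).isPreconnected (hsub _)
      ⟨x, ⟨hx1, by simp only [Set.mem_ofPred_eq]; linarith⟩, hx2⟩)

lemma mem_closure_half (hcut : Cut E c y) {p x : Pt} {r σ : ℝ} (hσ : σ ≠ 0)
    (hx : x ∈ openSegment ℝ c y) (hxr : x ∈ Metric.ball p r) : x ∈ closure (half c y p r σ) := by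
  have hcont : Continuous fun η : ℝ => x + η • (σ • rot (y - c)) := by fun_prop
  have t1 : Filter.Tendsto (fun η : ℝ => x + η • (σ • rot (y - c))) (nhdsWithin 0 (Set.Ioi 0))
      (nhds x) := by
    simpa using (hcont.tendsto 0).mono_left nhdsWithin_le_nhds
  refine mem_closure_of_tendsto t1 ?_
  filter_upwards [t1.eventually (Metric.isOpen_ball.mem_nhds hxr), self_mem_nhdsWithin] with η h1 h2
  refine ⟨h1, ?_⟩
  have h2 : 0 < η := h2
  have h0 := det2_eq_zero (openSegment_subset_segment ℝ c y hx)
  have h3 : 0 < ‖y - c‖ := norm_pos_iff.2 (sub_ne_zero.2 hcut.ne.symm)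
  have : det2 (y - c) (x + η • (σ • rot (y - c)) - c) = η * (σ * ‖y - c‖ ^ 2) := by
    rw [show x + η • (σ • rot (y - c)) - c = (x - c) + η • (σ • rot (y - c)) by abel,
      det2_add_right, h0, det2_smul_right, det2_smul_right, det2_rot, zero_add]
  rw [Set.mem_ofPred_eq, this]
  have : 0 < σ * σ := mul_self_pos.2 hσ
  have : 0 < σ * σ * (η * ‖y - c‖ ^ 2) := by positivity
  linarith

lemma openSegment_subset_closure (hcut : Cut E c y) (h : OuterRegion E C)
    (hW : IsComp (region E c y) W) {p : Pt} (hp : p ∈ openSegment ℝ c y) (hpW : p ∈ closure W) :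
    openSegment ℝ c y ⊆ closure W := by
  refine IsPreconnected.subset_of_eventually (convex_openSegment c y).isPreconnected
    isClosed_closure (fun s hs hsW => ?_) hp hpW
  obtain ⟨r, hr, hsub⟩ := hcut.exists_half_subset h hW hs hsW
  filter_upwards [mem_nhdsWithin_of_mem_nhds (Metric.ball_mem_nhds s hr), self_mem_nhdsWithin]
    with x hxr hx
  rcases hsub with hsub | hsub
  · exact closure_mono hsub (hcut.mem_closure_half one_ne_zero hx hxr)
  · exact closure_mono hsub (hcut.mem_closure_half (by norm_num) hx hxr)

lemma eq_of_half_subset (hcut : Cut E c y) {W' : Set Pt} (hW : IsComp (region E c y) W)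
    (hW' : IsComp (region E c y) W') {p : Pt} (hp : p ∈ openSegment ℝ c y) {r r' σ : ℝ}
    (hr : 0 < r) (hr' : 0 < r') (hσ : σ ≠ 0) (hsub : half c y p r σ ⊆ W)
    (hsub' : half c y p r' σ ⊆ W') : W = W' := by
  obtain ⟨x, hx⟩ := closure_nonempty_iff.1
    ⟨p, hcut.mem_closure_half hσ hp (Metric.mem_ball_self (lt_min hr hr'))⟩
  refine hW.eq_of_inter hW' ⟨x, hsub ⟨?_, hx.2⟩, hsub' ⟨?_, hx.2⟩⟩
  · exact Metric.ball_subset_ball (min_le_left r r') hx.1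
  · exact Metric.ball_subset_ball (min_le_right r r') hx.1

lemma eq_or_eq_or_eq (hcut : Cut E c y) (h : OuterRegion E C) {W₁ W₂ W₃ : Set Pt}
    (h₁ : IsComp (region E c y) W₁) (h₂ : IsComp (region E c y) W₂)
    (h₃ : IsComp (region E c y) W₃) (hs₁ : openSegment ℝ c y ⊆ closure W₁)
    (hs₂ : openSegment ℝ c y ⊆ closure W₂) (hs₃ : openSegment ℝ c y ⊆ closure W₃) :
    W₁ = W₂ ∨ W₁ = W₃ ∨ W₂ = W₃ := by
  have hp : midpoint ℝ c y ∈ openSegment ℝ c y := by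
    rw [openSegment_eq_image']
    exact ⟨1 / 2, by norm_num, by rw [midpoint_eq_smul_add, invOf_eq_inv]; module⟩
  obtain ⟨r₁, hr₁, a₁⟩ := hcut.exists_half_subset h h₁ hp (hs₁ hp)
  obtain ⟨r₂, hr₂, a₂⟩ := hcut.exists_half_subset h h₂ hp (hs₂ hp)
  obtain ⟨r₃, hr₃, a₃⟩ := hcut.exists_half_subset h h₃ hp (hs₃ hp)
  have h1 : (1 : ℝ) ≠ 0 := one_ne_zero
  have h2 : (-1 : ℝ) ≠ 0 := by norm_num
  rcases a₁ with a₁ | a₁ <;> rcases a₂ with a₂ | a₂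
  · exact Or.inl (hcut.eq_of_half_subset h₁ h₂ hp hr₁ hr₂ h1 a₁ a₂)
  · rcases a₃ with a₃ | a₃
    · exact Or.inr (Or.inl (hcut.eq_of_half_subset h₁ h₃ hp hr₁ hr₃ h1 a₁ a₃))
    · exact Or.inr (Or.inr (hcut.eq_of_half_subset h₂ h₃ hp hr₂ hr₃ h2 a₂ a₃))
  · rcases a₃ with a₃ | a₃
    · exact Or.inr (Or.inr (hcut.eq_of_half_subset h₂ h₃ hp hr₂ hr₃ h1 a₂ a₃))
    · exact Or.inr (Or.inl (hcut.eq_of_half_subset h₁ h₃ hp hr₁ hr₃ h2 a₁ a₃))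
  · exact Or.inl (hcut.eq_of_half_subset h₁ h₂ hp hr₁ hr₂ h2 a₁ a₂)

end Cut

namespace Cut

variable {E C Z W : Set Pt} {c y : Pt}

lemma gap_or_end_mem (hcut : Cut E c y) (h : OuterRegion E C)
    (hP : Pieces E C (region E c y) Z) (hZ : Z ⊆ insert y C) (hW : IsComp (region E c y) W) :
    (∃ z z', Pieces.Gap E Z W z z') ∨
      y ∈ closure W ∧ (y ∈ E ∨ openSegment ℝ c y ⊆ closure W) := by
  obtain ⟨p, hpE, hpW, hpU⟩ := h.exists_frontier (isOpen_region h) hP.subset_interior hP.subset hW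
  by_cases hpi : p ∈ _root_.interior (convexHull ℝ Eᶜ)
  · have hps := hcut.mem_openSegment_of_mem (by_contra fun hs => hpU ⟨⟨hpi, hpE⟩, hs⟩) hpE hpi
    have := hcut.openSegment_subset_closure h hW hps hpW
    exact Or.inr ⟨end_mem_closure this, Or.inr this⟩
  · by_cases hpy : p = y
    · subst hpy
      exact Or.inr ⟨hpW, Or.inl hpE⟩
    · refine Or.inl (hP.exists_gap hW hpE hpi (fun hpZ => ?_) hpW)
      rcases hZ hpZ with h' | h'
      · exact hpy h'
      · exact h.disjoint p h' hpE

lemma gap_of_end_mem (hcut : Cut E c y) (h : OuterRegion E C)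
    (hP : Pieces E C (region E c y) Z) (hZ : Z ⊆ insert y C) (hyE : y ∈ E)
    (hW : IsComp (region E c y) W) : ∃ z z', Pieces.Gap E Z W z z' := by
  rcases hcut.gap_or_end_mem h hP hZ hW with hg | ⟨hyW, -⟩
  · exact hg
  have hyi : y ∉ _root_.interior (convexHull ℝ Eᶜ) := fun hi => hcut.exit ⟨hi, hyE⟩
  obtain ⟨u, hu⟩ := exists_det2_lt_of_notMem_of_isOpen (convex_convexHull ℝ _).interior
    isOpen_interior hyi
  have he : 0 < ‖y - c‖ := norm_pos_iff.2 (sub_ne_zero.2 hcut.ne.symm)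
  have hue : 0 < det2 u (y - c) := by
    rw [det2_sub_right]
    linarith [hu c hcut.mem_interior]
  obtain ⟨r, hr, hball⟩ := Metric.isOpen_iff.1 h.isOpen y hyE
  set s := r / (2 * ‖y - c‖) with hs
  have hs0 : 0 < s := by positivity
  have hsr : s * ‖y - c‖ = r / 2 := by rw [hs]; field_simp
  have hO : IsOpen (Metric.ball y (r / 2) ∩ {x | det2 u y - det2 u x < s * det2 u (y - c)}) :=
    Metric.isOpen_ball.inter (isOpen_lt (by fun_prop) (by fun_prop))
  have hyO : y ∈ Metric.ball y (r / 2) ∩ {x | det2 u y - det2 u x < s * det2 u (y - c)} :=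
    ⟨Metric.mem_ball_self (by positivity), by simp only [Set.mem_ofPred_eq, sub_self]; positivity⟩
  obtain ⟨x, ⟨⟨hx1, hx2⟩, hxW⟩, hx⟩ := exists_mem_det2_ne_zero (hO.inter (hW.isOpen hP.isOpen))
    (mem_closure_iff_nhds.1 hyW _ (hO.mem_nhds hyO)) {(y - c, c)}
    (by simpa using sub_ne_zero.2 hcut.ne.symm)
  have hx : det2 (y - c) (x - c) ≠ 0 := hx _ (Finset.mem_singleton_self _)
  simp only [Set.mem_ofPred_eq] at hx2
  have hxi := hP.subset_interior (hW.subset hxW)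
  obtain ⟨s₁, h1, h2, h3, h4⟩ := exists_exit (e := y - c) isOpen_interior hxi hs0.le (fun hi => by
    have := hu _ hi
    rw [det2_add_right, det2_smul_right] at this
    linarith)
  have hdet : ∀ t : ℝ, det2 (y - c) (x + t • (y - c) - c) = det2 (y - c) (x - c) := by
    intro t
    rw [show x + t • (y - c) - c = (x - c) + t • (y - c) by abel, det2_add_right,
      det2_smul_right, det2_self, mul_zero, add_zero]
  have hEt : ∀ t, 0 ≤ t → t ≤ s → x + t • (y - c) ∈ E := by
    intro t ht0 ht1
    apply hball
    rw [Metric.mem_ball, dist_eq_norm, show x + t • (y - c) - y = (x - y) + t • (y - c) by abel]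
    refine (norm_add_le _ _).trans_lt ?_
    rw [norm_smul, Real.norm_of_nonneg ht0, ← dist_eq_norm]
    rw [Metric.mem_ball] at hx1
    have : t * ‖y - c‖ ≤ s * ‖y - c‖ := by gcongr
    linarith
  have hsubW : (fun t : ℝ => x + t • (y - c)) '' Set.Ico 0 s₁ ⊆ W := by
    refine hW.subset_of_inter ?_ ?_ ⟨x, ⟨0, ⟨le_rfl, h1⟩, by simp⟩, hxW⟩
    · exact isPreconnected_Ico.image _ (by fun_prop)
    · rintro _ ⟨t, ⟨ht0, ht1⟩, rfl⟩
      refine ⟨⟨h4 t ht0 ht1, hEt t ht0 (by linarith)⟩, fun hseg => ?_⟩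
      have := det2_eq_zero hseg
      rw [hdet] at this
      exact hx this
  refine hP.exists_gap hW (hEt s₁ h1.le h2) h3 (fun hqZ => ?_) ?_
  · rcases hZ hqZ with h' | h'
    · have := hdet s₁
      rw [h', det2_self] at this
      exact hx this.symm
    · exact h.disjoint _ h' (hEt s₁ h1.le h2)
  · have hcl : s₁ ∈ closure (Set.Ico 0 s₁) := by
      rw [closure_Ico h1.ne]; exact ⟨h1.le, le_rfl⟩
    refine closure_mono hsubW ?_
    have hcont : Continuous fun t : ℝ => x + t • (y - c) := by fun_prop
    exact image_closure_subset_closure_image hcont ⟨s₁, hcl, rfl⟩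

lemma exists_neighbour (hcut : Cut E c y) (h : OuterRegion E C)
    (hP : Pieces E C (region E c y) Z) (hZ : Z ⊆ C) (hW : IsComp (region E c y) W)
    (hn : ¬ ∃ z z', Pieces.Gap E Z W z z') :
    ∃ W₁, IsComp (region E c y) W₁ ∧ (∃ z z', Pieces.Gap E Z W₁ z z') ∧
      openSegment ℝ c y ⊆ closure W₁ := by
  have hV : IsOpen (_root_.interior (convexHull ℝ Eᶜ) ∩ E) := isOpen_interior.inter h.isOpen
  obtain ⟨x, hx⟩ := hW.nonempty
  have hX := IsComp.of_mem (U := _root_.interior (convexHull ℝ Eᶜ) ∩ E) (hW.subset hx).1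
  set X := connectedComponentIn (_root_.interior (convexHull ℝ Eᶜ) ∩ E) x with hXdef
  have hWX : W ⊆ X := hX.subset_of_inter hW.isPreconnected (fun _ hz => (hW.subset hz).1)
    ⟨x, hx, mem_connectedComponentIn (hW.subset hx).1⟩
  obtain ⟨q, hqE, hqX, hqV⟩ := h.exists_frontier hV (fun _ hz => hz.1) (fun _ hz => hz.2) hX
  have hqi : q ∉ _root_.interior (convexHull ℝ Eᶜ) := fun hi => hqV ⟨hi, hqE⟩
  have hqQ : q ∈ convexHull ℝ Eᶜ := closure_minimal
    (fun z hz => interior_subset (hX.subset hz).1) hP.isClosed_hull hqX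
  have hqZ : q ∉ Z := fun hz => h.disjoint q (hZ hz) hqE
  obtain ⟨r, hr, hnear⟩ := hP.near q hqE hqQ hqi hqZ
  obtain ⟨x', hx'1, hx'2⟩ := mem_closure_iff_nhds.1 hqX _ (Metric.ball_mem_nhds q hr)
  have hx'G := (hX.subset hx'2).1
  have hW₁ := IsComp.of_mem (hnear ⟨hx'G, hx'1⟩)
  set W₁ := connectedComponentIn (region E c y) x' with hW₁def
  have hx'W₁ : x' ∈ W₁ := mem_connectedComponentIn (hnear ⟨hx'G, hx'1⟩)
  have hsub : _root_.interior (convexHull ℝ Eᶜ) ∩ Metric.ball q r ⊆ W₁ :=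
    hW₁.subset_of_inter ((convex_convexHull ℝ _).interior.inter (convex_ball q r)).isPreconnected
      hnear ⟨x', ⟨hx'G, hx'1⟩, hx'W₁⟩
  have hqW₁ : q ∈ closure W₁ := by
    refine closure_mono hsub ?_
    rw [Set.inter_comm]
    exact Metric.isOpen_ball.inter_closure ⟨Metric.mem_ball_self hr, hP.hull_subset_closure hqQ⟩
  have hgap := hP.exists_gap hW₁ hqE hqi hqZ hqW₁
  refine ⟨W₁, hW₁, hgap, ?_⟩
  by_contra hno
  have hXW₁ : X ⊆ W₁ := by
    refine hX.isPreconnected.subset_of_closure_inter_subset (hW₁.isOpen hP.isOpen)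
      ⟨x', hx'2, hx'W₁⟩ ?_
    rintro p ⟨hpW, hpX⟩
    refine hW₁.mem_of_mem_closure hP.isOpen ?_ hpW
    refine ⟨hX.subset hpX, fun hps => hno ?_⟩
    have := hX.subset hpX
    exact hcut.openSegment_subset_closure h hW₁ (hcut.mem_openSegment_of_mem hps this.2 this.1) hpW
  exact hn (hW.eq_of_inter hW₁ ⟨x, hx, hXW₁ (hWX hx)⟩ ▸ hgap)

end Cut

/-- The pieces that are not gaps all coincide, and such a piece meets a gap in the closure of
a point `y ∉ E` at which `E` has a supporting line. -/
structure Residual (E U Z : Set Pt) (y : Pt) : Prop where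
  notMem : y ∉ E
  support : ∃ u, ∃ r > (0 : ℝ), ∀ x ∈ E ∩ Metric.ball y r, det2 u y < det2 u x
  unique : ∀ W W', IsComp U W → IsComp U W' → (¬ ∃ z z', Pieces.Gap E Z W z z') →
    (¬ ∃ z z', Pieces.Gap E Z W' z z') → W = W'
  mem_closure : ∀ W, IsComp U W → (¬ ∃ z z', Pieces.Gap E Z W z z') → y ∈ closure W
  neighbour : ∀ W, IsComp U W → (¬ ∃ z z', Pieces.Gap E Z W z z') →
    ∃ W₁, IsComp U W₁ ∧ (∃ z z', Pieces.Gap E Z W₁ z z') ∧ y ∈ closure W₁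

theorem OuterRegion.exists_pieces {E C : Set Pt} (h : OuterRegion E C)
    (hne : (interior (convexHull ℝ Eᶜ)).Nonempty) (hC : C.ncard ≤ 4) (B : Finset Pt)
    (hBE : ∀ b ∈ B, b ∈ E) (hBi : ∀ b ∈ B, b ∈ interior (convexHull ℝ Eᶜ)) :
    ∃ U Z, Pieces E C U Z ∧ (∀ b ∈ B, b ∈ U) ∧ Z.ncard ≤ C.ncard ∧
      ((∀ W, IsComp U W → ∃ z z', Pieces.Gap E Z W z z') ∨
        Z.ncard < C.ncard ∧ ∃ y, Residual E U Z y) := by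
  have h3 := three_le_ncard_of_subset_convexHull hne (h.finite.subset Set.sdiff_subset)
    h.hull_subset
  by_cases hex : ∃ c ∈ C, c ∈ interior (convexHull ℝ Eᶜ)
  swap
  · push Not at hex
    have hP : Pieces E C ((interior (convexHull ℝ Eᶜ) ∩ E) \ ∅) C :=
      { outer := h
        nonempty := hne
        isOpen := (isOpen_interior.inter h.isOpen).sdiff isClosed_empty
        subset := fun _ hx => hx.1.2
        subset_interior := fun _ hx => hx.1.1
        convex := fun W hW => h.convex_of_isComp isClosed_empty (fun p hpi hp => by
          rcases hp with hp | ⟨-, hp⟩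
          · exact absurd hpi (hex p hp)
          · exact absurd hp (Set.notMem_empty p)) hW
        finite := h.finite
        subset_hull := fun c hc => subset_convexHull ℝ _ (h.disjoint c hc)
        notMem_interior := hex
        hull_subset := h.hull_subset.trans (convexHull_mono Set.sdiff_subset)
        corners := fun c hc _ => hc
        near := by
          intro p hpE _ _ _
          obtain ⟨r, hr, hball⟩ := Metric.isOpen_iff.1 h.isOpen p hpE
          exact ⟨r, hr, fun x hx => ⟨⟨hx.1, hball hx.2⟩, Set.notMem_empty x⟩⟩ }
    refine ⟨_, C, hP, fun b hb => ⟨⟨hBi b hb, hBE b hb⟩, Set.notMem_empty b⟩, le_rfl,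
      Or.inl fun W hW => ?_⟩
    obtain ⟨p, hpE, hpW, hpU⟩ := h.exists_frontier hP.isOpen hP.subset_interior hP.subset hW
    exact hP.exists_gap hW hpE (fun hpi => hpU ⟨⟨hpi, hpE⟩, Set.notMem_empty p⟩)
      (fun hpC => h.disjoint p hpC hpE) hpW
  obtain ⟨c, hc, hci⟩ := hex
  have hsplit := Set.ncard_inter_add_ncard_sdiff_eq_ncard C (interior (convexHull ℝ Eᶜ)) h.finite
  have huniq : ∀ c' ∈ C, c' ∈ interior (convexHull ℝ Eᶜ) → c' = c := by
    intro c' hc' hci'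
    exact (Set.ncard_le_one_iff (h.finite.subset Set.inter_subset_left)).1 (by omega)
      ⟨hc', hci'⟩ ⟨hc, hci⟩
  have hpos : 0 < (C ∩ interior (convexHull ℝ Eᶜ)).ncard :=
    (Set.ncard_pos (h.finite.subset Set.inter_subset_left)).2 ⟨c, hc, hci⟩
  obtain ⟨y, hcut, hF⟩ := h.exists_cut hc hci (B ∪ (h.finite.toFinset.erase c)) (by
    simp only [Finset.mem_union, Finset.mem_erase, ne_eq, not_true_eq_false, false_and, or_false]
    exact fun hcB => h.disjoint c hc (hBE c hcB))
  have hBU : ∀ b ∈ B, b ∈ Cut.region E c y := fun b hb => ⟨⟨hBi b hb, hBE b hb⟩, fun hs =>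
    hF b (Finset.mem_union_left _ hb) (Cut.det2_eq_zero hs)⟩
  have hyC : y ∉ C := fun hy => hF y (Finset.mem_union_right _ (by
    simpa using ⟨hcut.ne.symm, hy⟩)) (det2_self _)
  by_cases hyE : y ∈ E
  · have hyi : y ∉ interior (convexHull ℝ Eᶜ) := fun hi => hcut.exit ⟨hi, hyE⟩
    have hP := hcut.pieces h huniq (Set.subset_insert y _) subset_rfl
      (fun _ => Set.mem_insert y _) (fun _ => hyi)
    refine ⟨_, _, hP, hBU, ?_, Or.inl fun W hW => hcut.gap_of_end_mem h hP
      (Set.insert_subset_insert Set.sdiff_subset) hyE hW⟩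
    have := Set.ncard_insert_le y (C \ interior (convexHull ℝ Eᶜ))
    omega
  · have hP := hcut.pieces h huniq subset_rfl (Set.subset_insert y _) (fun h => absurd h hyE)
      (fun hy => absurd hy.1 hyC)
    have key : ∀ W, IsComp (Cut.region E c y) W →
        (¬ ∃ z z', Pieces.Gap E (C \ interior (convexHull ℝ Eᶜ)) W z z') →
        openSegment ℝ c y ⊆ closure W := by
      intro W hW hn
      rcases hcut.gap_or_end_mem h hP (Set.sdiff_subset.trans (Set.subset_insert y C)) hW with
        hg | ⟨-, hy | hs⟩
      · exact absurd hg hn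
      · exact absurd hy hyE
      · exact hs
    refine ⟨_, _, hP, hBU, by omega, Or.inr ⟨by omega, y, hyE, ?_, ?_, ?_, ?_⟩⟩
    · obtain ⟨r, hr, hconv⟩ := h.locally_convex y hyE hyC
      obtain ⟨u, hu⟩ := exists_det2_lt_of_notMem_of_isOpen hconv
        (h.isOpen.inter Metric.isOpen_ball) (fun h' => hyE h'.1)
      refine ⟨-u, r, hr, fun x hx => ?_⟩
      rw [det2_neg_left, det2_neg_left]
      exact neg_lt_neg (hu x hx)
    · intro W W' hW hW' hn hn'
      obtain ⟨W₁, hW₁, hg, hs⟩ := hcut.exists_neighbour h hP Set.sdiff_subset hW hn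
      rcases hcut.eq_or_eq_or_eq h hW hW' hW₁ (key W hW hn) (key W' hW' hn') hs with h' | h' | h'
      · exact h'
      · exact absurd (h' ▸ hg) hn
      · exact absurd (h' ▸ hg) hn'
    · exact fun W hW hn => Cut.end_mem_closure (key W hW hn)
    · intro W hW hn
      obtain ⟨W₁, hW₁, hg, hs⟩ := hcut.exists_neighbour h hP Set.sdiff_subset hW hn
      exact ⟨W₁, hW₁, hg, Cut.end_mem_closure hs⟩

/-! ### Quantitative estimates -/

/-- Constants small, respectively large, enough for the arguments below. -/
structure Consts (ρ κ δ Λ D θ : ℝ) : Prop where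
  one_le : 1 ≤ ρ
  κ_pos : 0 < κ
  κ_le : κ ≤ 1 / 2
  δ_pos : 0 < δ
  le_Λ : 1 + ρ ≤ Λ
  sq_le : 4 * ρ ^ 2 ≤ κ * Λ
  mul_le : 8 * ρ ≤ κ ^ 2 * Λ
  δ_le : 18 * δ ≤ κ ^ 2
  slim : κ * (16 * ρ ^ 2 + 4 * ρ + 1) < D
  slim_far : 4 * (6 * δ * (2 * ρ + 1)) ≤ κ
  slim_near : 6 * δ * (2 * ρ + 1) * (1 + 4 * ρ / D) ≤ κ
  slim_blue : 6 * δ * (2 * ρ + 1) * (1 + 2 * ρ) < D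
  slim_bounded : 6 * δ * (2 * ρ + 1) * (1 + Λ + ρ) * (2 / θ + 1) < D

lemma exists_consts {ρ D θ : ℝ} (hρ : 1 ≤ ρ) (hD : 0 < D) :
    ∃ κ δ Λ, Consts ρ κ δ Λ D θ := by
  have hρ0 : 0 < ρ := by linarith
  obtain ⟨κ, hκ, hκ1, hκD⟩ : ∃ κ : ℝ, 0 < κ ∧ κ ≤ 1 / 2 ∧ κ * (16 * ρ ^ 2 + 4 * ρ + 1) < D := by
    refine ⟨min (1 / 2) (D / (2 * (16 * ρ ^ 2 + 4 * ρ + 1))), by positivity, min_le_left _ _, ?_⟩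
    have h1 := min_le_right (1 / 2) (D / (2 * (16 * ρ ^ 2 + 4 * ρ + 1)))
    rw [le_div_iff₀ (by positivity)] at h1
    linarith
  set Λ := 1 + ρ + 4 * ρ ^ 2 / κ + 8 * ρ / κ ^ 2 with hΛ
  have e1 : κ * (4 * ρ ^ 2 / κ) = 4 * ρ ^ 2 := by field_simp
  have e2 : κ ^ 2 * (8 * ρ / κ ^ 2) = 8 * ρ := by field_simp
  have p1 : 0 < 4 * ρ ^ 2 / κ := by positivity
  have p2 : 0 < 8 * ρ / κ ^ 2 := by positivity
  have small : ∀ A b : ℝ, 0 < b → ∀ᶠ δ in nhdsWithin (0 : ℝ) (Set.Ioi 0), δ * A < b := by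
    intro A b hb
    have : Filter.Tendsto (fun δ : ℝ => δ * A) (nhdsWithin 0 (Set.Ioi 0)) (nhds (0 * A)) :=
      ((continuous_mul_const A).tendsto 0).mono_left nhdsWithin_le_nhds
    rw [zero_mul] at this
    exact this.eventually_lt_const hb
  have hpos : ∀ᶠ δ in nhdsWithin (0 : ℝ) (Set.Ioi 0), 0 < δ := self_mem_nhdsWithin
  obtain ⟨δ, h0, h1, h2, h3, h4, h5⟩ := (hpos.and ((small 18 (κ ^ 2) (by positivity)).and
    ((small (4 * (6 * (2 * ρ + 1))) κ hκ).and
    ((small (6 * (2 * ρ + 1) * (1 + 4 * ρ / D)) κ hκ).and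
    ((small (6 * (2 * ρ + 1) * (1 + 2 * ρ)) D hD).and
    (small (6 * (2 * ρ + 1) * (1 + Λ + ρ) * (2 / θ + 1)) D hD)))))).exists
  refine ⟨κ, δ, Λ, hρ, hκ, hκ1, h0, by linarith, ?_, ?_, by linarith, hκD, by linarith, ?_, ?_, ?_⟩
  · rw [hΛ]
    have : 0 < κ * (1 + ρ + 8 * ρ / κ ^ 2) := by positivity
    linarith
  · rw [hΛ]
    have : 0 < κ ^ 2 * (1 + ρ + 4 * ρ ^ 2 / κ) := by positivity
    linarith
  · rw [show 6 * δ * (2 * ρ + 1) * (1 + 4 * ρ / D) = δ * (6 * (2 * ρ + 1) * (1 + 4 * ρ / D)) by ring]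
    exact h3.le
  · rw [show 6 * δ * (2 * ρ + 1) * (1 + 2 * ρ) = δ * (6 * (2 * ρ + 1) * (1 + 2 * ρ)) by ring]
    exact h4
  · rw [show 6 * δ * (2 * ρ + 1) * (1 + Λ + ρ) * (2 / θ + 1) =
      δ * (6 * (2 * ρ + 1) * (1 + Λ + ρ) * (2 / θ + 1)) by ring]
    exact h5

/-- The unit vector in the direction of `x`. -/
def unit (x : Pt) : Pt := ‖x‖⁻¹ • x

lemma norm_unit {x : Pt} (hx : x ≠ 0) : ‖unit x‖ = 1 := norm_smul_inv_norm hx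

lemma norm_smul_unit (x : Pt) : ‖x‖ • unit x = x := by
  by_cases hx : x = 0
  · simp [hx]
  · rw [unit, smul_smul, mul_inv_cancel₀ (norm_ne_zero_iff.2 hx), one_smul]

lemma norm_unit_sub_unit_le {x b : Pt} (hx : x ≠ 0) (hxb : x ≠ b) :
    ‖unit (x - b) - unit x‖ ≤ 2 * ‖b‖ / ‖x‖ := by
  have h1 : 0 < ‖x‖ := norm_pos_iff.2 hx
  have h2 : 0 < ‖x - b‖ := norm_pos_iff.2 (sub_ne_zero.2 hxb)
  have e : (‖x‖ * ‖x - b‖) • (unit (x - b) - unit x) =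
      (‖x‖ - ‖x - b‖) • (x - b) - ‖x - b‖ • b := by
    have a1 : (‖x‖ * ‖x - b‖) • unit (x - b) = ‖x‖ • (x - b) := by
      rw [mul_smul, norm_smul_unit]
    have a2 : (‖x‖ * ‖x - b‖) • unit x = ‖x - b‖ • x := by
      rw [mul_comm, mul_smul, norm_smul_unit]
    rw [smul_sub, a1, a2]
    module
  have e2 : ‖x‖ * ‖x - b‖ * ‖unit (x - b) - unit x‖ ≤ 2 * ‖b‖ * ‖x - b‖ := by
    have := congrArg norm e
    rw [norm_smul, Real.norm_of_nonneg (by positivity)] at this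
    rw [this]
    refine (norm_sub_le _ _).trans ?_
    rw [norm_smul, norm_smul, norm_norm, Real.norm_eq_abs]
    have h3 : |‖x‖ - ‖x - b‖| ≤ ‖b‖ := by
      have := abs_norm_sub_norm_le x (x - b)
      rwa [sub_sub_cancel] at this
    nlinarith
  rw [le_div_iff₀ h1]
  have : (‖unit (x - b) - unit x‖ * ‖x‖) * ‖x - b‖ ≤ (2 * ‖b‖) * ‖x - b‖ := by linarith
  exact le_of_mul_le_mul_right this h2

/-- A convex subset of `E` whose closure contains a triangle of large area meets `Eᶜ`. -/
lemma abs_det2_le_of_mem_closure {E W : Set Pt} {L δ N : ℝ}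
    (hth : ∀ x : Pt, ‖x‖ ≤ L → ∃ r ∉ E, dist x r < δ) (hW : Convex ℝ W) (ho : IsOpen W)
    (hne : W.Nonempty) (hWE : W ⊆ E) {p v w : Pt} (hp : p ∈ closure W) (hv : p + v ∈ closure W)
    (hw : p + w ∈ closure W) (hvN : ‖v‖ ≤ N) (hwN : ‖w‖ ≤ N)
    (hL : ‖p + (1 / 3 : ℝ) • (v + w)‖ ≤ L) : |det2 v w| ≤ 6 * δ * N := by
  by_contra! hlt
  obtain ⟨r, hr, hd⟩ := hth _ hL
  obtain ⟨u, hu⟩ := exists_det2_lt_of_notMem_of_isOpen hW ho (fun h => hr (hWE h))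
  have hcl : ∀ y ∈ closure W, det2 u y ≤ det2 u r := fun y hy =>
    closure_minimal (t := {y | det2 u y ≤ det2 u r}) (fun x hx => (hu x hx).le)
      (isClosed_le (by fun_prop) (by fun_prop)) hy
  set n := r - (p + (1 / 3 : ℝ) • (v + w)) with hn
  have hnδ : ‖n‖ ≤ δ := by rw [hn, ← dist_eq_norm, dist_comm]; exact hd.le
  have hN : 0 ≤ N := (norm_nonneg v).trans hvN
  have hδ : 0 ≤ δ := (norm_nonneg n).trans hnδ
  have hD0 : det2 v w ≠ 0 := by
    intro h
    rw [h, abs_zero] at hlt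
    have : 0 ≤ 6 * δ * N := by positivity
    linarith
  set D := det2 v w with hD
  have hDpos : 0 < |D| := abs_pos.2 hD0
  have b1 : |det2 n w / D| < 1 / 6 := by
    rw [abs_div, div_lt_iff₀ hDpos]
    have : ‖n‖ * ‖w‖ ≤ δ * N := by gcongr
    linarith [abs_det2_le n w]
  have b2 : |det2 v n / D| < 1 / 6 := by
    rw [abs_div, div_lt_iff₀ hDpos]
    have : ‖v‖ * ‖n‖ ≤ N * δ := by gcongr
    linarith [abs_det2_le v n]
  have hnc := exists_coords_of_det2_ne_zero hD0 n
  rw [← hD] at hnc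
  set α := det2 n w / D
  set β := det2 v n / D
  rw [abs_lt] at b1 b2
  have hr' : r = p + (1 / 3 + α) • v + (1 / 3 + β) • w := by
    have : r = n + (p + (1 / 3 : ℝ) • (v + w)) := by rw [hn]; abel
    rw [this]
    conv_lhs => rw [hnc]
    module
  have h1 := hcl p hp
  have h2 := hcl _ hv
  have h3 := hcl _ hw
  have h4 : det2 u r = det2 u p + (1 / 3 + α) * det2 u v + (1 / 3 + β) * det2 u w := by
    rw [hr', det2_add_right, det2_add_right, det2_smul_right, det2_smul_right]
  rw [det2_add_right] at h2 h3
  have h5 : (1 - (1 / 3 + α) - (1 / 3 + β)) * (det2 u r - det2 u p) +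
      (1 / 3 + α) * (det2 u r - (det2 u p + det2 u v)) +
      (1 / 3 + β) * (det2 u r - (det2 u p + det2 u w)) = 0 := by
    linear_combination -h4 + 2 * h4
  have c1 : 0 ≤ (1 - (1 / 3 + α) - (1 / 3 + β)) * (det2 u r - det2 u p) :=
    mul_nonneg (by linarith) (by linarith)
  have c2 : 0 ≤ (1 / 3 + α) * (det2 u r - (det2 u p + det2 u v)) :=
    mul_nonneg (by linarith) (by linarith)
  have c3 : 0 ≤ (1 / 3 + β) * (det2 u r - (det2 u p + det2 u w)) :=
    mul_nonneg (by linarith) (by linarith)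
  have d1 : det2 u r - det2 u p = 0 := by
    rcases mul_eq_zero.1 (le_antisymm (by linarith) c1) with h | h
    · linarith
    · exact h
  have d2 : det2 u r - (det2 u p + det2 u v) = 0 := by
    rcases mul_eq_zero.1 (le_antisymm (by linarith) c2) with h | h
    · linarith
    · exact h
  have d3 : det2 u r - (det2 u p + det2 u w) = 0 := by
    rcases mul_eq_zero.1 (le_antisymm (by linarith) c3) with h | h
    · linarith
    · exact h
  have hu0 : u = 0 := eq_zero_of_det2_eq_zero hD0 (by rw [det2_swap]; linarith)
    (by rw [det2_swap]; linarith)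
  obtain ⟨x, hx⟩ := hne
  simpa [hu0] using hu x hx

/-- Two unit vectors can only be nearly parallel to two short independent vectors
if they are themselves independent. -/
lemma lt_abs_det2_of_nearly_parallel {u v β β' : Pt} {κ M D : ℝ} (hu : ‖u‖ = 1) (hv : ‖v‖ = 1)
    (h : |det2 β u| ≤ κ) (h' : |det2 β' v| ≤ κ) (hβ : ‖β‖ ≤ M) (hβ' : ‖β'‖ ≤ M)
    (hD : D ≤ |det2 β β'|) (hκ : κ ≤ 1) (hlt : κ * (4 * M ^ 2 + 2 * M + 1) < D) :
    4 * κ < |det2 u v| := by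
  by_contra! hle
  have hκ0 : 0 ≤ κ := (abs_nonneg _).trans h
  have hM : 0 ≤ M := (norm_nonneg _).trans hβ
  have decomp : ∀ e x : Pt, ‖e‖ = 1 → x = (inner ℝ e x) • e + (-det2 x e) • rot e := by
    intro e x he
    have he0 : det2 e (rot e) = 1 := by rw [det2_rot, he]; norm_num
    have := exists_coords_of_det2_ne_zero (by rw [he0]; norm_num : det2 e (rot e) ≠ 0) x
    rw [he0, div_one, div_one, det2_rot_right, det2_swap e x, real_inner_comm] at this
    exact this
  have expand : ∀ a b a' b' : ℝ, det2 (a • u + (-b) • rot u) (a' • v + (-b') • rot v) =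
      a * a' * det2 u v - a * b' * inner ℝ u v + b * a' * inner ℝ u v + b * b' * det2 u v := by
    intro a b a' b'
    simp only [det2, rot, inner_eq_coord, mkPt, PiLp.add_apply, PiLp.smul_apply, smul_eq_mul]
    simp
    ring
  have e1 := decomp u β hu
  have e2 := decomp v β' hv
  have i1 : |inner ℝ u β| ≤ M := (abs_real_inner_le_norm u β).trans (by rw [hu, one_mul]; exact hβ)
  have i2 : |inner ℝ v β'| ≤ M := (abs_real_inner_le_norm v β').trans (by rw [hv, one_mul]; exact hβ')
  have i3 : |inner ℝ u v| ≤ 1 := (abs_real_inner_le_norm u v).trans (by rw [hu, hv, one_mul])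
  have hdet1 : |det2 u v| ≤ 1 := (abs_det2_le u v).trans (by rw [hu, hv, one_mul])
  set a := inner ℝ u β
  set a' := inner ℝ v β'
  set b := det2 β u
  set b' := det2 β' v
  have key : det2 β β' = a * a' * det2 u v - a * b' * inner ℝ u v + b * a' * inner ℝ u v +
      b * b' * det2 u v := by
    rw [← expand, ← e1, ← e2]
  have t1 : |a * a' * det2 u v| ≤ M * M * (4 * κ) := by rw [abs_mul, abs_mul]; gcongr
  have t2 : |a * b' * inner ℝ u v| ≤ M * κ * 1 := by rw [abs_mul, abs_mul]; gcongr
  have t3 : |b * a' * inner ℝ u v| ≤ κ * M * 1 := by rw [abs_mul, abs_mul]; gcongr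
  have t4 : |b * b' * det2 u v| ≤ κ * 1 * 1 := by
    rw [abs_mul, abs_mul]; gcongr; exact h'.trans hκ
  rw [key] at hD
  have t5 := abs_add_le (a * a' * det2 u v - a * b' * inner ℝ u v + b * a' * inner ℝ u v)
    (b * b' * det2 u v)
  have t6 := abs_add_le (a * a' * det2 u v - a * b' * inner ℝ u v) (b * a' * inner ℝ u v)
  have t7 := abs_sub (a * a' * det2 u v) (a * b' * inner ℝ u v)
  nlinarith

/-- The complement of `E` is dense in a large disc, at a scale set by the constants. -/
structure Fine (E : Set Pt) (ρ κ δ Λ D θ : ℝ) : Prop extends Consts ρ κ δ Λ D θ where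
  dense : ∀ x : Pt, ‖x‖ ≤ Λ + δ + 3 * ρ + 2 → ∃ r ∉ E, dist x r < δ
  ball_subset : Metric.ball 0 Λ ⊆ interior (convexHull ℝ Eᶜ)

/-- A nonempty open convex subset of `E`. -/
structure Chunk (E W : Set Pt) : Prop where
  convex : Convex ℝ W
  isOpen : IsOpen W
  nonempty : W.Nonempty
  subset : W ⊆ E

lemma Pieces.chunk {E C U Z W : Set Pt} (h : Pieces E C U Z) (hW : IsComp U W) : Chunk E W :=
  ⟨h.convex W hW, hW.isOpen h.isOpen, hW.nonempty, hW.subset.trans h.subset⟩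

namespace Fine

variable {E W : Set Pt} {ρ κ δ Λ D θ : ℝ}

lemma abs_det2_le (hF : Fine E ρ κ δ Λ D θ) (hW : Chunk E W) {p q x : Pt} (hp : p ∈ closure W)
    (hq : q ∈ closure W) (hx : x ∈ closure W) (hpρ : ‖p‖ ≤ ρ) (hqρ : ‖q‖ ≤ ρ) :
    |det2 (q - p) (x - p)| ≤ 6 * δ * (2 * ρ + 1) * (1 + ‖x - p‖) := by
  have h0 : 0 < 1 + ‖x - p‖ := by positivity
  have hρ := hF.one_le
  set w := (1 + ‖x - p‖)⁻¹ • (x - p) with hw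
  have hwn : ‖w‖ ≤ 1 := by
    rw [hw, norm_smul, Real.norm_of_nonneg (by positivity), inv_mul_le_iff₀ h0]
    linarith
  have hvn : ‖q - p‖ ≤ 2 * ρ := (norm_sub_le _ _).trans (by linarith)
  have hpw : p + w ∈ closure W := by
    refine hW.convex.closure.segment_subset hp hx ?_
    refine mem_segment_iff_wbtw.2 ⟨(1 + ‖x - p‖)⁻¹, ⟨by positivity, ?_⟩, ?_⟩
    · exact inv_le_one_of_one_le₀ (by linarith [norm_nonneg (x - p)])
    · rw [AffineMap.lineMap_apply, vsub_eq_sub, vadd_eq_add, hw, add_comm]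
  have key := abs_det2_le_of_mem_closure hF.dense hW.convex hW.isOpen hW.nonempty hW.subset
    (v := q - p) (w := w) (N := 2 * ρ + 1) hp (by simpa using hq) hpw (by linarith) (by linarith) (by
      have h1 := norm_add_le p ((1 / 3 : ℝ) • (q - p + w))
      rw [norm_smul] at h1
      have h2 := norm_add_le (q - p) w
      have h3 : ‖(1 / 3 : ℝ)‖ = 1 / 3 := by norm_num
      rw [h3] at h1
      linarith [hF.δ_pos, hF.le_Λ])
  have e : x - p = (1 + ‖x - p‖) • w := by
    rw [hw, smul_smul, mul_inv_cancel₀ h0.ne', one_smul]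
  conv_lhs => rw [e]
  rw [det2_smul_right, abs_mul, abs_of_pos h0, mul_comm]
  gcongr

/-- A convex subset of `E` contains no large triangle with vertices near the origin. -/
lemma abs_det2_lt (hF : Fine E ρ κ δ Λ D θ) (hW : Chunk E W) {p q x : Pt} (hp : p ∈ W)
    (hq : q ∈ W) (hx : x ∈ W) (hpρ : ‖p‖ ≤ ρ) (hqρ : ‖q‖ ≤ ρ) (hxρ : ‖x‖ ≤ ρ) :
    |det2 (q - p) (x - p)| < D := by
  refine (hF.abs_det2_le hW (subset_closure hp) (subset_closure hq) (subset_closure hx)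
    hpρ hqρ).trans_lt (lt_of_le_of_lt ?_ hF.slim_blue)
  have := hF.δ_pos
  have := hF.one_le
  gcongr
  exact (norm_sub_le _ _).trans (by linarith)

lemma Λ_pos (hF : Fine E ρ κ δ Λ D θ) : 0 < Λ := by linarith [hF.le_Λ, hF.one_le]

lemma abs_det2_unit_le (hF : Fine E ρ κ δ Λ D θ) (hW : Chunk E W) {p q x : Pt}
    (hp : p ∈ closure W) (hq : q ∈ closure W) (hx : x ∈ closure W) (hpρ : ‖p‖ ≤ ρ) (hqρ : ‖q‖ ≤ ρ)
    (hxΛ : Λ ≤ ‖x‖) : |det2 (q - p) (unit x)| ≤ κ := by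
  have h1 := hF.abs_det2_le hW hp hq hx hpρ hqρ
  have hx0 : 0 < ‖x‖ := hF.Λ_pos.trans_le hxΛ
  have h2 := _root_.abs_det2_le (q - p) p
  have h3 : ‖q - p‖ * ‖p‖ ≤ 2 * ρ * ρ := by
    have : ‖q - p‖ ≤ 2 * ρ := (norm_sub_le _ _).trans (by linarith)
    have := hF.one_le
    gcongr
  have h4 : 6 * δ * (2 * ρ + 1) * (1 + ‖x - p‖) ≤ 6 * δ * (2 * ρ + 1) * (2 * ‖x‖) := by
    have := hF.δ_pos
    have := hF.one_le
    gcongr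
    linarith [norm_sub_le x p, hF.le_Λ]
  have h5 : det2 (q - p) x = det2 (q - p) (x - p) + det2 (q - p) p := by
    rw [← det2_add_right, sub_add_cancel]
  have h6 : |det2 (q - p) x| ≤ κ * ‖x‖ := by
    rw [h5]
    refine (abs_add_le _ _).trans ?_
    have h7 := mul_le_mul_of_nonneg_right hF.slim_far hx0.le
    have h8 := mul_le_mul_of_nonneg_left hxΛ hF.κ_pos.le
    nlinarith [hF.sq_le]
  rw [unit, det2_smul_right, abs_mul, abs_of_pos (inv_pos.2 hx0), inv_mul_le_iff₀ hx0, mul_comm]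
  exact h6

lemma le_norm (hF : Fine E ρ κ δ Λ D θ) {z : Pt} (hz : z ∉ interior (convexHull ℝ Eᶜ)) :
    Λ ≤ ‖z‖ := by
  by_contra! h
  exact hz (hF.ball_subset (by simpa using h))

lemma le_det2 (hF : Fine E ρ κ δ Λ D θ) {u z : Pt} (hu : ‖u‖ = 1)
    (h : ∀ y ∈ convexHull ℝ Eᶜ, det2 u y ≤ det2 u z) : Λ ≤ det2 u z := by
  refine le_of_forall_lt fun t ht => ?_
  obtain ⟨s, hs, hsΛ⟩ := exists_between (max_lt ht hF.Λ_pos)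
  have hs0 : 0 < s := (le_max_right _ _).trans_lt hs
  have hmem : s • rot u ∈ convexHull ℝ Eᶜ := by
    refine interior_subset (hF.ball_subset ?_)
    rw [mem_ball_zero_iff, norm_smul, norm_rot, hu, Real.norm_of_nonneg hs0.le, mul_one]
    exact hsΛ
  have := h _ hmem
  rw [det2_smul_right, det2_rot, hu] at this
  linarith [le_max_left t 0]

/-- Seen from afar, the endpoints of a gap lie in nearly the same direction. -/
lemma norm_unit_sub_le {z z' b : Pt} (hF : Fine E ρ κ δ Λ D θ) (hW : Chunk E W) {Z : Set Pt}
    (hg : Pieces.Gap E Z W z z') (hb : b ∈ W) (hbρ : ‖b‖ ≤ ρ)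
    (hz : z ∈ closure W) (hz' : z' ∈ closure W) : ‖unit z - unit z'‖ ≤ κ ^ 2 := by
  obtain ⟨u, hu0, hu, hsup⟩ := hg.edge.support
  have hρ := hF.one_le
  have hδ := hF.δ_le
  have hκ : κ ^ 2 ≤ 1 := by nlinarith [hF.κ_le, hF.κ_pos]
  have hΛ := hF.le_Λ
  have hn := norm_unit hu0
  have hle : ∀ y, det2 u y = det2 u z → Λ ≤ det2 (unit u) y := by
    intro y hy
    refine hF.le_det2 hn fun x hx => ?_
    rw [unit, det2_smul_left, det2_smul_left, hy]
    exact mul_le_mul_of_nonneg_left (hsup x hx) (by positivity)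
  have hfar : ∀ y, det2 u y = det2 u z → 1 ≤ ‖y - b‖ ∧ Λ ≤ ‖y‖ := by
    intro y hy
    have h1 := hle y hy
    have h2 := _root_.abs_det2_le (unit u) y
    rw [hn, one_mul] at h2
    have h3 : Λ ≤ ‖y‖ := h1.trans ((le_abs_self _).trans h2)
    exact ⟨by linarith [norm_sub_norm_le y b], h3⟩
  obtain ⟨h1, hzΛ⟩ := hfar z rfl
  obtain ⟨h1', hzΛ'⟩ := hfar z' hu
  have hne : ∀ y, 1 ≤ ‖y - b‖ → y - b ≠ 0 := fun y hy h => by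
    rw [h, norm_zero] at hy; linarith
  have hmem : ∀ y, 1 ≤ ‖y - b‖ → y ∈ closure W → b + unit (y - b) ∈ closure W := by
    intro y hy hyW
    refine hW.convex.closure.segment_subset (subset_closure hb) hyW ?_
    refine mem_segment_iff_wbtw.2 ⟨‖y - b‖⁻¹, ⟨by positivity, inv_le_one_of_one_le₀ hy⟩, ?_⟩
    rw [AffineMap.lineMap_apply, vsub_eq_sub, vadd_eq_add, add_comm, unit]
  have hdet : ∀ x y, x ∈ closure W → y ∈ closure W → 1 ≤ ‖x - b‖ → 1 ≤ ‖y - b‖ →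
      |det2 (unit (x - b)) (unit (y - b))| ≤ 6 * δ := by
    intro x y hx hy hx1 hy1
    have e1 := norm_unit (hne x hx1)
    have e2 := norm_unit (hne y hy1)
    have := abs_det2_le_of_mem_closure hF.dense hW.convex hW.isOpen hW.nonempty hW.subset
      (N := 1) (subset_closure hb) (hmem x hx1 hx) (hmem y hy1 hy) e1.le e2.le (by
        have h1 := norm_add_le b ((1 / 3 : ℝ) • (unit (x - b) + unit (y - b)))
        rw [norm_smul] at h1
        have h2 := norm_add_le (unit (x - b)) (unit (y - b))
        have h3 : ‖(1 / 3 : ℝ)‖ = 1 / 3 := by norm_num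
        rw [h3] at h1
        linarith [hF.δ_pos, hF.le_Λ])
    linarith
  set v := unit (z - b) with hv
  set v' := unit (z' - b) with hv'
  have nv : ‖v‖ = 1 := norm_unit (hne z h1)
  have nv' : ‖v'‖ = 1 := norm_unit (hne z' h1')
  have hd := hdet z z' hz hz' h1 h1'
  rw [← hv, ← hv'] at hd
  have hin : 0 ≤ inner ℝ v v' := by
    by_contra! hlt
    set a := ‖z - b‖ with ha
    set a' := ‖z' - b‖ with ha'
    have e1 : z - b = a • v := (norm_smul_unit _).symm
    have e2 : z' - b = a' • v' := (norm_smul_unit _).symm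
    set c := -inner ℝ v v' with hc
    have hc0 : 0 < c := by linarith
    have hden : 0 < a + a' * c := by positivity
    set t := a / (a + a' * c) with ht
    have ht1 : 1 - t = a' * c / (a + a' * c) := by rw [ht]; field_simp; ring
    set m := (1 - t) • z + t • z' with hm
    have hmW : m ∈ closure W := hW.convex.closure hz hz'
      (by rw [ht1]; positivity) (by positivity) (by ring)
    have hmu : det2 u m = det2 u z := by
      rw [hm, det2_add_right, det2_smul_right, det2_smul_right, hu]; ring
    have hm1 := (hfar m hmu).1
    have hmb : m - b = ((1 - t) * a) • v + (t * a') • v' := by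
      rw [mul_smul, mul_smul, ← e1, ← e2, hm]; module
    have hinm : inner ℝ v (m - b) = 0 := by
      rw [hmb, inner_add_right, inner_smul_right, inner_smul_right, real_inner_self_eq_norm_sq, nv,
        show inner ℝ v v' = -c by rw [hc]; ring, ht1, ht]
      field_simp; ring
    have hinu : inner ℝ v (unit (m - b)) = 0 := by rw [unit, inner_smul_right, hinm, mul_zero]
    have h2 := hdet z m hz hmW h1 hm1
    have h3 := det2_sq_add_inner_sq v (unit (m - b))
    rw [hinu, nv, norm_unit (hne m hm1)] at h3
    rw [← hv] at h2
    have h4 : |det2 v (unit (m - b))| ^ 2 = 1 := by rw [sq_abs]; linarith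
    nlinarith [abs_nonneg (det2 v (unit (m - b))), hF.δ_pos]
  have hvv : ‖v - v'‖ ≤ 9 * δ := by
    have h2 := det2_sq_add_inner_sq v v'
    rw [nv, nv', ← sq_abs] at h2
    have h3 := norm_sub_sq_real v v'
    rw [nv, nv'] at h3
    have h4 : |det2 v v'| ^ 2 ≤ (6 * δ) ^ 2 := by gcongr
    have h5 : inner ℝ v v' ≤ 1 := by
      nlinarith [sq_nonneg |det2 v v'|]
    refine abs_le_of_sq_le_sq' ?_ (by linarith [hF.δ_pos]) |>.2
    nlinarith
  have hclose : ∀ y, Λ ≤ ‖y‖ → 1 ≤ ‖y - b‖ → ‖unit (y - b) - unit y‖ ≤ κ ^ 2 / 4 := by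
    intro y hy hy1
    have hy0 : 0 < ‖y‖ := hF.Λ_pos.trans_le hy
    refine (norm_unit_sub_unit_le (norm_pos_iff.1 hy0) (sub_ne_zero.1 (hne y hy1))).trans ?_
    rw [div_le_iff₀ hy0]
    nlinarith [hF.mul_le, mul_le_mul_of_nonneg_left hy (sq_nonneg κ)]
  have e1 := hclose z hzΛ h1
  have e2 := hclose z' hzΛ' h1'
  have e3 : unit z - unit z' = -(v - unit z) + (v - v') + (v' - unit z') := by abel
  rw [e3]
  refine (norm_add₃_le).trans ?_
  rw [norm_neg]
  linarith

lemma exists_inner_nonpos (hF : Fine E ρ κ δ Λ D θ) {Z : Set Pt}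
    (hZ : convexHull ℝ Eᶜ ⊆ convexHull ℝ Z) (u : Pt) : ∃ z ∈ Z, inner ℝ u z ≤ 0 := by
  by_contra! h
  have h0 : (0 : Pt) ∈ convexHull ℝ Z :=
    hZ (interior_subset (hF.ball_subset (Metric.mem_ball_self hF.Λ_pos)))
  have hc : Convex ℝ {y : Pt | 0 < inner ℝ u y} :=
    convex_halfSpace_gt (f := fun y : Pt => inner ℝ u y) ((innerSL ℝ u).isBoundedLinearMap.toIsLinearMap) 0
  have h1 : (0 : ℝ) < inner ℝ u (0 : Pt) := convexHull_min (fun z hz => h z hz) hc h0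
  rw [inner_zero_right] at h1
  exact lt_irrefl _ h1

end Fine

lemma exists_smul_of_det2_eq_zero {u v : Pt} (hu : u ≠ 0) (h : det2 u v = 0) :
    ∃ t : ℝ, v = t • u := by
  have hr : det2 u (rot u) ≠ 0 := by
    rw [det2_rot]; exact pow_ne_zero 2 (norm_ne_zero_iff.2 hu)
  have := exists_coords_of_det2_ne_zero hr v
  rw [h, zero_div, zero_smul, add_zero] at this
  exact ⟨_, this⟩

/-- Among three distinct collinear points one lies between the other two. -/
lemma mem_openSegment_of_det2_eq_zero {a b c : Pt} (hab : a ≠ b) (hac : a ≠ c) (hbc : b ≠ c)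
    (h : det2 (b - a) (c - a) = 0) :
    c ∈ openSegment ℝ a b ∨ b ∈ openSegment ℝ a c ∨ a ∈ openSegment ℝ b c := by
  obtain ⟨t, ht⟩ := exists_smul_of_det2_eq_zero (sub_ne_zero.2 hab.symm) h
  have hc : c = a + t • (b - a) := by rw [← ht]; abel
  have h0 : t ≠ 0 := fun h => hac (by rw [hc, h]; simp)
  have h1 : t ≠ 1 := fun h => hbc (by rw [hc, h]; simp)
  rcases lt_or_gt_of_ne h0 with h0 | h0
  · right; right
    refine ⟨-t / (1 - t), 1 / (1 - t), div_pos (by linarith) (by linarith),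
      div_pos one_pos (by linarith), ?_, ?_⟩
    · have : 1 - t ≠ 0 := by linarith
      field_simp; ring
    · have e : (1 - t)⁻¹ * (1 - t) = 1 := inv_mul_cancel₀ (by linarith)
      rw [hc]
      have : (-t / (1 - t)) • b + (1 / (1 - t)) • (a + t • (b - a)) =
          ((1 - t)⁻¹ * (1 - t)) • a := by
        simp only [div_eq_mul_inv]; module
      rw [this, e, one_smul]
  rcases lt_or_gt_of_ne h1 with h1 | h1
  · left
    exact ⟨1 - t, t, by linarith, h0, by ring, by rw [hc]; module⟩
  · right; left
    refine ⟨1 - t⁻¹, t⁻¹, by linarith [inv_lt_one_of_one_lt₀ h1], by positivity, by ring, ?_⟩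
    have e : t⁻¹ * t = 1 := inv_mul_cancel₀ h0.ne'
    rw [hc]
    have : (1 - t⁻¹) • a + t⁻¹ • (a + t • (b - a)) = a + (t⁻¹ * t) • (b - a) := by module
    rw [this, e]; module

/-- A gap whose piece contains a point near the origin. -/
structure SeenGap (E U Z : Set Pt) (ρ : ℝ) (W : Set Pt) (z z' : Pt) : Prop where
  comp : IsComp U W
  gap : Pieces.Gap E Z W z z'
  seen : ∃ b ∈ W, ‖b‖ ≤ ρ

namespace SeenGap

variable {E C U Z W W' : Set Pt} {ρ κ δ Λ D θ : ℝ} {z z' y y' : Pt}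

lemma symm (h : SeenGap E U Z ρ W z z') : SeenGap E U Z ρ W z' z := ⟨h.comp, h.gap.symm, h.seen⟩

lemma left_mem (h : SeenGap E U Z ρ W z z') : z ∈ Z := h.gap.edge.left

lemma right_mem (h : SeenGap E U Z ρ W z z') : z' ∈ Z := h.gap.edge.right

lemma ne (h : SeenGap E U Z ρ W z z') : z ≠ z' := h.gap.edge.ne

lemma dist_le (h : SeenGap E U Z ρ W z z') (hF : Fine E ρ κ δ Λ D θ) (hP : Pieces E C U Z) :
    dist (unit z) (unit z') ≤ κ ^ 2 := by
  obtain ⟨b, hb, hbρ⟩ := h.seen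
  rw [dist_eq_norm]
  exact hF.norm_unit_sub_le (hP.chunk h.comp) h.gap hb hbρ h.gap.left_mem h.gap.right_mem

lemma ne_right (hP : Pieces E C U Z) (h : SeenGap E U Z ρ W z z')
    (h' : SeenGap E U Z ρ W' z y') (hne : W ≠ W') : z' ≠ y' := by
  rintro rfl
  exact hne (h.gap.eq_of_eq hP h.comp h'.comp h'.gap)

lemma exists_common (hP : Pieces E C U Z) (h : SeenGap E U Z ρ W z z')
    (h' : SeenGap E U Z ρ W' y y') (hne : W ≠ W') :
    (∃ p q s, SeenGap E U Z ρ W p q ∧ SeenGap E U Z ρ W' p s ∧ q ≠ s) ∨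
      (z ≠ y ∧ z ≠ y' ∧ z' ≠ y ∧ z' ≠ y') := by
  by_cases h1 : z = y
  · subst h1; exact Or.inl ⟨_, _, _, h, h', h.ne_right hP h' hne⟩
  by_cases h2 : z = y'
  · subst h2; exact Or.inl ⟨_, _, _, h, h'.symm, h.ne_right hP h'.symm hne⟩
  by_cases h3 : z' = y
  · subst h3; exact Or.inl ⟨_, _, _, h.symm, h', h.symm.ne_right hP h' hne⟩
  by_cases h4 : z' = y'
  · subst h4; exact Or.inl ⟨_, _, _, h.symm, h'.symm, h.symm.ne_right hP h'.symm hne⟩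
  exact Or.inr ⟨h1, h2, h3, h4⟩

end SeenGap

lemma eq_or_of_ncard_le_three {Z : Set Pt} (hfin : Z.Finite) (hZ : Z.ncard ≤ 3) {p q s z : Pt}
    (hp : p ∈ Z) (hq : q ∈ Z) (hs : s ∈ Z) (hpq : p ≠ q) (hps : p ≠ s) (hqs : q ≠ s)
    (hz : z ∈ Z) : z = p ∨ z = q ∨ z = s := by
  have h3 : ({p, q, s} : Set Pt).ncard = 3 := Set.ncard_eq_three.2 ⟨p, q, s, hpq, hps, hqs, rfl⟩
  have := Set.eq_of_subset_of_ncard_le (s := {p, q, s}) (t := Z)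
    (by rintro x (rfl | rfl | rfl) <;> assumption) (by rw [h3]; exact hZ) hfin
  rw [← this] at hz
  simpa using hz

lemma eq_or_of_ncard_le_four {Z : Set Pt} (hfin : Z.Finite) (hZ : Z.ncard ≤ 4) {p q s t z : Pt}
    (hp : p ∈ Z) (hq : q ∈ Z) (hs : s ∈ Z) (ht : t ∈ Z) (hpq : p ≠ q) (hps : p ≠ s) (hpt : p ≠ t)
    (hqs : q ≠ s) (hqt : q ≠ t) (hst : s ≠ t) (hz : z ∈ Z) : z = p ∨ z = q ∨ z = s ∨ z = t := by
  have h3 : ({q, s, t} : Set Pt).ncard = 3 := Set.ncard_eq_three.2 ⟨q, s, t, hqs, hqt, hst, rfl⟩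
  have h4 : ({p, q, s, t} : Set Pt).ncard = 4 := by
    rw [Set.ncard_insert_of_notMem (by simp [hpq, hps, hpt]), h3]
  have := Set.eq_of_subset_of_ncard_le (s := {p, q, s, t}) (t := Z)
    (by rintro x (rfl | rfl | rfl | rfl) <;> assumption) (by rw [h4]; exact hZ) hfin
  rw [← this] at hz
  simpa using hz

namespace Fine

variable {E C U Z : Set Pt} {ρ κ δ Λ D θ : ℝ}

lemma sq_le_quarter (hF : Fine E ρ κ δ Λ D θ) : κ ^ 2 ≤ 1 / 4 := by
  nlinarith [hF.κ_le, hF.κ_pos]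

lemma le_norm_of_mem (hF : Fine E ρ κ δ Λ D θ) (hP : Pieces E C U Z) {z : Pt} (hz : z ∈ Z) :
    Λ ≤ ‖z‖ := hF.le_norm (hP.notMem_interior z hz)

lemma ne_zero_of_mem (hF : Fine E ρ κ δ Λ D θ) (hP : Pieces E C U Z) {z : Pt} (hz : z ∈ Z) :
    z ≠ 0 := norm_pos_iff.1 (hF.Λ_pos.trans_le (hF.le_norm_of_mem hP hz))

lemma exists_inner_unit_nonpos (hF : Fine E ρ κ δ Λ D θ) (hP : Pieces E C U Z) (u : Pt) :
    ∃ z ∈ Z, inner ℝ u (unit z) ≤ 0 := by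
  obtain ⟨z, hz, h⟩ := hF.exists_inner_nonpos hP.hull_subset u
  refine ⟨z, hz, ?_⟩
  rw [unit, inner_smul_right]
  exact mul_nonpos_of_nonneg_of_nonpos (by positivity) h

lemma inner_unit_pos {p z : Pt} (hp : p ≠ 0) (hz : z ≠ 0) (h : dist (unit z) (unit p) ≤ 1) :
    0 < inner ℝ (unit p) (unit z) := by
  have h3 := norm_sub_sq_real (unit z) (unit p)
  rw [norm_unit hp, norm_unit hz, ← dist_eq_norm, real_inner_comm] at h3
  nlinarith [dist_nonneg (x := unit z) (y := unit p)]

/-- The directions of the extreme points are not all close to each other. -/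
lemma not_star (hF : Fine E ρ κ δ Λ D θ) (hP : Pieces E C U Z) {p : Pt} (hp : p ∈ Z)
    (h : ∀ z ∈ Z, dist (unit z) (unit p) ≤ 1) : False := by
  obtain ⟨z, hz, hle⟩ := hF.exists_inner_unit_nonpos hP (unit p)
  have := inner_unit_pos (hF.ne_zero_of_mem hP hp) (hF.ne_zero_of_mem hP hz) (h z hz)
  linarith

/-- With three extreme points only one gap can be seen. -/
lemma false_of_two_gaps (hF : Fine E ρ κ δ Λ D θ) (hP : Pieces E C U Z) (hZ : Z.ncard ≤ 3)
    {W W' : Set Pt} {z z' y y' : Pt} (h : SeenGap E U Z ρ W z z') (h' : SeenGap E U Z ρ W' y y')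
    (hne : W ≠ W') : False := by
  have hκ := hF.sq_le_quarter
  rcases h.exists_common hP h' hne with ⟨p, q, s, h1, h2, hqs⟩ | ⟨a1, a2, a3, a4⟩
  · have d1 := h1.dist_le hF hP
    have d2 := h2.dist_le hF hP
    refine hF.not_star hP h1.left_mem fun z hz => ?_
    rcases eq_or_of_ncard_le_three hP.finite hZ h1.left_mem h1.right_mem h2.right_mem h1.ne h2.ne
      hqs hz with rfl | rfl | rfl
    · simp
    · rw [dist_comm]; linarith
    · rw [dist_comm]; linarith
  · rcases eq_or_of_ncard_le_three hP.finite hZ h.left_mem h.right_mem h'.left_mem h.ne a1 a3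
      h'.right_mem with e | e | e
    · exact a2 e.symm
    · exact a4 e.symm
    · exact h'.ne e.symm

/-- Two gaps cannot see two pairs of points each. -/
lemma false_of_two_pairs (hF : Fine E ρ κ δ Λ D θ) (hP : Pieces E C U Z) (hZ : Z.ncard ≤ 4)
    {W W' : Set Pt} {z z' y y' : Pt} (h : SeenGap E U Z ρ W z z') (h' : SeenGap E U Z ρ W' y y')
    (hne : W ≠ W') {a b c d : Pt} (ha : a ∈ W) (hb : b ∈ W) (hc : c ∈ W') (hd : d ∈ W')
    (haρ : ‖a‖ ≤ ρ) (hbρ : ‖b‖ ≤ ρ) (hcρ : ‖c‖ ≤ ρ) (hdρ : ‖d‖ ≤ ρ)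
    (hD : D ≤ |det2 (b - a) (d - c)|) : False := by
  have hκ := hF.sq_le_quarter
  have hκ0 := hF.κ_pos
  have hβ : ‖b - a‖ ≤ 2 * ρ := (norm_sub_le _ _).trans (by linarith)
  have hβ' : ‖d - c‖ ≤ 2 * ρ := (norm_sub_le _ _).trans (by linarith)
  have N : ∀ p ∈ closure W, ∀ q ∈ closure W', p ∈ Z → q ∈ Z →
      4 * κ < |det2 (unit p) (unit q)| := by
    intro p hp q hq hpZ hqZ
    refine lt_abs_det2_of_nearly_parallel (norm_unit (hF.ne_zero_of_mem hP hpZ))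
      (norm_unit (hF.ne_zero_of_mem hP hqZ))
      (hF.abs_det2_unit_le (hP.chunk h.comp) (subset_closure ha) (subset_closure hb) hp haρ hbρ
        (hF.le_norm_of_mem hP hpZ))
      (hF.abs_det2_unit_le (hP.chunk h'.comp) (subset_closure hc) (subset_closure hd) hq hcρ hdρ
        (hF.le_norm_of_mem hP hqZ)) hβ hβ' hD (by linarith [hF.κ_le]) ?_
    have := hF.slim
    nlinarith
  rcases h.exists_common hP h' hne with ⟨p, q, s, h1, h2, hqs⟩ | ⟨a1, a2, a3, a4⟩
  · have := N p h1.gap.left_mem p h2.gap.left_mem h1.left_mem h1.left_mem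
    rw [det2_self, abs_zero] at this
    linarith
  · have hN := N z h.gap.left_mem y h'.gap.left_mem h.left_mem h'.left_mem
    have d1 := h.dist_le hF hP
    have d2 := h'.dist_le hF hP
    have n1 := norm_unit (hF.ne_zero_of_mem hP h.left_mem)
    have n2 := norm_unit (hF.ne_zero_of_mem hP h'.left_mem)
    set u := unit z
    set v := unit y
    have nuv : ‖u + v‖ ≤ 2 := (norm_add_le _ _).trans (by linarith)
    have e1 : inner ℝ (u + v) u = 1 + inner ℝ u v := by
      rw [inner_add_left, real_inner_self_eq_norm_sq, n1, real_inner_comm]; ring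
    have e2 : inner ℝ (u + v) v = 1 + inner ℝ u v := by
      rw [inner_add_left, real_inner_self_eq_norm_sq, n2]; ring
    have close : ∀ w w' : Pt, dist w w' ≤ κ ^ 2 →
        inner ℝ (u + v) w ≤ inner ℝ (u + v) w' + 2 * κ ^ 2 := by
      intro w w' hw
      have := real_inner_le_norm (u + v) (w - w')
      rw [inner_sub_right, ← dist_eq_norm] at this
      have : ‖u + v‖ * dist w w' ≤ 2 * κ ^ 2 := by gcongr
      linarith
    have hle : 1 + inner ℝ u v ≤ 2 * κ ^ 2 := by
      obtain ⟨w, hw, hle⟩ := hF.exists_inner_unit_nonpos hP (u + v)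
      rcases eq_or_of_ncard_le_four hP.finite hZ h.left_mem h.right_mem h'.left_mem h'.right_mem
        h.ne a1 a2 a3 a4 h'.ne hw with rfl | rfl | rfl | rfl
      · nlinarith
      · have := close u _ d1
        linarith
      · nlinarith
      · have := close v _ d2
        linarith
    have h1 := det2_sq_add_inner_sq u v
    rw [n1, n2] at h1
    have h2 : -1 ≤ inner ℝ u v := by
      have := abs_real_inner_le_norm u v
      rw [n1, n2, abs_le] at this
      linarith
    have h3 : |det2 u v| ^ 2 ≤ (2 * κ) ^ 2 := by
      rw [sq_abs]
      nlinarith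
    have := abs_le_of_sq_le_sq' h3 (by positivity)
    linarith

end Fine

lemma IsEdge.det2_ne_zero {Q Z : Set Pt} {a b c : Pt} (h : IsEdge Q Z a b)
    (h0 : (0 : Pt) ∈ interior Q) (hc : c ∈ Q) :
    det2 a b ≠ 0 ∧ 0 ≤ det2 (b - a) (c - a) * det2 a b := by
  obtain ⟨u, hu, h1, h2⟩ := h.support
  have hpos := det2_lt_of_mem_interior hu h2 h0
  rw [det2_zero_right] at hpos
  obtain ⟨k, rfl⟩ := exists_smul_of_det2_eq_zero (sub_ne_zero.2 h.ne.symm)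
    (show det2 (b - a) u = 0 by rw [det2_swap, det2_sub_right, h1, sub_self, neg_zero])
  have h3 := h2 c hc
  have e : det2 (b - a) a = -det2 a b := by rw [det2_sub_left, det2_self, det2_swap]; ring
  rw [det2_smul_left, det2_smul_left] at h3
  rw [det2_smul_left, e] at hpos
  refine ⟨fun h => by rw [h] at hpos; simp at hpos, ?_⟩
  rw [e] at h3
  rw [det2_sub_right, e]
  have hk : 0 < k ^ 2 := by
    have : k ≠ 0 := fun h => by rw [h] at hpos; simp at hpos
    positivity
  have h4 : 0 ≤ k ^ 2 * ((det2 (b - a) c - -det2 a b) * det2 a b) := by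
    nlinarith [mul_nonneg (sub_nonneg.2 h3) hpos.le]
  exact nonneg_of_mul_nonneg_right h4 hk

namespace Fine

variable {E C U Z : Set Pt} {ρ κ δ Λ D θ : ℝ}

/-- Three edges forming a triangle are not all short when seen from the origin. -/
lemma false_of_triangle (hF : Fine E ρ κ δ Λ D θ) (hP : Pieces E C U Z) {a b c : Pt}
    (hab : IsEdge (convexHull ℝ Eᶜ) Z a b) (hbc : IsEdge (convexHull ℝ Eᶜ) Z b c)
    (hca : IsEdge (convexHull ℝ Eᶜ) Z c a) (db : dist (unit b) (unit a) ≤ 1)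
    (dc : dist (unit c) (unit a) ≤ 1) : False := by
  have h0 := hF.ball_subset (Metric.mem_ball_self hF.Λ_pos)
  have ha := hab.left
  have hb := hbc.left
  have hc := hca.left
  obtain ⟨n1, p1⟩ := hab.det2_ne_zero h0 (hP.subset_hull hc)
  obtain ⟨n2, p2⟩ := hbc.det2_ne_zero h0 (hP.subset_hull ha)
  obtain ⟨n3, p3⟩ := hca.det2_ne_zero h0 (hP.subset_hull hb)
  have e2 : det2 (c - b) (a - b) = det2 (b - a) (c - a) := by simp only [det2, PiLp.sub_apply]; ring
  have e3 : det2 (a - c) (b - c) = det2 (b - a) (c - a) := by simp only [det2, PiLp.sub_apply]; ring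
  rw [e2] at p2
  rw [e3] at p3
  have hT : det2 (b - a) (c - a) ≠ 0 := by
    intro h
    rcases mem_openSegment_of_det2_eq_zero hab.ne hca.ne.symm hbc.ne h with h | h | h
    · exact hab.inside _ h hc
    · exact hca.symm.inside _ h hb
    · exact hbc.inside _ h ha
  set T := det2 (b - a) (c - a)
  have q1 := lt_of_le_of_ne p1 (mul_ne_zero hT n1).symm
  have q2 := lt_of_le_of_ne p2 (mul_ne_zero hT n2).symm
  have q3 := lt_of_le_of_ne p3 (mul_ne_zero hT n3).symm
  have hz : ∀ z ∈ Z, dist (unit z) (unit a) ≤ 1 → 0 < inner ℝ (unit a) z := by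
    intro z hz h
    have := inner_unit_pos (hF.ne_zero_of_mem hP ha) (hF.ne_zero_of_mem hP hz) h
    rw [← norm_smul_unit z, inner_smul_right]
    exact mul_pos (norm_pos_iff.2 (hF.ne_zero_of_mem hP hz)) this
  have i1 := hz a ha (by simp)
  have i2 := hz b hb db
  have i3 := hz c hc dc
  have key : det2 b c * inner ℝ (unit a) a + det2 c a * inner ℝ (unit a) b +
      det2 a b * inner ℝ (unit a) c = 0 := by
    simp only [inner_eq_coord, det2]; ring
  have : T * det2 b c * inner ℝ (unit a) a + T * det2 c a * inner ℝ (unit a) b +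
      T * det2 a b * inner ℝ (unit a) c = 0 := by linear_combination T * key
  have r1 := mul_pos q2 i1
  have r2 := mul_pos q3 i2
  have r3 := mul_pos q1 i3
  linarith

lemma false_of_disjoint_gaps (hF : Fine E ρ κ δ Λ D θ) (hP : Pieces E C U Z) (hZ : Z.ncard ≤ 4)
    {W₁ W₂ W₃ : Set Pt} {z z' y y' x x' : Pt} (h₁ : SeenGap E U Z ρ W₁ z z')
    (h₂ : SeenGap E U Z ρ W₂ y y') (h₃ : SeenGap E U Z ρ W₃ x x') (h13 : W₁ ≠ W₃) (h23 : W₂ ≠ W₃)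
    (hzy : z ≠ y) (hzy' : z ≠ y') (hz'y : z' ≠ y) (hz'y' : z' ≠ y') : False := by
  have hκ := hF.sq_le_quarter
  have hκ0 := sq_nonneg κ
  have cover : ∀ w ∈ Z, w = z ∨ w = z' ∨ w = y ∨ w = y' := fun w hw =>
    eq_or_of_ncard_le_four hP.finite hZ h₁.left_mem h₁.right_mem h₂.left_mem h₂.right_mem
      h₁.ne hzy hzy' hz'y hz'y' h₂.ne hw
  have d1 := h₁.dist_le hF hP
  have d2 := h₂.dist_le hF hP
  have d1' := h₁.symm.dist_le hF hP
  have d2' := h₂.symm.dist_le hF hP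
  have main : ∀ x x', SeenGap E U Z ρ W₃ x x' → (x = z ∨ x = z') → (x' = y ∨ x' = y') → False := by
    intro x x' h hx hx'
    have d3 := h.symm.dist_le hF hP
    refine hF.not_star hP h.left_mem fun w hw => ?_
    have c1 : ∀ w, (w = z ∨ w = z') → dist (unit w) (unit x) ≤ 1 := by
      rintro w hw
      rcases hw with rfl | rfl <;> rcases hx with rfl | rfl <;> first | linarith | simp
    have c2 : ∀ w, (w = y ∨ w = y') → dist (unit w) (unit x') ≤ κ ^ 2 := by
      rintro w hw
      rcases hw with rfl | rfl <;> rcases hx' with rfl | rfl <;>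
        first | (simpa using hκ0) | assumption
    rcases cover w hw with h | h | h | h
    · exact c1 w (Or.inl h)
    · exact c1 w (Or.inr h)
    · linarith [dist_triangle (unit w) (unit x') (unit x), c2 w (Or.inl h)]
    · linarith [dist_triangle (unit w) (unit x') (unit x), c2 w (Or.inr h)]
  have hn : ∀ {W : Set Pt} {z z' : Pt}, SeenGap E U Z ρ W z z' → W ≠ W₃ →
      (x = z ∨ x = z') → (x' = z ∨ x' = z') → False := by
    rintro W z z' h hne (rfl | rfl) (rfl | rfl)
    · exact h₃.ne rfl
    · exact h.ne_right hP h₃ hne rfl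
    · exact h.symm.ne_right hP h₃ hne rfl
    · exact h₃.ne rfl
  have hx : (x = z ∨ x = z') ∨ (x = y ∨ x = y') := by
    rw [or_assoc]; exact cover x h₃.left_mem
  have hx' : (x' = z ∨ x' = z') ∨ (x' = y ∨ x' = y') := by
    rw [or_assoc]; exact cover x' h₃.right_mem
  rcases hx with hx | hx <;> rcases hx' with hx' | hx'
  · exact hn h₁ h13 hx hx'
  · exact main _ _ h₃ hx hx'
  · exact main _ _ h₃.symm hx' hx
  · exact (hn h₂ h23 hx hx').elim

/-- At most two gaps can be seen. -/
lemma false_of_three_gaps (hF : Fine E ρ κ δ Λ D θ) (hP : Pieces E C U Z) (hZ : Z.ncard ≤ 4)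
    {W₁ W₂ W₃ : Set Pt} {z z' y y' x x' : Pt} (h₁ : SeenGap E U Z ρ W₁ z z')
    (h₂ : SeenGap E U Z ρ W₂ y y') (h₃ : SeenGap E U Z ρ W₃ x x') (h12 : W₁ ≠ W₂) (h13 : W₁ ≠ W₃)
    (h23 : W₂ ≠ W₃) : False := by
  have hκ := hF.sq_le_quarter
  rcases h₁.exists_common hP h₂ h12 with ⟨p, q, s, g1, g2, hqs⟩ | ⟨a1, a2, a3, a4⟩
  swap
  · exact hF.false_of_disjoint_gaps hP hZ h₁ h₂ h₃ h13 h23 a1 a2 a3 a4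
  have d1 := g1.symm.dist_le hF hP
  have d2 := g2.symm.dist_le hF hP
  have star : ∀ t, SeenGap E U Z ρ W₃ p t → False := by
    intro t g3
    have d3 := g3.symm.dist_le hF hP
    refine hF.not_star hP g1.left_mem fun w hw => ?_
    rcases eq_or_of_ncard_le_four hP.finite hZ g1.left_mem g1.right_mem g2.right_mem g3.right_mem
      g1.ne g2.ne g3.ne hqs (g1.ne_right hP g3 h13) (g2.ne_right hP g3 h23) hw with
      rfl | rfl | rfl | rfl
    · simp
    all_goals linarith
  have tri : SeenGap E U Z ρ W₃ q s → False := fun g3 =>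
    hF.false_of_triangle hP g1.gap.edge g3.gap.edge g2.gap.edge.symm (by linarith) (by linarith)
  by_cases e1 : x = p
  · exact star _ (e1 ▸ h₃)
  by_cases e2 : x' = p
  · exact star _ (e2 ▸ h₃).symm
  by_cases e3 : q = x
  · by_cases e4 : s = x'
    · exact tri (e3 ▸ e4 ▸ h₃)
    · exact hF.false_of_disjoint_gaps hP hZ g2 h₃ g1 h12.symm h13.symm (Ne.symm e1) (Ne.symm e2)
        (fun h => hqs (e3.trans h.symm)) e4
  · by_cases e4 : q = x'
    · by_cases e5 : s = x
      · exact tri (e4 ▸ e5 ▸ h₃.symm)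
      · exact hF.false_of_disjoint_gaps hP hZ g2 h₃ g1 h12.symm h13.symm (Ne.symm e1) (Ne.symm e2)
          e5 (fun h => hqs (e4.trans h.symm))
    · exact hF.false_of_disjoint_gaps hP hZ g1 h₃ g2 h12 h23.symm (Ne.symm e1) (Ne.symm e2) e3 e4

end Fine

lemma Chunk.det2_lt_of_support {E W : Set Pt} (hW : Chunk E W) {u y : Pt} {r : ℝ} (hr : 0 < r)
    (hu : ∀ x ∈ E ∩ Metric.ball y r, det2 u y < det2 u x) (hy : y ∈ closure W) {x : Pt}
    (hx : x ∈ W) : det2 u y < det2 u x := by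
  have hcont : Continuous fun t : ℝ => y + t • (x - y) := by fun_prop
  have hnhds : Metric.ball y r ∈ nhds (y + (0 : ℝ) • (x - y)) := by
    rw [zero_smul, add_zero]; exact Metric.ball_mem_nhds y hr
  have h0 : ∀ᶠ t : ℝ in nhdsWithin 0 (Set.Ioi 0), y + t • (x - y) ∈ Metric.ball y r :=
    ((hcont.tendsto 0).mono_left nhdsWithin_le_nhds) hnhds
  have h1 : ∀ᶠ t : ℝ in nhdsWithin 0 (Set.Ioi 0), 0 < t := self_mem_nhdsWithin
  have h2 : ∀ᶠ t : ℝ in nhdsWithin 0 (Set.Ioi 0), t < 1 :=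
    (eventually_lt_nhds one_pos).filter_mono nhdsWithin_le_nhds
  obtain ⟨t, ht, ht0, ht1⟩ := (h0.and (h1.and h2)).exists
  have hmem : y + t • (x - y) ∈ W := by
    have := hW.convex.openSegment_interior_closure_subset_interior
      (by rwa [hW.isOpen.interior_eq]) hy
    rw [hW.isOpen.interior_eq] at this
    exact this ⟨t, 1 - t, ht0, by linarith, by ring, by module⟩
  have := hu _ ⟨hW.subset hmem, ht⟩
  rw [det2_add_right, det2_smul_right, det2_sub_right] at this
  nlinarith

lemma Chunk.det2_le_of_support {E W : Set Pt} (hW : Chunk E W) {u y : Pt} {r : ℝ} (hr : 0 < r)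
    (hu : ∀ x ∈ E ∩ Metric.ball y r, det2 u y < det2 u x) (hy : y ∈ closure W) {x : Pt}
    (hx : x ∈ closure W) : det2 u y ≤ det2 u x :=
  closure_minimal (t := {x | det2 u y ≤ det2 u x})
    (fun _ hx => (hW.det2_lt_of_support hr hu hy hx).le)
    (isClosed_le (by fun_prop) (by fun_prop)) hx

namespace Fine

variable {E C U Z : Set Pt} {ρ κ δ Λ D θ : ℝ}

/-- Two pieces touching at a residual point cannot contain two pairs of points such that one of
the four points is well inside the triangle spanned by the others. -/
lemma false_of_touching (hF : Fine E ρ κ δ Λ D θ) (hθ : 0 < θ) {W W' : Set Pt}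
    (hW : Chunk E W) (hW' : Chunk E W') (hdisj : Disjoint W W') {y : Pt}
    (hsup : ∃ u, ∃ r > (0 : ℝ), ∀ x ∈ E ∩ Metric.ball y r, det2 u y < det2 u x)
    (hy : y ∈ closure W) (hy' : y ∈ closure W') {a b c d : Pt} (ha : a ∈ W) (hb : b ∈ W)
    (hc : c ∈ W') (hd : d ∈ W') (haρ : ‖a‖ ≤ ρ) (hbρ : ‖b‖ ≤ ρ) (hcρ : ‖c‖ ≤ ρ) (hdρ : ‖d‖ ≤ ρ)
    (hD : D ≤ |det2 (b - a) (d - c)|) (hT : D ≤ |det2 (c - a) (d - a)|)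
    (hbary : ∃ α β γ : ℝ, θ ≤ α ∧ θ ≤ β ∧ θ ≤ γ ∧ α + β + γ = 1 ∧ b = α • a + β • c + γ • d) :
    False := by
  obtain ⟨α, β, γ, hα, hβ, hγ, hsum, hbeq⟩ := hbary
  obtain ⟨u, r, hr, hu⟩ := hsup
  have hρ := hF.one_le
  have hδ := hF.δ_pos
  rcases le_total Λ ‖y‖ with hyΛ | hyΛ
  · have hy0 : y ≠ 0 := norm_pos_iff.1 (hF.Λ_pos.trans_le hyΛ)
    have h1 := hF.abs_det2_unit_le hW (subset_closure ha) (subset_closure hb) hy haρ hbρ hyΛ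
    have h2 := hF.abs_det2_unit_le hW' (subset_closure hc) (subset_closure hd) hy' hcρ hdρ hyΛ
    have := lt_abs_det2_of_nearly_parallel (norm_unit hy0) (norm_unit hy0) h1 h2
      (M := 2 * ρ) ((norm_sub_le _ _).trans (by linarith)) ((norm_sub_le _ _).trans (by linarith)) hD
      (by linarith [hF.κ_le]) (by have := hF.slim; nlinarith)
    rw [det2_self, abs_zero] at this
    linarith [hF.κ_pos]
  · obtain ⟨f, m, hf1, hf2⟩ := geometric_hahn_banach_open_open hW.convex hW.isOpen hW'.convex
      hW'.isOpen hdisj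
    obtain ⟨v, hv⟩ := exists_det2_eq_clm f
    simp only [hv] at hf1 hf2
    have hvy : det2 v y = m := le_antisymm
      (closure_minimal (t := {x | det2 v x ≤ m}) (fun x hx => (hf1 x hx).le)
        (isClosed_le (by fun_prop) (by fun_prop)) hy)
      (closure_minimal (t := {x | m ≤ det2 v x}) (fun x hx => (hf2 x hx).le)
        (isClosed_le (by fun_prop) (by fun_prop)) hy')
    have Ga := hW.det2_lt_of_support hr hu hy ha
    have Gc := hW'.det2_lt_of_support hr hu hy' hc
    have Gd := hW'.det2_lt_of_support hr hu hy' hd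
    have Sa := hf1 a ha
    have Sc := hf2 c hc
    have Sd := hf2 d hd
    have ident : ∀ p q : Pt, det2 u v * det2 (p - y) (q - y) =
        (det2 u p - det2 u y) * (det2 v q - m) - (det2 u q - det2 u y) * (det2 v p - m) := by
      intro p q
      rw [← hvy]
      simp only [det2, PiLp.sub_apply]; ring
    have p1 : 0 < det2 u v * det2 (a - y) (c - y) := by
      rw [ident]; nlinarith [mul_pos (sub_pos.2 Ga) (sub_pos.2 Sc), mul_pos (sub_pos.2 Gc) (sub_pos.2 Sa)]
    have p2 : 0 < det2 u v * det2 (a - y) (d - y) := by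
      rw [ident]; nlinarith [mul_pos (sub_pos.2 Ga) (sub_pos.2 Sd), mul_pos (sub_pos.2 Gd) (sub_pos.2 Sa)]
    have e1 : det2 (b - a) (y - a) = β * det2 (a - y) (c - y) + γ * det2 (a - y) (d - y) := by
      have hα' : α = 1 - β - γ := by linarith
      rw [hbeq, hα']
      simp only [det2, PiLp.sub_apply, PiLp.add_apply, PiLp.smul_apply, smul_eq_mul]; ring
    have e2 : det2 (c - a) (d - a) =
        det2 (a - y) (c - y) - det2 (a - y) (d - y) + det2 (d - c) (y - c) := by
      simp only [det2, PiLp.sub_apply]; ring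
    have t1 := hF.abs_det2_le hW (subset_closure ha) (subset_closure hb) hy haρ hbρ
    have t2 := hF.abs_det2_le hW' (subset_closure hc) (subset_closure hd) hy' hcρ hdρ
    have hη : 0 < 6 * δ * (2 * ρ + 1) := by positivity
    have t3 : ∀ x : Pt, ‖x‖ ≤ ρ → 6 * δ * (2 * ρ + 1) * (1 + ‖y - x‖) ≤
        6 * δ * (2 * ρ + 1) * (1 + Λ + ρ) := by
      intro x hx
      refine mul_le_mul_of_nonneg_left ?_ hη.le
      linarith [norm_sub_le y x]
    replace t1 := t1.trans (t3 a haρ)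
    replace t2 := t2.trans (t3 c hcρ)
    set X := 6 * δ * (2 * ρ + 1) * (1 + Λ + ρ) with hX
    set A := det2 (a - y) (c - y)
    set B := det2 (a - y) (d - y)
    have t4 : θ * (|A| + |B|) ≤ X := by
      rw [e1, abs_le] at t1
      have hAB : 0 < A * B := by
        have := mul_pos p1 p2
        have h2 : 0 < det2 u v ^ 2 * (A * B) := by nlinarith
        exact pos_of_mul_pos_right h2 (sq_nonneg _)
      rcases pos_and_pos_or_neg_and_neg_of_mul_pos hAB with ⟨hA, hB⟩ | ⟨hA, hB⟩
      · rw [abs_of_pos hA, abs_of_pos hB]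
        linarith [t1.2, mul_le_mul_of_nonneg_right hβ hA.le, mul_le_mul_of_nonneg_right hγ hB.le]
      · rw [abs_of_neg hA, abs_of_neg hB]
        linarith [t1.1, mul_le_mul_of_nonpos_right hβ hA.le, mul_le_mul_of_nonpos_right hγ hB.le]
    have t5 : |A| + |B| ≤ X / θ := by rw [le_div_iff₀ hθ]; linarith
    have t6 := hF.slim_bounded
    rw [← hX] at t6
    have t7 : D ≤ |A| + |B| + X := by
      refine hT.trans ?_
      rw [e2]
      exact (abs_add_le _ _).trans (by linarith [abs_sub A B])
    have t8 : X * (2 / θ + 1) = 2 * (X / θ) + X := by ring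
    have t9 : 0 ≤ X / θ := by linarith [abs_nonneg A, abs_nonneg B]
    linarith only [t5, t6, t7, t8, t9]

end Fine

namespace Fine

variable {E C U Z : Set Pt} {ρ κ δ Λ D θ : ℝ}

/-- If `y` is close to the pair `c d` in direction, both endpoints of the gap seen by
another pair lie on the same side of the line through `y` and one of the points `c`, `d`. -/
lemma mul_det2_pos (hF : Fine E ρ κ δ Λ D θ) (hP : Pieces E C U Z) {W W' : Set Pt}
    {p q y : Pt} (hg : SeenGap E U Z ρ W p q) (hW' : Chunk E W')
    (hy' : y ∈ closure W') {a b c d : Pt} (ha : a ∈ W) (hb : b ∈ W)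
    (hc : c ∈ W') (hd : d ∈ W') (haρ : ‖a‖ ≤ ρ) (hbρ : ‖b‖ ≤ ρ) (hcρ : ‖c‖ ≤ ρ) (hdρ : ‖d‖ ≤ ρ)
    (hD0 : 0 < D) (hD : D ≤ |det2 (b - a) (d - c)|) (hfar : D / (4 * ρ) ≤ ‖y - c‖) :
    0 < det2 (y - c) (p - c) * det2 (y - c) (q - c) := by
  have hρ := hF.one_le
  have hδ := hF.δ_pos
  have hκ := hF.κ_le
  have hκ0 := hF.κ_pos
  have hW := hP.chunk hg.comp
  set w := y - c with hw
  have hw0 : 0 < ‖w‖ := lt_of_lt_of_le (by positivity) hfar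
  have hwu : ‖unit w‖ = 1 := norm_unit (norm_pos_iff.1 hw0)
  have h1 : |det2 (d - c) (unit w)| ≤ κ := by
    have t := hF.abs_det2_le hW' (subset_closure hc) (subset_closure hd) hy' hcρ hdρ
    rw [← hw] at t
    refine le_trans ?_ hF.slim_near
    rw [unit, det2_smul_right, abs_mul, abs_of_pos (inv_pos.2 hw0), inv_mul_le_iff₀ hw0]
    refine t.trans ?_
    have : 1 ≤ 4 * ρ / D * ‖w‖ := by
      rw [div_le_iff₀ (by positivity)] at hfar
      rw [div_mul_eq_mul_div, le_div_iff₀ hD0]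
      linarith
    have e : ‖w‖ * (6 * δ * (2 * ρ + 1) * (1 + 4 * ρ / D)) =
        6 * δ * (2 * ρ + 1) * (‖w‖ + 4 * ρ / D * ‖w‖) := by ring
    rw [e]
    refine mul_le_mul_of_nonneg_left ?_ (by positivity)
    linarith
  have N : ∀ z ∈ Z, z ∈ closure W → 4 * κ < |det2 (unit w) (unit z)| := by
    intro z hz hzW
    rw [det2_swap, abs_neg]
    exact lt_abs_det2_of_nearly_parallel (norm_unit (hF.ne_zero_of_mem hP hz)) hwu
      (hF.abs_det2_unit_le hW (subset_closure ha) (subset_closure hb) hzW haρ hbρ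
        (hF.le_norm_of_mem hP hz)) h1 (M := 2 * ρ) ((norm_sub_le _ _).trans (by linarith))
      ((norm_sub_le _ _).trans (by linarith)) hD (by linarith) (by have := hF.slim; nlinarith)
  have near : ∀ z ∈ Z, 0 < ‖z - c‖ ∧
      |det2 (unit w) (unit (z - c)) - det2 (unit w) (unit z)| ≤ κ := by
    intro z hz
    have hzΛ := hF.le_norm_of_mem hP hz
    have hz0 := hF.ne_zero_of_mem hP hz
    have hzc : 0 < ‖z - c‖ := by linarith [norm_sub_norm_le z c, hF.le_Λ]
    refine ⟨hzc, ?_⟩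
    rw [← det2_sub_right]
    refine (_root_.abs_det2_le _ _).trans ?_
    rw [hwu, one_mul]
    refine (norm_unit_sub_unit_le hz0 (sub_ne_zero.1 (norm_pos_iff.1 hzc))).trans ?_
    rw [div_le_iff₀ (norm_pos_iff.2 hz0)]
    have := hF.mul_le
    nlinarith [mul_le_mul_of_nonneg_left hzΛ hκ0.le]
  have hp := hg.left_mem
  have hq := hg.right_mem
  have Np := N p hp hg.gap.left_mem
  have Nq := N q hq hg.gap.right_mem
  obtain ⟨ap, np⟩ := near p hp
  obtain ⟨aq, nq⟩ := near q hq
  have hpq : |det2 (unit w) (unit p) - det2 (unit w) (unit q)| ≤ κ := by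
    rw [← det2_sub_right]
    refine (_root_.abs_det2_le _ _).trans ?_
    rw [hwu, one_mul, ← dist_eq_norm]
    nlinarith [hg.dist_le hF hP]
  have expand : ∀ z : Pt, det2 w (z - c) = ‖w‖ * ‖z - c‖ * det2 (unit w) (unit (z - c)) := by
    intro z
    conv_lhs => rw [← norm_smul_unit w, ← norm_smul_unit (z - c)]
    rw [det2_smul_left, det2_smul_right]; ring
  rw [expand, expand]
  have hpos : 0 < det2 (unit w) (unit (p - c)) * det2 (unit w) (unit (q - c)) := by
    rw [abs_le] at np nq hpq
    rcases lt_abs.1 Np with h | h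
    · exact mul_pos (by linarith) (by linarith)
    · exact mul_pos_of_neg_of_neg (by linarith) (by linarith)
  have e : ‖w‖ * ‖p - c‖ * det2 (unit w) (unit (p - c)) *
      (‖w‖ * ‖q - c‖ * det2 (unit w) (unit (q - c))) =
      ‖w‖ ^ 2 * (‖p - c‖ * ‖q - c‖) *
        (det2 (unit w) (unit (p - c)) * det2 (unit w) (unit (q - c))) := by ring
  rw [e]
  positivity

/-- A residual point joining a gap to a piece that is not a gap cannot be compatible
with another gap when there are only three extreme points. -/
lemma false_of_neighbour (hP : Pieces E C U Z) (hZ : Z.ncard ≤ 3)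
    {W₀ W₁ W₂ : Set Pt} {p q p' s' y c : Pt} (hg₀ : Pieces.Gap E Z W₀ p q)
    (hW₀ : IsComp U W₀) (hg₁ : Pieces.Gap E Z W₁ p' s') (hW₁ : IsComp U W₁) (hne : W₀ ≠ W₁)
    (hW₂ : IsComp U W₂) (hne' : W₁ ≠ W₂) (hyE : y ∉ E)
    (hsup : ∃ u, ∃ r > (0 : ℝ), ∀ x ∈ E ∩ Metric.ball y r, det2 u y < det2 u x)
    (hy₁ : y ∈ closure W₁) (hy₂ : y ∈ closure W₂) (hc : c ∈ W₂)
    (hpos : 0 < det2 (y - c) (p - c) * det2 (y - c) (q - c)) : False := by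
  wlog hcommon : p = p' ∧ q ≠ s' generalizing p q p' s'
  · obtain ⟨x₀, hx₀⟩ := hW₀.nonempty
    obtain ⟨x₁, hx₁⟩ := hW₁.nonempty
    have s₀ : SeenGap E U Z (max ‖x₀‖ ‖x₁‖) W₀ p q := ⟨hW₀, hg₀, x₀, hx₀, le_max_left _ _⟩
    have s₁ : SeenGap E U Z (max ‖x₀‖ ‖x₁‖) W₁ p' s' := ⟨hW₁, hg₁, x₁, hx₁, le_max_right _ _⟩
    have hpos' : 0 < det2 (y - c) (q - c) * det2 (y - c) (p - c) := by rwa [mul_comm]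
    by_cases h1 : p = p'
    · exact this hg₀ hg₁ hpos ⟨h1, by subst h1; exact s₀.ne_right hP s₁ hne⟩
    by_cases h2 : p = s'
    · exact this hg₀ hg₁.symm hpos ⟨h2, by subst h2; exact s₀.ne_right hP s₁.symm hne⟩
    by_cases h3 : q = p'
    · exact this hg₀.symm hg₁ hpos' ⟨h3, by subst h3; exact s₀.symm.ne_right hP s₁ hne⟩
    by_cases h4 : q = s'
    · exact this hg₀.symm hg₁.symm hpos' ⟨h4, by subst h4; exact s₀.symm.ne_right hP s₁.symm hne⟩
    rcases eq_or_of_ncard_le_three hP.finite hZ s₀.left_mem s₀.right_mem s₁.left_mem s₀.ne h1 h3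
      s₁.right_mem with e | e | e
    · exact h2 e.symm
    · exact h4 e.symm
    · exact s₁.ne e.symm
  obtain ⟨rfl, hqs⟩ := hcommon
  have hcI := hP.subset_interior (hW₂.subset hc)
  have hpZ := hg₀.edge.left
  have hsZ := hg₁.edge.right
  have hcover : Z ⊆ {p, q, s'} := fun z hz =>
    eq_or_of_ncard_le_three hP.finite hZ hpZ hg₀.edge.right hsZ hg₀.edge.ne hg₁.edge.ne hqs hz
  have hch := convexHull_mono hcover (hP.hull_subset (interior_subset hcI))
  rw [convexHull_insert ⟨q, by simp⟩, convexHull_pair] at hch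
  obtain ⟨x, hx, hcx⟩ := by simpa using hch
  obtain ⟨a₁, b₁, ha₁, hb₁, hab₁, rfl⟩ := hx
  obtain ⟨a₂, b₂, ha₂, hb₂, hab₂, hceq⟩ := hcx
  set w := y - c with hw
  set A := det2 w (p - c) with hA
  set B := det2 w (q - c) with hB
  set S := det2 w (s' - c) with hS
  have hsum : a₂ * A + b₂ * a₁ * B + b₂ * b₁ * S = 0 := by
    have e : a₂ • (p - c) + (b₂ * a₁) • (q - c) + (b₂ * b₁) • (s' - c) = 0 := by
      have e1 : a₂ • (p - c) + (b₂ * a₁) • (q - c) + (b₂ * b₁) • (s' - c) =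
          (a₂ • p + b₂ • (a₁ • q + b₁ • s')) - (a₂ + b₂ * (a₁ + b₁)) • c := by module
      rw [e1, hceq, hab₁, mul_one, hab₂, one_smul, sub_self]
    have := congrArg (det2 w) e
    simpa only [det2_add_right, det2_smul_right, det2_zero_right] using this
  have hb₂' : b₂ * b₁ ≠ 1 := by
    intro h
    have h1 : b₂ = 1 := by nlinarith
    have h2 : b₁ = 1 := by rw [h1] at h; linarith
    have h3 : a₂ = 0 := by linarith
    have h4 : a₁ = 0 := by linarith
    rw [h1, h2, h3, h4] at hceq
    simp only [zero_smul, one_smul, zero_add] at hceq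
    exact hP.notMem_interior s' hsZ (hceq ▸ hcI)
  have hA0 : A ≠ 0 := fun h => by rw [h, zero_mul] at hpos; exact lt_irrefl _ hpos
  have hAS : A * S < 0 := by
    have e : a₂ * A ^ 2 + b₂ * a₁ * (A * B) + b₂ * b₁ * (A * S) = 0 := by
      linear_combination A * hsum
    have hA2 : 0 < A ^ 2 := by positivity
    by_contra! h
    have t1 := mul_nonneg ha₂ hA2.le
    have t2 := mul_nonneg (mul_nonneg hb₂ ha₁) hpos.le
    have t3 := mul_nonneg (mul_nonneg hb₂ hb₁) h
    have z1 : a₂ = 0 := by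
      rcases mul_eq_zero.1 (le_antisymm (by linarith) t1) with h | h
      · exact h
      · exact absurd h hA2.ne'
    have z2 : b₂ * a₁ = 0 := by
      rcases mul_eq_zero.1 (le_antisymm (by linarith) t2) with h | h
      · exact h
      · exact absurd h hpos.ne'
    apply hb₂'
    have : b₂ * (a₁ + b₁) = 1 := by rw [hab₁]; linarith
    linarith
  have hden : 0 < A ^ 2 - A * S := by nlinarith [sq_nonneg A]
  set t := A ^ 2 / (A ^ 2 - A * S) with ht
  have ht0 : 0 < t := by positivity
  have ht1 : 1 - t = -(A * S) / (A ^ 2 - A * S) := by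
    rw [ht, eq_div_iff hden.ne', sub_mul, div_mul_cancel₀ _ hden.ne']; ring
  have ht1' : 0 < 1 - t := by rw [ht1]; exact div_pos (by linarith) hden
  set z := (1 - t) • p + t • s' with hz
  have hzo : z ∈ openSegment ℝ p s' := ⟨1 - t, t, ht1', ht0, by ring, rfl⟩
  have hzcl := hg₁.subset_closure hzo
  have hw0 : w ≠ 0 := fun h => hA0 (by rw [hA, h, det2_zero_left])
  have hzw : det2 w (z - c) = 0 := by
    have e : z - c = (1 - t) • (p - c) + t • (s' - c) := by rw [hz]; module
    rw [e, det2_add_right, det2_smul_right, det2_smul_right, ← hA, ← hS, ht1, ht]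
    field_simp; ring
  obtain ⟨τ, hτ⟩ := exists_smul_of_det2_eq_zero hw0 hzw
  have hzc : z = c + τ • (y - c) := by rw [← hw, ← hτ]; abel
  have hch₁ := hP.chunk hW₁
  have hch₂ := hP.chunk hW₂
  rcases le_or_gt τ 0 with h0 | h0
  · have hd : 0 < 1 - τ := by linarith
    have : c ∈ closure W₁ := by
      refine hch₁.convex.closure.segment_subset hzcl hy₁ ?_
      refine ⟨(1 - τ)⁻¹, -τ * (1 - τ)⁻¹, by positivity,
        mul_nonneg (by linarith) (by positivity), ?_, ?_⟩
      · field_simp; ring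
      · rw [hzc]
        have e : (1 - τ)⁻¹ • (c + τ • (y - c)) + (-τ * (1 - τ)⁻¹) • y =
            ((1 - τ)⁻¹ * (1 - τ)) • c := by module
        rw [e, inv_mul_cancel₀ hd.ne', one_smul]
    obtain ⟨v, hv₂, hv₁⟩ := mem_closure_iff.1 this W₂ hch₂.isOpen hc
    exact hne' (hW₁.eq_of_inter hW₂ ⟨v, hv₁, hv₂⟩)
  rcases lt_trichotomy τ 1 with h1 | h1 | h1
  · refine hg₁.edge.notMem_interior hzo ?_
    refine (convex_convexHull ℝ Eᶜ).openSegment_interior_closure_subset_interior hcI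
      (subset_closure (subset_convexHull ℝ _ hyE)) ?_
    exact ⟨1 - τ, τ, by linarith, h0, by ring, by rw [hzc]; module⟩
  · refine hyE ?_
    have : z = y := by rw [hzc, h1]; module
    exact this ▸ hg₁.subset hzo
  · obtain ⟨u, r, hr, hu⟩ := hsup
    have k1 := hch₂.det2_lt_of_support hr hu hy₂ hc
    have k2 := hch₁.det2_le_of_support hr hu hy₁ hzcl
    rw [hzc, det2_add_right, det2_smul_right, det2_sub_right] at k2
    nlinarith

end Fine

/-- Four points, the last of which is well inside the triangle spanned by the others, in
quantitative strong general position. -/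
structure Blues (ρ D θ : ℝ) (f : Fin 4 → Pt) : Prop where
  norm_le : ∀ i, ‖f i‖ ≤ ρ
  triangle : ∀ i j k, i ≠ j → i ≠ k → j ≠ k → D ≤ |det2 (f j - f i) (f k - f i)|
  pairs : ∀ i j k l, i ≠ j → i ≠ k → i ≠ l → j ≠ k → j ≠ l → k ≠ l →
    D ≤ |det2 (f j - f i) (f l - f k)|
  bary : ∀ i j k, i ≠ 3 → j ≠ 3 → k ≠ 3 → i ≠ j → i ≠ k → j ≠ k →
    ∃ α β γ : ℝ, θ ≤ α ∧ θ ≤ β ∧ θ ≤ γ ∧ α + β + γ = 1 ∧ f 3 = α • f i + β • f j + γ • f k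

/-- A colouring of four elements with two colours, each used at most twice, uses both twice. -/
lemma exists_two_two {α : Type*} (g : Fin 4 → α)
    (h3 : ∀ i j k, i ≠ j → i ≠ k → j ≠ k → ¬ (g i = g j ∧ g j = g k))
    (hd : ∀ i j k, g i ≠ g j → g i ≠ g k → g j ≠ g k → False) :
    ∃ i j k, i ≠ 3 ∧ j ≠ 3 ∧ k ≠ 3 ∧ i ≠ j ∧ i ≠ k ∧ j ≠ k ∧ g i = g 3 ∧ g j = g k ∧ g i ≠ g j := by
  by_cases h0 : g 0 = g 3
  · have h1 : g 1 ≠ g 3 := fun h => h3 0 3 1 (by decide) (by decide) (by decide) ⟨h0, h.symm⟩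
    have h2 : g 2 ≠ g 3 := fun h => h3 0 3 2 (by decide) (by decide) (by decide) ⟨h0, h.symm⟩
    refine ⟨0, 1, 2, by decide, by decide, by decide, by decide, by decide, by decide, h0, ?_,
      fun h => h1 (h.symm.trans h0)⟩
    by_contra h
    exact hd 1 2 3 h h1 h2
  by_cases h1 : g 1 = g 3
  · have h2 : g 2 ≠ g 3 := fun h => h3 1 3 2 (by decide) (by decide) (by decide) ⟨h1, h.symm⟩
    refine ⟨1, 0, 2, by decide, by decide, by decide, by decide, by decide, by decide, h1, ?_,
      fun h => h0 (h.symm.trans h1)⟩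
    by_contra h
    exact hd 0 2 3 h h0 h2
  have h01 : g 0 = g 1 := by
    by_contra h
    exact hd 0 1 3 h h0 h1
  have h2 : g 2 = g 3 := by
    by_contra h
    have h02 : g 0 ≠ g 2 := fun h => h3 0 2 1 (by decide) (by decide) (by decide)
      ⟨h, h.symm.trans h01⟩
    exact hd 0 2 3 h02 h0 h
  exact ⟨2, 0, 1, by decide, by decide, by decide, by decide, by decide, by decide, h2, h01,
    fun h => h0 (h.symm.trans h2)⟩

namespace Fine

variable {E C U Z : Set Pt} {ρ κ δ Λ D θ : ℝ}

lemma false_of_three (hF : Fine E ρ κ δ Λ D θ) (hP : Pieces E C U Z) (hZ : Z.ncard ≤ 3)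
    (hgap : ∀ W, IsComp U W → ∃ z z', Pieces.Gap E Z W z z') {a b c : Pt} (ha : a ∈ U) (hb : b ∈ U)
    (hc : c ∈ U) (haρ : ‖a‖ ≤ ρ) (hbρ : ‖b‖ ≤ ρ) (hcρ : ‖c‖ ≤ ρ)
    (hD : D ≤ |det2 (b - a) (c - a)|) : False := by
  have seen : ∀ x ∈ U, ‖x‖ ≤ ρ → ∃ z z', SeenGap E U Z ρ (connectedComponentIn U x) z z' := by
    intro x hx hxρ
    obtain ⟨z, z', h⟩ := hgap _ (IsComp.of_mem hx)
    exact ⟨z, z', IsComp.of_mem hx, h, x, mem_connectedComponentIn hx, hxρ⟩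
  have eq : ∀ x ∈ U, ‖x‖ ≤ ρ → ∀ y ∈ U, ‖y‖ ≤ ρ →
      connectedComponentIn U x = connectedComponentIn U y := by
    intro x hx hxρ y hy hyρ
    obtain ⟨_, _, h⟩ := seen x hx hxρ
    obtain ⟨_, _, h'⟩ := seen y hy hyρ
    by_contra hne
    exact hF.false_of_two_gaps hP hZ h h' hne
  have hb' : b ∈ connectedComponentIn U a := by
    rw [eq a ha haρ b hb hbρ]; exact mem_connectedComponentIn hb
  have hc' : c ∈ connectedComponentIn U a := by
    rw [eq a ha haρ c hc hcρ]; exact mem_connectedComponentIn hc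
  have := hF.abs_det2_lt (hP.chunk (IsComp.of_mem ha)) (mem_connectedComponentIn ha) hb' hc'
    haρ hbρ hcρ
  linarith

lemma false_of_four (hF : Fine E ρ κ δ Λ D θ) (hD0 : 0 < D) (hθ : 0 < θ) (hP : Pieces E C U Z)
    {f : Fin 4 → Pt} (hf : Blues ρ D θ f) (hfU : ∀ i, f i ∈ U)
    (h : Z.ncard ≤ 4 ∧ (∀ W, IsComp U W → ∃ z z', Pieces.Gap E Z W z z') ∨
      Z.ncard ≤ 3 ∧ ∃ y, Residual E U Z y) : False := by
  have hρ := hF.one_le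
  set g := fun i => connectedComponentIn U (f i) with hg
  have hcomp : ∀ i, IsComp U (g i) := fun i => IsComp.of_mem (hfU i)
  have hmem : ∀ i, f i ∈ g i := fun i => mem_connectedComponentIn (hfU i)
  have hmem' : ∀ {i j}, g i = g j → f j ∈ g i := fun h => h ▸ hmem _
  have seen : ∀ i, (∃ z z', Pieces.Gap E Z (g i) z z') → ∃ z z', SeenGap E U Z ρ (g i) z z' :=
    fun i ⟨z, z', h⟩ => ⟨z, z', hcomp i, h, f i, hmem i, hf.norm_le i⟩
  have h3 : ∀ i j k, i ≠ j → i ≠ k → j ≠ k → ¬ (g i = g j ∧ g j = g k) := by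
    rintro i j k hij hik hjk ⟨e1, e2⟩
    have := hF.abs_det2_lt (hP.chunk (hcomp i)) (hmem i) (hmem' e1) (hmem' (e1.trans e2))
      (hf.norm_le _) (hf.norm_le _) (hf.norm_le _)
    linarith [hf.triangle i j k hij hik hjk]
  rcases h with ⟨hZ, hgap⟩ | ⟨hZ, y, hy⟩
  · have hd : ∀ i j k, g i ≠ g j → g i ≠ g k → g j ≠ g k → False := by
      intro i j k hij hik hjk
      obtain ⟨_, _, g1⟩ := seen i (hgap _ (hcomp i))
      obtain ⟨_, _, g2⟩ := seen j (hgap _ (hcomp j))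
      obtain ⟨_, _, g3⟩ := seen k (hgap _ (hcomp k))
      exact hF.false_of_three_gaps hP hZ g1 g2 g3 hij hik hjk
    obtain ⟨i, j, k, hi, hj, hk, hij, hik, hjk, ei, ejk, hne⟩ := exists_two_two g h3 hd
    obtain ⟨_, _, g1⟩ := seen i (hgap _ (hcomp i))
    obtain ⟨_, _, g2⟩ := seen j (hgap _ (hcomp j))
    exact hF.false_of_two_pairs hP hZ g1 g2 hne (hmem i) (hmem' ei) (hmem j) (hmem' ejk)
      (hf.norm_le _) (hf.norm_le _) (hf.norm_le _) (hf.norm_le _)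
      (hf.pairs i 3 j k hi hij hik hj.symm hk.symm hjk)
  · have same : ∀ i j, ((∃ z z', Pieces.Gap E Z (g i) z z') ↔ ∃ z z', Pieces.Gap E Z (g j) z z') →
        g i = g j := by
      intro i j hij
      by_cases hi : ∃ z z', Pieces.Gap E Z (g i) z z'
      · obtain ⟨_, _, g1⟩ := seen i hi
        obtain ⟨_, _, g2⟩ := seen j (hij.1 hi)
        by_contra hne
        exact hF.false_of_two_gaps hP hZ g1 g2 hne
      · exact hy.unique _ _ (hcomp i) (hcomp j) hi fun h => hi (hij.2 h)
    have hd : ∀ i j k, g i ≠ g j → g i ≠ g k → g j ≠ g k → False := by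
      intro i j k hij hik hjk
      have h1 := mt (same i j) hij
      have h2 := mt (same i k) hik
      have h3 := mt (same j k) hjk
      rw [not_iff] at h1 h2
      exact h3 (h1.symm.trans h2)
    obtain ⟨i, j, k, hi, hj, hk, hij, hik, hjk, ei, ejk, hne⟩ := exists_two_two g h3 hd
    have touch : y ∈ closure (g i) → y ∈ closure (g j) → False := by
      intro hyi hyj
      refine hF.false_of_touching hθ (hP.chunk (hcomp i)) (hP.chunk (hcomp j)) ?_ hy.support hyi hyj
        (hmem i) (hmem' ei) (hmem j) (hmem' ejk)
        (hf.norm_le _) (hf.norm_le _) (hf.norm_le _) (hf.norm_le _)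
        (hf.pairs i 3 j k hi hij hik hj.symm hk.symm hjk) (hf.triangle i j k hij hik hjk)
        (hf.bary i j k hi hj hk hij hik hjk)
      rw [Set.disjoint_iff_inter_eq_empty, ← Set.not_nonempty_iff_eq_empty]
      exact fun h => hne ((hcomp i).eq_of_inter (hcomp j) h)
    have side : ∀ a b c d : Fin 4, a ≠ b → a ≠ c → a ≠ d → b ≠ c → b ≠ d → c ≠ d → g a = g b →
        g c = g d → g a ≠ g c → (∃ z z', Pieces.Gap E Z (g a) z z') →
        (¬ ∃ z z', Pieces.Gap E Z (g c) z z') → y ∈ closure (g a) := by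
      intro a b c d hab hac had hbc hbd hcd eab ecd hne hgap hngap
      obtain ⟨W₁, hW₁, ⟨p', s', hg₁⟩, hy₁⟩ := hy.neighbour _ (hcomp c) hngap
      have hy₂ := hy.mem_closure _ (hcomp c) hngap
      have hne' : W₁ ≠ g c := fun h => hngap ⟨p', s', h ▸ hg₁⟩
      by_cases e : g a = W₁
      · rwa [e]
      exfalso
      obtain ⟨p, q, hs⟩ := seen a hgap
      have finish : ∀ c d : Fin 4, g a ≠ g c → W₁ ≠ g c → y ∈ closure (g c) → IsComp U (g c) →
          g c = g d → D ≤ |det2 (f b - f a) (f d - f c)| →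
          D / (4 * ρ) ≤ ‖y - f c‖ → False := by
        intro c d hne hne' hy₂ hcc ecd hD hfar
        exact false_of_neighbour hP hZ hs.gap hs.comp hg₁ hW₁ e hcc hne' hy.notMem hy.support hy₁
          hy₂ (hmem c) (hF.mul_det2_pos hP hs (hP.chunk hcc) hy₂ (hmem a) (hmem' eab) (hmem c)
            (hmem' ecd) (hf.norm_le _) (hf.norm_le _) (hf.norm_le _) (hf.norm_le _) hD0 hD hfar)
      have hD := hf.pairs a b c d hab hac had hbc hbd hcd
      have hD' := hf.pairs a b d c hab had hac hbd hbc hcd.symm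
      by_cases hfar : D / (4 * ρ) ≤ ‖y - f c‖
      · exact finish c d hne hne' hy₂ (hcomp c) ecd hD hfar
      refine finish d c (ecd ▸ hne) (ecd ▸ hne') (ecd ▸ hy₂) (hcomp d) ecd.symm hD' ?_
      push Not at hfar
      have h1 : D / (2 * ρ) ≤ ‖f d - f c‖ := by
        rw [div_le_iff₀ (by positivity)]
        refine hD.trans ((_root_.abs_det2_le _ _).trans ?_)
        rw [mul_comm]
        refine mul_le_mul_of_nonneg_left ?_ (norm_nonneg _)
        exact (norm_sub_le _ _).trans (by linarith [hf.norm_le a, hf.norm_le b])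
      have h2 : D / (2 * ρ) = D / (4 * ρ) + D / (4 * ρ) := by field_simp; norm_num
      have h3 : ‖f d - f c‖ ≤ ‖y - f c‖ + ‖y - f d‖ := by
        have : f d - f c = (y - f c) - (y - f d) := by abel
        rw [this]; exact norm_sub_le _ _
      linarith
    by_cases hgi : ∃ z z', Pieces.Gap E Z (g i) z z'
    · have hgj : ¬ ∃ z z', Pieces.Gap E Z (g j) z z' := fun h =>
        hne (same i j ⟨fun _ => h, fun _ => hgi⟩)
      exact touch (side i 3 j k hi hij hik hj.symm hk.symm hjk ei ejk hne hgi hgj)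
        (hy.mem_closure _ (hcomp j) hgj)
    · have hgj : ∃ z z', Pieces.Gap E Z (g j) z z' := by
        by_contra h
        exact hne (same i j ⟨fun h' => absurd h' hgi, fun h' => absurd h' h⟩)
      exact touch (hy.mem_closure _ (hcomp i) hgi)
        (side j k i 3 hjk hij.symm hj hik.symm hk hi ejk ei hne.symm hgj hgi)

end Fine

/-! ### Dense sets in strong general position -/

lemma det2_triple_rot (p q r : Pt) : det2 (q - p) (r - p) = det2 (r - q) (p - q) := by
  simp [det2]; ring

lemma NoThreeCollinear.insert {S : Set Pt} (hS : NoThreeCollinear S) {x : Pt}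
    (hx : ∀ p ∈ S, ∀ q ∈ S, p ≠ q → det2 (q - p) (x - p) ≠ 0) :
    NoThreeCollinear (insert x S) := by
  rintro p (rfl | hp) q (rfl | hq) r (rfl | hr) hpq hpr hqr
  · exact absurd rfl hpq
  · exact absurd rfl hpq
  · exact absurd rfl hpr
  · rw [det2_triple_rot]; exact hx q hq r hr hqr
  · exact absurd rfl hqr
  · rw [det2_triple_rot, det2_triple_rot]; exact hx r hr p hp hpr.symm
  · exact hx p hp q hq hpq
  · exact hS p hp q hq r hr hpq hpr hqr

lemma StrongGenPos.insert {S : Set Pt} (hS : StrongGenPos S) {x : Pt}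
    (hx : ∀ p ∈ S, ∀ q ∈ S, ∀ s ∈ S, p ≠ q → det2 (q - p) (x - s) ≠ 0) :
    StrongGenPos (insert x S) := by
  refine ⟨hS.1.insert fun p hp q hq => hx p hp q hq p hp, ?_⟩
  rintro p₁ (rfl | h₁) p₂ (rfl | h₂) p₃ (rfl | h₃) p₄ (rfl | h₄) h12 h13 h14 h23 h24 h34
  case inr.inr.inr.inr => exact hS.2 p₁ h₁ p₂ h₂ p₃ h₃ p₄ h₄ h12 h13 h14 h23 h24 h34
  case inr.inr.inr.inl => exact hx p₁ h₁ p₂ h₂ p₃ h₃ h12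
  case inr.inr.inl.inr =>
    rw [← neg_sub p₃, det2_neg_right]
    exact neg_ne_zero.2 (hx p₁ h₁ p₂ h₂ p₄ h₄ h12)
  case inr.inl.inr.inr =>
    rw [det2_swap]
    exact neg_ne_zero.2 (hx p₃ h₃ p₄ h₄ p₁ h₁ h34)
  case inl.inr.inr.inr =>
    rw [det2_swap, ← neg_sub p₁, det2_neg_right, neg_neg]
    exact hx p₃ h₃ p₄ h₄ p₂ h₂ h34
  all_goals contradiction

lemma StrongGenPos.exists_insert {S : Finset Pt} (hS : StrongGenPos (S : Set Pt)) {O : Set Pt}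
    (hO : IsOpen O) (hne : O.Nonempty) :
    ∃ x ∈ O, x ∉ S ∧ StrongGenPos (Insert.insert x (S : Set Pt)) := by
  obtain ⟨x, hxO, hx⟩ := exists_mem_det2_ne_zero hO hne
    ((S.image fun s => (mkPt 1 0, s)) ∪
      ((S ×ˢ S ×ˢ S).filter fun t => t.1 ≠ t.2.1).image fun t => (t.2.1 - t.1, t.2.2)) (by
    intro f hf
    rcases Finset.mem_union.1 hf with hf | hf
    · obtain ⟨s, -, rfl⟩ := Finset.mem_image.1 hf
      exact mkPt_one_zero_ne
    · obtain ⟨t, ht, rfl⟩ := Finset.mem_image.1 hf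
      exact sub_ne_zero.2 (Finset.mem_filter.1 ht).2.symm)
  refine ⟨x, hxO, fun hxS => ?_, hS.insert fun p hp q hq s hs hpq => ?_⟩
  · exact hx _ (Finset.mem_union_left _ (Finset.mem_image_of_mem _ hxS)) (by simp)
  · refine hx (q - p, s) (Finset.mem_union_right _ (Finset.mem_image.2 ⟨(p, q, s), ?_, rfl⟩))
    simp only [Finset.mem_filter, Finset.mem_product]
    exact ⟨⟨hp, hq, hs⟩, hpq⟩

lemma StrongGenPos.exists_meeting {B : Finset Pt} (hB : StrongGenPos (B : Set Pt)) {δ : ℝ}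
    (hδ : 0 < δ) (T : Finset Pt) :
    ∃ R : Finset Pt, Disjoint B R ∧ StrongGenPos (↑B ∪ ↑R : Set Pt) ∧
      ∀ t ∈ T, ∃ r ∈ R, dist t r < δ := by
  induction T using Finset.induction_on with
  | empty => exact ⟨∅, by simp, by simpa using hB, by simp⟩
  | insert t T _ ih =>
    obtain ⟨R, hd, hR, hT⟩ := ih
    rw [← Finset.coe_union] at hR
    obtain ⟨x, hx, hxS, hxR⟩ := hR.exists_insert Metric.isOpen_ball
      ⟨t, Metric.mem_ball_self hδ⟩
    refine ⟨Insert.insert x R, ?_, ?_, ?_⟩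
    · rw [Finset.disjoint_insert_right]
      exact ⟨fun h => hxS (Finset.mem_union_left _ h), hd⟩
    · rwa [Finset.coe_insert, Set.union_insert, ← Finset.coe_union]
    · intro s hs
      rcases Finset.mem_insert.1 hs with rfl | hs
      · exact ⟨x, Finset.mem_insert_self _ _, by rwa [dist_comm]⟩
      · obtain ⟨r, hr, h⟩ := hT s hs
        exact ⟨r, Finset.mem_insert_of_mem hr, h⟩

/-- A finite set in strong general position extends to one containing a fine net of a disc. -/
lemma StrongGenPos.exists_net {B : Finset Pt} (hB : StrongGenPos (B : Set Pt)) {δ : ℝ}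
    (hδ : 0 < δ) (L : ℝ) :
    ∃ R : Finset Pt, Disjoint B R ∧ StrongGenPos (↑B ∪ ↑R : Set Pt) ∧
      ∀ x : Pt, ‖x‖ ≤ L → ∃ r ∈ R, dist x r < δ := by
  obtain ⟨T, -, hT, hcov⟩ := (isCompact_closedBall (0 : Pt) L).finite_cover_balls (half_pos hδ)
  obtain ⟨R, hd, hR, hTR⟩ := hB.exists_meeting (half_pos hδ) hT.toFinset
  refine ⟨R, hd, hR, fun x hx => ?_⟩
  obtain ⟨t, ht, hxt⟩ := Set.mem_iUnion₂.1 (hcov (mem_closedBall_zero_iff.2 hx))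
  obtain ⟨r, hr, htr⟩ := hTR t (hT.mem_toFinset.2 ht)
  exact ⟨r, hr, by linarith [dist_triangle x t r, Metric.mem_ball.1 hxt]⟩

/-! ### Three points, and four points not in convex position -/

lemma NoThreeCollinear.strongGenPos_of_card_eq_three {B : Finset Pt}
    (hB : NoThreeCollinear (B : Set Pt)) (h3 : B.card = 3) : StrongGenPos (B : Set Pt) := by
  refine ⟨hB, fun a ha b hb c hc d hd hab hac had hbc hbd hcd => ?_⟩
  have : ({a, b, c, d} : Finset Pt).card ≤ B.card := Finset.card_le_card (by
    intro x hx
    simp only [Finset.mem_insert, Finset.mem_singleton] at hx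
    rcases hx with rfl | rfl | rfl | rfl <;> assumption)
  have h4 : ({a, b, c, d} : Finset Pt).card = 4 := by simp [*]
  omega

lemma NoThreeCollinear.exists_bary {B : Finset Pt} (hB : NoThreeCollinear (B : Set Pt))
    (h4 : B.card = 4) {p a b c : Pt} (hpB : p ∈ B)
    (hp : p ∈ convexHull ℝ (↑(B.erase p) : Set Pt)) (ha : a ∈ B) (hb : b ∈ B) (hc : c ∈ B)
    (hpa : p ≠ a) (hpb : p ≠ b) (hpc : p ≠ c) (hab : a ≠ b) (hac : a ≠ c) (hbc : b ≠ c) :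
    ∃ α β γ : ℝ, 0 < α ∧ 0 < β ∧ 0 < γ ∧ α + β + γ = 1 ∧ p = α • a + β • b + γ • c := by
  have he : ({a, b, c} : Finset Pt) = B.erase p := by
    refine Finset.eq_of_subset_of_card_le ?_ ?_
    · intro x hx
      simp only [Finset.mem_insert, Finset.mem_singleton] at hx
      rcases hx with rfl | rfl | rfl <;> simp [*, Ne.symm]
    · rw [Finset.card_erase_of_mem hpB, h4]
      simp [*]
  rw [← he, Finset.mem_convexHull'] at hp
  obtain ⟨w, hw0, hw1, hw⟩ := hp
  rw [Finset.sum_insert (by simp [*]), Finset.sum_insert (by simp [*]),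
    Finset.sum_singleton] at hw1 hw
  have pos : ∀ x y z : Pt, ∀ s t u : ℝ, p ≠ y → p ≠ z → y ≠ z → y ∈ B → z ∈ B → 0 ≤ s →
      s + t + u = 1 → s • x + t • y + u • z = p → 0 < s := by
    intro x y z s t u hy hz hyz hyB hzB hs h1 he
    refine hs.lt_of_ne ?_
    rintro rfl
    refine hB y hyB z hzB p hpB hyz hy.symm hz.symm ?_
    rw [← he, show t = 1 - u by linarith, show (0 : ℝ) • x + (1 - u) • y + u • z - y = u • (z - y)
      by module, det2_smul_right, det2_self, mul_zero]
  refine ⟨w a, w b, w c, ?_, ?_, ?_, by linarith, by rw [← hw]; abel⟩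
  · exact pos a b c _ (w b) (w c) hpb hpc hbc hb hc (hw0 a (by simp)) (by linarith)
      (by rw [← hw]; abel)
  · exact pos b a c _ (w a) (w c) hpa hpc hac ha hc (hw0 b (by simp)) (by linarith)
      (by rw [← hw]; abel)
  · exact pos c a b _ (w a) (w b) hpa hpb hab ha hb (hw0 c (by simp)) (by linarith)
      (by rw [← hw]; abel)

lemma NoThreeCollinear.strongGenPos_of_mem_convexHull {B : Finset Pt}
    (hB : NoThreeCollinear (B : Set Pt)) (h4 : B.card = 4) {p : Pt} (hpB : p ∈ B)
    (hp : p ∈ convexHull ℝ (↑(B.erase p) : Set Pt)) : StrongGenPos (B : Set Pt) := by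
  refine ⟨hB, fun a ha b hb c hc d hd hab hac had hbc hbd hcd => ?_⟩
  have key : ∀ x ∈ B, ∀ y ∈ B, ∀ z ∈ B, p ≠ x → p ≠ y → p ≠ z → x ≠ y → x ≠ z → y ≠ z →
      det2 (x - p) (z - y) ≠ 0 := by
    intro x hx y hy z hz hpx hpy hpz hxy hxz hyz
    obtain ⟨α, β, γ, -, hβ, hγ, h1, he⟩ := hB.exists_bary h4 hpB hp hx hy hz hpx hpy hpz hxy hxz hyz
    have : det2 (x - p) (z - y) = -((β + γ) * det2 (y - x) (z - x)) := by
      rw [he, show α = 1 - β - γ by linarith]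
      simp [det2]; ring
    rw [this]
    exact neg_ne_zero.2 (mul_ne_zero (by positivity) (hB x hx y hy z hz hxy hxz hyz))
  have he : ({a, b, c, d} : Finset Pt) = B := by
    refine Finset.eq_of_subset_of_card_le ?_ ?_
    · intro x hx
      simp only [Finset.mem_insert, Finset.mem_singleton] at hx
      rcases hx with rfl | rfl | rfl | rfl <;> assumption
    · rw [h4]; simp [*]
  have hp4 := hpB
  rw [← he] at hp4
  simp only [Finset.mem_insert, Finset.mem_singleton] at hp4
  rcases hp4 with rfl | rfl | rfl | rfl
  · exact key b hb c hc d hd hab hac had hbc hbd hcd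
  · rw [← neg_sub, det2_neg_left]
    exact neg_ne_zero.2 (key a ha c hc d hd hab.symm hbc hbd hac had hcd)
  · rw [det2_swap]
    exact neg_ne_zero.2 (key d hd a ha b hb hcd hac.symm hbc.symm had.symm hbd.symm hab)
  · rw [det2_swap, ← neg_sub, det2_neg_left, neg_neg]
    exact key c hc a ha b hb hcd.symm had.symm hbd.symm hac.symm hbc.symm hab

lemma exists_pos_le_of_finite {ι : Type*} [Finite ι] (P : ι → Prop) (g : ι → ℝ)
    (h : ∀ i, P i → 0 < g i) : ∃ D > 0, ∀ i, P i → D ≤ g i := by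
  by_cases hne : Nonempty {i // P i}
  · obtain ⟨i₀, hi₀⟩ := Finite.exists_min fun i : {i // P i} => g i
    exact ⟨g i₀, h i₀ i₀.2, fun i hi => hi₀ ⟨i, hi⟩⟩
  · exact ⟨1, one_pos, fun i hi => absurd ⟨i, hi⟩ hne⟩

lemma exists_blues {f : Fin 4 → Pt} (hf : Function.Injective f)
    (hS : StrongGenPos (Set.range f)) {ρ : ℝ} (hρ : ∀ i, ‖f i‖ ≤ ρ)
    (hbary : ∀ i j k, i ≠ 3 → j ≠ 3 → k ≠ 3 → i ≠ j → i ≠ k → j ≠ k →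
      ∃ α β γ : ℝ, 0 < α ∧ 0 < β ∧ 0 < γ ∧ α + β + γ = 1 ∧ f 3 = α • f i + β • f j + γ • f k) :
    ∃ D θ, 0 < D ∧ 0 < θ ∧ Blues ρ D θ f := by
  obtain ⟨D₁, hD₁, h₁⟩ := exists_pos_le_of_finite
    (fun t : Fin 4 × Fin 4 × Fin 4 => t.1 ≠ t.2.1 ∧ t.1 ≠ t.2.2 ∧ t.2.1 ≠ t.2.2)
    (fun t => |det2 (f t.2.1 - f t.1) (f t.2.2 - f t.1)|) fun t ⟨h1, h2, h3⟩ =>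
      abs_pos.2 (hS.1 _ ⟨_, rfl⟩ _ ⟨_, rfl⟩ _ ⟨_, rfl⟩ (hf.ne h1) (hf.ne h2) (hf.ne h3))
  obtain ⟨D₂, hD₂, h₂⟩ := exists_pos_le_of_finite
    (fun t : Fin 4 × Fin 4 × Fin 4 × Fin 4 => t.1 ≠ t.2.1 ∧ t.1 ≠ t.2.2.1 ∧ t.1 ≠ t.2.2.2 ∧
      t.2.1 ≠ t.2.2.1 ∧ t.2.1 ≠ t.2.2.2 ∧ t.2.2.1 ≠ t.2.2.2)
    (fun t => |det2 (f t.2.1 - f t.1) (f t.2.2.2 - f t.2.2.1)|) fun t ⟨h1, h2, h3, h4, h5, h6⟩ =>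
      abs_pos.2 (hS.2 _ ⟨_, rfl⟩ _ ⟨_, rfl⟩ _ ⟨_, rfl⟩ _ ⟨_, rfl⟩ (hf.ne h1) (hf.ne h2) (hf.ne h3)
        (hf.ne h4) (hf.ne h5) (hf.ne h6))
  choose! α β γ hα hβ hγ hsum heq using hbary
  obtain ⟨θ, hθ, h₃⟩ := exists_pos_le_of_finite
    (fun t : Fin 4 × Fin 4 × Fin 4 => t.1 ≠ 3 ∧ t.2.1 ≠ 3 ∧ t.2.2 ≠ 3 ∧ t.1 ≠ t.2.1 ∧ t.1 ≠ t.2.2 ∧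
      t.2.1 ≠ t.2.2)
    (fun t => min (α t.1 t.2.1 t.2.2) (min (β t.1 t.2.1 t.2.2) (γ t.1 t.2.1 t.2.2)))
    fun t ⟨h1, h2, h3, h4, h5, h6⟩ => lt_min (hα _ _ _ h1 h2 h3 h4 h5 h6)
      (lt_min (hβ _ _ _ h1 h2 h3 h4 h5 h6) (hγ _ _ _ h1 h2 h3 h4 h5 h6))
  refine ⟨min D₁ D₂, θ, lt_min hD₁ hD₂, hθ, hρ, ?_, ?_, ?_⟩
  · exact fun i j k h1 h2 h3 => (min_le_left _ _).trans (h₁ (i, j, k) ⟨h1, h2, h3⟩)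
  · exact fun i j k l h1 h2 h3 h4 h5 h6 =>
      (min_le_right _ _).trans (h₂ (i, j, k, l) ⟨h1, h2, h3, h4, h5, h6⟩)
  · intro i j k h1 h2 h3 h4 h5 h6
    have h := h₃ (i, j, k) ⟨h1, h2, h3, h4, h5, h6⟩
    simp only [le_min_iff] at h
    exact ⟨_, _, _, h.1, h.2.1, h.2.2, hsum i j k h1 h2 h3 h4 h5 h6, heq i j k h1 h2 h3 h4 h5 h6⟩

lemma exists_norm_le (B : Finset Pt) : ∃ ρ : ℝ, 1 ≤ ρ ∧ ∀ b ∈ B, ‖b‖ ≤ ρ := by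
  obtain ⟨M, hM⟩ := B.finite_toSet.isBounded.subset_closedBall 0
  exact ⟨max 1 M, le_max_left _ _, fun b hb =>
    (mem_closedBall_zero_iff.1 (hM hb)).trans (le_max_right _ _)⟩

/-- A fine enough net `R` forces any polygon separating `B` from `R` to have many convex
vertices, in terms of the pieces of its outer region. -/
lemma StrongGenPos.exists_not_separable {B : Finset Pt} (hB : StrongGenPos (B : Set Pt))
    (hB4 : B.card ≤ 4) {ρ D θ : ℝ} (hρ : 1 ≤ ρ) (hBρ : ∀ b ∈ B, ‖b‖ ≤ ρ) (hD : 0 < D)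
    (h : ∀ (κ δ Λ : ℝ) (E C U Z : Set Pt), Fine E ρ κ δ Λ D θ → Pieces E C U Z → (∀ b ∈ B, b ∈ U) →
      (Z.ncard ≤ B.card ∧ (∀ W, IsComp U W → ∃ z z', Pieces.Gap E Z W z z') ∨
        Z.ncard < B.card ∧ ∃ y, Residual E U Z y) → False) :
    ∃ R : Finset Pt, Disjoint B R ∧ StrongGenPos (↑B ∪ ↑R : Set Pt) ∧ ¬ Separable B R := by
  obtain ⟨κ, δ, Λ, hc⟩ := exists_consts (θ := θ) hρ hD
  obtain ⟨R, hd, hR, hnet⟩ := hB.exists_net hc.δ_pos (Λ + δ + 3 * ρ + 2)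
  refine ⟨R, hd, hR, fun hsep => ?_⟩
  obtain ⟨E, C, hO, hC, hRE, hBE⟩ := hsep.exists_outerRegion
  have hdense : ∀ x : Pt, ‖x‖ ≤ Λ + δ + 3 * ρ + 2 → ∃ r ∉ E, dist x r < δ := by
    intro x hx
    obtain ⟨r, hr, hxr⟩ := hnet x hx
    exact ⟨r, hRE r hr, hxr⟩
  have hball : Metric.ball 0 Λ ⊆ interior (convexHull ℝ Eᶜ) :=
    (Metric.ball_subset_ball (by linarith)).trans (hO.ball_subset_hull hc.δ_pos hdense)
  have hΛ := hc.le_Λ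
  obtain ⟨U, Z, hP, hBU, hZ, hgap⟩ := hO.exists_pieces
    ⟨0, hball (Metric.mem_ball_self (by linarith))⟩ (hC.trans hB4) B hBE fun b hb =>
      hball (mem_ball_zero_iff.2 (by linarith [hBρ b hb]))
  refine h κ δ Λ E C U Z ⟨hc, hdense, hball⟩ hP hBU ?_
  rcases hgap with hgap | ⟨hlt, hy⟩
  · exact Or.inl ⟨hZ.trans hC, hgap⟩
  · exact Or.inr ⟨hlt.trans_le hC, hy⟩

lemma NoThreeCollinear.exists_not_separable_of_card_eq_three {B : Finset Pt}
    (hB : NoThreeCollinear (B : Set Pt)) (h3 : B.card = 3) :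
    ∃ R : Finset Pt, Disjoint B R ∧ StrongGenPos (↑B ∪ ↑R : Set Pt) ∧ ¬ Separable B R := by
  obtain ⟨ρ, hρ, hBρ⟩ := exists_norm_le B
  have hS := hB.strongGenPos_of_card_eq_three h3
  obtain ⟨a, b, c, hab, hac, hbc, rfl⟩ := Finset.card_eq_three.1 h3
  have hD := hB a (by simp) b (by simp) c (by simp) hab hac hbc
  refine hS.exists_not_separable (θ := 1) (by omega) hρ hBρ (abs_pos.2 hD)
    fun κ δ Λ E C U Z hF hP hU h => ?_
  rw [h3] at h
  rcases h with ⟨hZ, hgap⟩ | ⟨hZ, -⟩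
  · exact hF.false_of_three hP hZ hgap (hU a (by simp)) (hU b (by simp)) (hU c (by simp))
      (hBρ a (by simp)) (hBρ b (by simp)) (hBρ c (by simp)) le_rfl
  · have := three_le_ncard_of_subset_convexHull hP.nonempty hP.finite hP.hull_subset
    omega

lemma NoThreeCollinear.exists_not_separable_of_mem_convexHull {B : Finset Pt}
    (hB : NoThreeCollinear (B : Set Pt)) (h4 : B.card = 4) {p : Pt} (hpB : p ∈ B)
    (hp : p ∈ convexHull ℝ (↑(B.erase p) : Set Pt)) :
    ∃ R : Finset Pt, Disjoint B R ∧ StrongGenPos (↑B ∪ ↑R : Set Pt) ∧ ¬ Separable B R := by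
  obtain ⟨ρ, hρ, hBρ⟩ := exists_norm_le B
  have hS := hB.strongGenPos_of_mem_convexHull h4 hpB hp
  obtain ⟨f, hf, hfB, hf3⟩ : ∃ f : Fin 4 → Pt, Function.Injective f ∧ Set.range f = B ∧ f 3 = p := by
    let e := B.equivFinOfCardEq h4
    let g := e.symm.trans (Equiv.swap ⟨p, hpB⟩ (e.symm 3))
    refine ⟨fun i => g i, Subtype.val_injective.comp g.injective, ?_, ?_⟩
    · ext x
      constructor
      · rintro ⟨i, rfl⟩; exact (g i).2
      · intro hx; exact ⟨g.symm ⟨x, hx⟩, by simp⟩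
    · simp [g]
  have hmem : ∀ i, f i ∈ B := fun i => by
    rw [← Finset.mem_coe, ← hfB]; exact ⟨i, rfl⟩
  obtain ⟨D, θ, hD, hθ, hblues⟩ := exists_blues hf (hfB ▸ hS) (fun i => hBρ _ (hmem i))
    fun i j k hi hj hk hij hik hjk => by
      rw [hf3]
      exact hB.exists_bary h4 hpB hp (hmem i) (hmem j) (hmem k) (hf3 ▸ hf.ne hi.symm)
        (hf3 ▸ hf.ne hj.symm) (hf3 ▸ hf.ne hk.symm) (hf.ne hij) (hf.ne hik) (hf.ne hjk)
  refine hS.exists_not_separable (θ := θ) (by omega) hρ hBρ hD fun κ δ Λ E C U Z hF hP hU h => ?_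
  rw [h4] at h
  exact hF.false_of_four hD hθ hP hblues (fun i => hU _ (hmem i)) (h.imp_right fun h =>
    ⟨Nat.lt_succ_iff.1 h.1, h.2⟩)

/-- For any set `B` of three points, or of four points not in convex position,
there exists a set `R` from which `B` is not separable. -/
theorem three_or_nonconvex_four_not_always_separable
    (B : Finset Pt) (hcol : NoThreeCollinear (↑B : Set Pt))
    (h : B.card = 3 ∨
      (B.card = 4 ∧ ∃ p ∈ B, p ∈ convexHull ℝ (↑(B.erase p) : Set Pt))) :
    ∃ R : Finset Pt, Disjoint B R ∧ StrongGenPos ((↑B ∪ ↑R : Set Pt)) ∧ ¬ Separable B R := by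
  rcases h with h3 | ⟨h4, p, hpB, hp⟩
  · exact hcol.exists_not_separable_of_card_eq_three h3
  · exact hcol.exists_not_separable_of_mem_convexHull h4 hpB hp
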